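/- Let K be a local field, L/K a finite totally ramified abelian extension of degree n, and K'/K the unramified extension of degree n. Then the norm map N_{K'/K} induces an isomorphism O_{K'}^× / N_{L'/K'}(O_{L'}^×) ≅ O_K^× / N_{L/K}(O_L^×), where L' = K'L. -/

import Mathlib

local notation "Γ₀" => WithZero (Multiplicative ℤ)

section

open Polynomial

/-- Every nonzero element of `S` has absolute value an integral power of `r`. -/
def HasValueBase {E : Type*} [NormedField E] (S : Subfield E) (r : ℝ) : Prop :=
  ∀ x ∈ S, x ≠ 0 → ∃ k : ℤ, ‖x‖ = r ^ k

/-- Integral polynomials whose reduction is not constant have approximate roots in `S`. -/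
def ResiduallySolvable {E : Type*} [NormedField E] (S : Subfield E) : Prop :=
  ∀ f : E[X], (∀ j, ‖f.coeff j‖ ≤ 1) → (∃ j, 1 ≤ j ∧ ‖f.coeff j‖ = 1) →
    ∃ x ∈ S, ‖x‖ ≤ 1 ∧ ‖f.eval x‖ < 1

lemma HasValueBase.le_pow_succ {E : Type*} [NormedField E] {S : Subfield E} {r : ℝ}
    (h : HasValueBase S r) (h0 : 0 < r) (h1 : r < 1) {x : E} (hx : x ∈ S) {i : ℕ}
    (hlt : ‖x‖ < r ^ i) : ‖x‖ ≤ r ^ (i + 1) := by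
  rcases eq_or_ne x 0 with rfl | hx0
  · simp; positivity
  obtain ⟨k, hk⟩ := h x hx hx0
  rw [hk] at hlt ⊢
  rw [← zpow_natCast, zpow_lt_zpow_iff_right_of_lt_one₀ h0 h1] at hlt
  rw [← zpow_natCast, zpow_le_zpow_iff_right_of_lt_one₀ h0 h1]
  push_cast
  omega

lemma norm_sub_le_max_of_ultrametric {E : Type*} [NormedField E] [IsUltrametricDist E] (x y : E) :
    ‖x - y‖ ≤ max ‖x‖ ‖y‖ := by
  simpa [sub_eq_add_neg] using IsUltrametricDist.norm_add_le_max x (-y)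

lemma norm_sub_eq_max_of_ne {E : Type*} [NormedField E] [IsUltrametricDist E] {x y : E}
    (h : ‖x‖ ≠ ‖y‖) : ‖x - y‖ = max ‖x‖ ‖y‖ := by
  simpa [sub_eq_add_neg] using
    IsUltrametricDist.norm_add_eq_max_of_norm_ne_norm (x := x) (y := -y) (by simpa using h)

lemma norm_eq_one_of_norm_sub_one_lt {E : Type*} [NormedField E] [IsUltrametricDist E] {x : E}
    (h : ‖x - 1‖ < 1) : ‖x‖ = 1 := by
  have := IsUltrametricDist.norm_add_eq_max_of_norm_ne_norm (x := x - 1) (y := 1)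
    (by rw [norm_one]; exact h.ne)
  simpa [h.le] using this

/-- Successive approximation for a multiplicative map `f` from `S` to `B`. -/
lemma exists_map_eq_of_approx {E : Type*} [NormedField E] [CompleteSpace E] [IsUltrametricDist E]
    (S B : Subfield E) (hS : IsClosed (S : Set E)) (f : E → E) {r s : ℝ}
    (hr0 : 0 < r) (hr1 : r < 1) (hs0 : 0 < s) (hs1 : s < 1)
    (f_mul : ∀ x y, f (x * y) = f x * f y) (f_norm : ∀ x, ‖x‖ = 1 → ‖f x‖ = 1)
    (f_cont : ∀ x, ‖x‖ = 1 → ContinuousAt f x) (f_mem : ∀ x ∈ S, f x ∈ B) (f_one : f 1 = 1)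
    (step : ∀ i : ℕ, 1 ≤ i → ∀ b ∈ B, ‖b - 1‖ ≤ r ^ i →
      ∃ x ∈ S, ‖x - 1‖ ≤ s ^ i ∧ ‖b - f x‖ ≤ r ^ (i + 1))
    {b : E} (hb : b ∈ B) (hbr : ‖b - 1‖ ≤ r) :
    ∃ a ∈ S, ‖a‖ = 1 ∧ f a = b := by
  let P : ℕ → E → Prop := fun i y => y ∈ S ∧ ‖y‖ = 1 ∧ ‖b - f y‖ ≤ r ^ (i + 1)
  have key : ∀ (i : ℕ) (y : E), P i y → ∃ y', P (i + 1) y' ∧ ‖y' - y‖ ≤ s ^ (i + 1) := by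
    rintro i y ⟨hyS, hy1, hy⟩
    have hfy := f_norm y hy1
    have hfy0 : f y ≠ 0 := by intro h; rw [h] at hfy; simp at hfy
    obtain ⟨x, hxS, hx1, hx⟩ := step (i + 1) (by omega) (b / f y) (B.div_mem hb (f_mem y hyS)) (by
      rw [div_sub_one hfy0, norm_div, hfy, div_one]; exact hy)
    have hx' : ‖x‖ = 1 := norm_eq_one_of_norm_sub_one_lt
      (hx1.trans_lt (pow_lt_one₀ hs0.le hs1 (by omega)))
    refine ⟨y * x, ⟨S.mul_mem hyS hxS, by simp [hy1, hx'], ?_⟩, ?_⟩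
    · have : b - f (y * x) = f y * (b / f y - f x) := by rw [f_mul]; field_simp
      rw [this, norm_mul, hfy, one_mul]; exact hx
    · rw [show y * x - y = y * (x - 1) by ring, norm_mul, hy1, one_mul]; exact hx1
  have h0 : P 0 1 := ⟨S.one_mem, by simp, by simpa [f_one] using hbr⟩
  choose! g hg using key
  let Y : ℕ → E := fun n => Nat.rec 1 (fun i y => g i y) n
  have hY : ∀ n, P n (Y n) := by
    intro n
    induction n with
    | zero => exact h0
    | succ n ih => exact (hg n _ ih).1
  have hd : ∀ n, dist (Y n) (Y (n + 1)) ≤ s * s ^ n := by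
    intro n
    rw [dist_comm, dist_eq_norm, ← pow_succ']
    exact (hg n _ (hY n)).2
  obtain ⟨a, ha⟩ := cauchySeq_tendsto_of_complete (cauchySeq_of_le_geometric s s hs1 hd)
  have haS : a ∈ S := hS.mem_of_tendsto ha (Filter.Eventually.of_forall fun n => (hY n).1)
  have ha1 : ‖a‖ = 1 := by
    have h := ha.norm
    have h2 : (fun n => ‖Y n‖) = fun _ => (1 : ℝ) := funext fun n => (hY n).2.1
    rw [h2] at h
    exact tendsto_nhds_unique h tendsto_const_nhds
  refine ⟨a, haS, ha1, ?_⟩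
  have h1 := (f_cont a ha1).tendsto.comp ha
  refine tendsto_nhds_unique h1 ?_
  rw [tendsto_iff_norm_sub_tendsto_zero]
  have h3 : Filter.Tendsto (fun n : ℕ => r * r ^ n) Filter.atTop (nhds 0) := by
    simpa using (tendsto_pow_atTop_nhds_zero_of_lt_one hr0.le hr1).const_mul r
  refine squeeze_zero (fun _ => norm_nonneg _) (fun n => ?_) h3
  rw [norm_sub_rev, ← pow_succ']
  exact (hY n).2.2

/-- A Frobenius-type automorphism `ψ` of a complete field with algebraically closed residue field:
every unit is of the form `ψ(d) / d`. -/
lemma exists_map_div_eq {E : Type*} [NormedField E] [CompleteSpace E] [IsUltrametricDist E]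
    (S : Subfield E) (hS : IsClosed (S : Set E)) (hsol : ResiduallySolvable S) {ϖ : E}
    (hϖ : ϖ ∈ S) (hϖ0 : 0 < ‖ϖ‖) (hϖ1 : ‖ϖ‖ < 1) (hval : HasValueBase S ‖ϖ‖)
    (ψ : E ≃+* E) (hψ : ∀ x, ‖ψ x‖ = ‖x‖) (hψS : ∀ x ∈ S, ψ x ∈ S) (hψϖ : ψ ϖ = ϖ) {Q : ℕ}
    (hQ : 2 ≤ Q) (hfrob : ∀ x, ‖x‖ ≤ 1 → ‖ψ x - x ^ Q‖ < 1) {u : E} (hu : u ∈ S)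
    (hu1 : ‖u‖ = 1) : ∃ d ∈ S, ‖d‖ = 1 ∧ ψ d = u * d := by
  have hcont : Continuous ψ :=
    (AddMonoidHomClass.isometry_of_norm ψ hψ).continuous
  have hϖne : ϖ ≠ 0 := norm_pos_iff.1 hϖ0
  -- approximate solution
  obtain ⟨d₀, hd₀S, hd₀, hd₀u⟩ : ∃ d ∈ S, ‖d‖ = 1 ∧ ‖ψ d - u * d‖ < 1 := by
    obtain ⟨x, hxS, hx1, hx⟩ := hsol (X ^ (Q - 1) - C u)
      (fun j => by
        rw [coeff_sub, coeff_X_pow, coeff_C]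
        refine (norm_sub_le_max_of_ultrametric _ _).trans (max_le ?_ ?_)
        · split_ifs <;> simp
        · split_ifs <;> simp [hu1])
      ⟨Q - 1, by omega, by
        rw [coeff_sub, coeff_X_pow, coeff_C, if_pos rfl, if_neg (by omega)]; simp⟩
    simp only [eval_sub, eval_pow, eval_X, eval_C] at hx
    have hx' : ‖x ^ (Q - 1)‖ = 1 := by
      rw [← hu1]
      by_contra hne
      have := norm_sub_eq_max_of_ne hne
      rw [this, hu1] at hx
      exact absurd (lt_of_le_of_lt (le_max_right _ _) hx) (lt_irrefl _)
    have hxn : ‖x‖ = 1 := by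
      rw [norm_pow] at hx'
      exact (pow_eq_one_iff_of_nonneg (norm_nonneg _) (by omega)).1 hx'
    refine ⟨x, hxS, hxn, ?_⟩
    have h2 : ψ x - u * x = (ψ x - x ^ Q) + x * (x ^ (Q - 1) - u) := by
      have : x ^ Q = x * x ^ (Q - 1) := by rw [← pow_succ']; congr 1; omega
      rw [this]; ring
    rw [h2]
    refine (IsUltrametricDist.norm_add_le_max _ _).trans_lt (max_lt (hfrob x hx1) ?_)
    rw [norm_mul, hxn, one_mul]; exact hx
  have hd₀0 : d₀ ≠ 0 := by rintro rfl; simp at hd₀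
  have hψd₀0 : ψ d₀ ≠ 0 := by simpa using hd₀0
  have hb : ‖u * d₀ / ψ d₀ - 1‖ < 1 := by
    rw [div_sub_one hψd₀0, norm_div, hψ, hd₀, div_one, norm_sub_rev]; exact hd₀u
  have hbS : u * d₀ / ψ d₀ ∈ S := S.div_mem (S.mul_mem hu hd₀S) (hψS _ hd₀S)
  obtain ⟨a, haS, ha1, ha⟩ := exists_map_eq_of_approx S S hS (fun x => ψ x / x) hϖ0 hϖ1 hϖ0 hϖ1
    (fun x y => by simp [mul_div_mul_comm]) (fun x hx => by simp [hψ, hx])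
    (fun x hx => hcont.continuousAt.div continuousAt_id (by rintro rfl; simp at hx))
    (fun x hx => S.div_mem (hψS x hx) hx) (by simp)
    (fun i hi b hbS hb => by
      set c := (b - 1) / ϖ ^ i with hc
      have hcS : c ∈ S := S.div_mem (S.sub_mem hbS S.one_mem) (S.pow_mem hϖ i)
      have hbc : b = 1 + ϖ ^ i * c := by rw [hc]; field_simp; ring
      have hc1 : ‖c‖ ≤ 1 := by
        rw [hc, norm_div, norm_pow]; exact div_le_one_of_le₀ hb (by positivity)
      obtain ⟨x, hxS, hx1, hx⟩ := hsol (X ^ Q - X - C c)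
        (fun j => by
          rw [coeff_sub, coeff_sub, coeff_X_pow, coeff_C, coeff_X]
          refine (norm_sub_le_max_of_ultrametric _ _).trans (max_le
            ((norm_sub_le_max_of_ultrametric _ _).trans (max_le ?_ ?_)) ?_)
          · split_ifs <;> simp
          · split_ifs <;> simp
          · split_ifs <;> simp [hc1])
        ⟨Q, by omega, by
          rw [coeff_sub, coeff_sub, coeff_X_pow, coeff_C, coeff_X, if_pos rfl,
            if_neg (by omega), if_neg (by omega)]; simp⟩
      simp only [eval_sub, eval_pow, eval_X, eval_C] at hx
      have hlt : ‖ϖ‖ ^ i < 1 := pow_lt_one₀ hϖ0.le hϖ1 (by omega)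
      have hy : ‖1 + ϖ ^ i * x - 1‖ ≤ ‖ϖ‖ ^ i := by
        rw [add_sub_cancel_left, norm_mul, norm_pow]
        exact mul_le_of_le_one_right (by positivity) hx1
      have hy1 : ‖1 + ϖ ^ i * x‖ = 1 := norm_eq_one_of_norm_sub_one_lt (hy.trans_lt hlt)
      have hy0 : 1 + ϖ ^ i * x ≠ 0 := by intro h; rw [h] at hy1; simp at hy1
      have hyS : 1 + ϖ ^ i * x ∈ S := S.add_mem S.one_mem (S.mul_mem (S.pow_mem hϖ i) hxS)
      refine ⟨1 + ϖ ^ i * x, hyS, hy, ?_⟩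
      refine hval.le_pow_succ hϖ0 hϖ1 (S.sub_mem hbS (S.div_mem (hψS _ hyS) hyS)) ?_
      have e : b - ψ (1 + ϖ ^ i * x) / (1 + ϖ ^ i * x) =
          ϖ ^ i * (-((ψ x - x ^ Q) + (x ^ Q - x - c)) + ϖ ^ i * (c * x)) /
            (1 + ϖ ^ i * x) := by
        rw [eq_div_iff hy0, sub_mul, div_mul_cancel₀ _ hy0, hbc]
        simp only [map_add, map_one, map_mul, map_pow, hψϖ]
        ring
      rw [e, norm_div, hy1, div_one, norm_mul, norm_pow]
      refine mul_lt_of_lt_one_right (by positivity) ?_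
      refine (IsUltrametricDist.norm_add_le_max _ _).trans_lt (max_lt ?_ ?_)
      · rw [norm_neg]
        exact (IsUltrametricDist.norm_add_le_max _ _).trans_lt (max_lt (hfrob x hx1) hx)
      · rw [norm_mul, norm_mul, norm_pow]
        calc _ ≤ ‖ϖ‖ ^ i * 1 := by gcongr; exact mul_le_one₀ hc1 (norm_nonneg _) hx1
          _ < 1 := by simpa using hlt)
    hbS (by
      simpa using hval.le_pow_succ hϖ0 hϖ1 (i := 0) (S.sub_mem hbS S.one_mem) (by simpa using hb))
  have ha0 : a ≠ 0 := by rintro rfl; simp at ha1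
  refine ⟨a * d₀, S.mul_mem haS hd₀S, by simp [ha1, hd₀], ?_⟩
  have ha' : ψ a = u * d₀ / ψ d₀ * a := by rw [← ha]; field_simp
  rw [map_mul, ha']
  field_simp

section CyclicNorm

variable {E G : Type*} [NormedField E] [Group G] [MulSemiringAction G E]

/-- The product of the first `l` iterates of `g` applied to `x`. -/
noncomputable def iterNorm (g : G) (l : ℕ) (x : E) : E := ∏ i ∈ Finset.range l, (g ^ i) • x

/-- The sum of the first `l` iterates of `g` applied to `x`. -/
noncomputable def iterTrace (g : G) (l : ℕ) (x : E) : E := ∑ i ∈ Finset.range l, (g ^ i) • x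

lemma iterNorm_mul (g : G) (l : ℕ) (x y : E) :
    iterNorm g l (x * y) = iterNorm g l x * iterNorm g l y := by
  simp [iterNorm, Finset.prod_mul_distrib]

lemma iterNorm_one (g : G) (l : ℕ) : iterNorm g l (1 : E) = 1 := by simp [iterNorm]

lemma iterNorm_zpow (g : G) (l : ℕ) (x : E) (k : ℤ) :
    iterNorm g l (x ^ k) = iterNorm g l x ^ k := by
  have h : ∀ i : ℕ, (g ^ i) • (x ^ k) = ((g ^ i) • x) ^ k := fun i =>
    map_zpow₀ (MulSemiringAction.toRingHom G E (g ^ i)) x k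
  simp [iterNorm, h, Finset.prod_zpow]

lemma norm_iterNorm (hiso : ∀ (g : G) (x : E), ‖g • x‖ = ‖x‖) (g : G) (l : ℕ) (x : E) :
    ‖iterNorm g l x‖ = ‖x‖ ^ l := by
  simp [iterNorm, norm_prod, hiso]

lemma smul_range_prod {M : Type*} [CommMonoid M] [MulDistribMulAction G M] (g : G) {l : ℕ}
    (x : M) (hl : (g ^ l) • x = x) :
    g • ∏ i ∈ Finset.range l, (g ^ i) • x = ∏ i ∈ Finset.range l, (g ^ i) • x := by
  rw [Finset.smul_prod']
  simp_rw [smul_smul, ← pow_succ']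
  rcases l with _ | l
  · simp
  · rw [Finset.prod_range_succ, hl, Finset.prod_range_succ' (fun i => (g ^ i) • x)]
    simp

lemma smul_iterNorm (g : G) {l : ℕ} (x : E) (hl : (g ^ l) • x = x) :
    g • iterNorm g l x = iterNorm g l x := smul_range_prod g x hl

lemma smul_iterTrace (g : G) {l : ℕ} (x : E) (hl : (g ^ l) • x = x) :
    g • iterTrace g l x = iterTrace g l x := by
  rw [iterTrace, Finset.smul_sum]
  simp_rw [smul_smul, ← pow_succ']
  rcases l with _ | l
  · simp
  · rw [Finset.sum_range_succ, hl, Finset.sum_range_succ' (fun i => (g ^ i) • x)]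
    simp

lemma iterTrace_mul_of_fixed (g : G) (l : ℕ) {b : E} (hb : g • b = b) (x : E) :
    iterTrace g l (b * x) = b * iterTrace g l x := by
  have h : ∀ i : ℕ, (g ^ i) • b = b := by
    intro i
    induction i with
    | zero => simp
    | succ i ih => rw [pow_succ, mul_smul, hb, ih]
  simp [iterTrace, h, Finset.mul_sum]

lemma norm_iterTrace_le [IsUltrametricDist E] (hiso : ∀ (g : G) (x : E), ‖g • x‖ = ‖x‖) (g : G)
    (l : ℕ) (x : E) : ‖iterTrace g l x‖ ≤ ‖x‖ := by
  refine IsUltrametricDist.norm_sum_le_of_forall_le_of_nonneg (norm_nonneg _) fun i _ => ?_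
  rw [hiso]

/-- The polynomial whose value at a fixed element `x` is `iterNorm g l (1 + z * x)`. -/
noncomputable def normPoly (g : G) (l : ℕ) (z : E) : E[X] :=
  ∏ i ∈ Finset.range l, (1 + C ((g ^ i) • z) * X)

lemma norm_coeff_prod_le [IsUltrametricDist E] {ι : Type*} (s : Finset ι) (c : ι → E) {r : ℝ}
    (hr0 : 0 ≤ r) (hc : ∀ i ∈ s, ‖c i‖ ≤ r) (j : ℕ) :
    ‖(∏ i ∈ s, (1 + C (c i) * X)).coeff j‖ ≤ r ^ j := by
  classical
  induction s using Finset.induction_on generalizing j with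
  | empty =>
    rw [Finset.prod_empty, coeff_one]
    split_ifs with h
    · simp [h]
    · simp; positivity
  | insert a s ha ih =>
    have ih' := ih fun i hi => hc i (Finset.mem_insert_of_mem hi)
    rw [Finset.prod_insert ha, add_mul, one_mul, coeff_add, mul_assoc, coeff_C_mul]
    refine (IsUltrametricDist.norm_add_le_max _ _).trans (max_le (ih' j) ?_)
    rcases j with _ | j
    · simp
    · rw [mul_comm, coeff_X_mul, mul_comm, norm_mul, pow_succ']
      exact mul_le_mul (hc a (Finset.mem_insert_self _ _)) (ih' j) (norm_nonneg _) hr0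

lemma coeff_zero_prod_one_add {ι : Type*} (s : Finset ι) (c : ι → E) :
    (∏ i ∈ s, (1 + C (c i) * X)).coeff 0 = 1 := by
  rw [coeff_zero_eq_eval_zero, eval_prod]; simp

lemma coeff_card_prod_one_add {ι : Type*} (s : Finset ι) (c : ι → E) :
    (∏ i ∈ s, (1 + C (c i) * X)).coeff s.card = ∏ i ∈ s, c i := by
  have := coeff_prod_of_natDegree_le s (fun i => 1 + C (c i) * X) 1 (fun i _ => by compute_degree)
  rw [mul_one] at this
  rw [this]
  refine Finset.prod_congr rfl fun i _ => ?_
  simp [coeff_one]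

lemma map_normPoly (g : G) {l : ℕ} {z : E} (hl : (g ^ l) • z = z) :
    (normPoly g l z).map (MulSemiringAction.toRingHom G E g) = normPoly g l z := by
  simp only [normPoly, Polynomial.map_prod, Polynomial.map_add, Polynomial.map_one,
    Polynomial.map_mul, map_C, map_X, MulSemiringAction.toRingHom_apply, smul_smul, ← pow_succ']
  rcases l with _ | l
  · simp
  · rw [Finset.prod_range_succ, hl,
      Finset.prod_range_succ' (fun i => 1 + C ((g ^ i) • z) * X)]
    simp

lemma map_normPoly_pow (g : G) {l : ℕ} {z : E} (hl : (g ^ l) • z = z) (i : ℕ) :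
    (normPoly g l z).map (MulSemiringAction.toRingHom G E (g ^ i)) = normPoly g l z := by
  induction i with
  | zero =>
    have : MulSemiringAction.toRingHom G E (g ^ 0) = RingHom.id E := by ext; simp
    rw [this, Polynomial.map_id]
  | succ i ih =>
    have : MulSemiringAction.toRingHom G E (g ^ (i + 1)) =
        (MulSemiringAction.toRingHom G E g).comp (MulSemiringAction.toRingHom G E (g ^ i)) := by
      ext; simp [pow_succ', mul_smul]
    rw [this, ← Polynomial.map_map, ih, map_normPoly g hl]

lemma eval_normPoly (g : G) (l : ℕ) (z : E) {x : E} (hx : g • x = x) :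
    (normPoly g l z).eval x = iterNorm g l (1 + z * x) := by
  have h : ∀ i : ℕ, (g ^ i) • x = x := by
    intro i
    induction i with
    | zero => simp
    | succ i ih => rw [pow_succ, mul_smul, hx, ih]
  simp [normPoly, iterNorm, eval_prod, h]

lemma natCast_mul_coeff_normPoly (g : G) {l : ℕ} (hl0 : 0 < l) {z : E} (hl : (g ^ l) • z = z)
    (j : ℕ) :
    ((j : E) + 1) * (normPoly g l z).coeff (j + 1) = iterTrace g l
      (z * (∏ i ∈ (Finset.range l).erase 0, (1 + C ((g ^ i) • z) * X)).coeff j) := by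
  set Q : E[X] := ∏ i ∈ (Finset.range l).erase 0, (1 + C ((g ^ i) • z) * X) with hQ
  have hne : ∀ c : E, (1 + C c * X) ≠ 0 := by
    intro c h
    have := congrArg (fun p => eval 0 p) h
    simp at this
  have hP : normPoly g l z = (1 + C z * X) * Q := by
    rw [normPoly, ← Finset.mul_prod_erase _ _ (Finset.mem_range.2 hl0)]
    simp [hQ]
  have hQi : ∀ i ∈ Finset.range l, ∏ k ∈ (Finset.range l).erase i, (1 + C ((g ^ k) • z) * X) =
      Q.map (MulSemiringAction.toRingHom G E (g ^ i)) := by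
    intro i hi
    apply mul_left_cancel₀ (hne ((g ^ i) • z))
    rw [Finset.mul_prod_erase _ (fun k => 1 + C ((g ^ k) • z) * X) hi]
    have := map_normPoly_pow g hl i
    rw [hP, Polynomial.map_mul] at this
    simp only [Polynomial.map_add, Polynomial.map_one, Polynomial.map_mul, map_C, map_X,
      MulSemiringAction.toRingHom_apply] at this
    rw [this, ← hP, normPoly]
  have hd : derivative (normPoly g l z) = ∑ i ∈ Finset.range l,
      Q.map (MulSemiringAction.toRingHom G E (g ^ i)) * C ((g ^ i) • z) := by
    rw [normPoly, derivative_prod_finset]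
    refine Finset.sum_congr rfl fun i hi => ?_
    rw [hQi i hi]
    simp
  rw [mul_comm, ← coeff_derivative, hd, finsetSum_coeff, iterTrace]
  refine Finset.sum_congr rfl fun i _ => ?_
  rw [coeff_mul_C, coeff_map, smul_mul', mul_comm]
  rfl

end CyclicNorm

section NormStep

variable {E G : Type*} [NormedField E] [IsUltrametricDist E] [Group G] [MulSemiringAction G E]

lemma norm_natCast_eq_one_of_lt_prime {l : ℕ} (hl : l.Prime) (hl1 : ‖(l : E)‖ < 1) {j : ℕ}
    (hj0 : 0 < j) (hj : j < l) : ‖(j : E)‖ = 1 := by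
  refine le_antisymm (IsUltrametricDist.norm_natCast_le_one E j) ?_
  by_contra! hlt
  have hco : IsCoprime (j : ℤ) (l : ℤ) :=
    Nat.isCoprime_iff_coprime.2 (Nat.Coprime.symm ((Nat.Prime.coprime_iff_not_dvd hl).2
      (Nat.not_dvd_of_pos_of_lt hj0 hj)))
  obtain ⟨a, b, hab⟩ := hco
  have h : (a : E) * j + b * l = 1 := by exact_mod_cast congrArg (Int.cast : ℤ → E) hab
  have h1 : ‖(a : E) * j + b * l‖ < 1 := by
    refine (IsUltrametricDist.norm_add_le_max _ _).trans_lt (max_lt ?_ ?_)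
    · rw [norm_mul]
      exact (mul_le_of_le_one_left (norm_nonneg _)
        (IsUltrametricDist.norm_intCast_le_one E a)).trans_lt hlt
    · rw [norm_mul]
      exact (mul_le_of_le_one_left (norm_nonneg _)
        (IsUltrametricDist.norm_intCast_le_one E b)).trans_lt hl1
  rw [h, norm_one] at h1
  exact lt_irrefl _ h1

/-- A multiplier `z` for which the polynomial of norms `N(1 + z x)` has all its nonconstant
coefficients in `ϖ ^ i`, and at least one of them of that exact size. -/
lemma exists_normPoly_coeff (hiso : ∀ (g : G) (x : E), ‖g • x‖ = ‖x‖) (S : Subfield E) (g : G)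
    (hgS : ∀ x ∈ S, g • x ∈ S) {l : ℕ} (hl : l.Prime) (hord : ∀ x ∈ S, (g ^ l) • x = x) {p : E}
    (hp : p ∈ S) (hp0 : 0 < ‖p‖) (hp1 : ‖p‖ < 1) (hvalS : HasValueBase S ‖p‖)
    (hvalB : ∀ b ∈ S, g • b = b → b ≠ 0 → ∃ k : ℤ, ‖b‖ = (‖p‖ ^ l) ^ k) (i : ℕ) :
    ∃ z ∈ S, ‖z‖ ≤ ‖p‖ ^ i ∧ (∀ j, 1 ≤ j → ‖(normPoly g l z).coeff j‖ ≤ (‖p‖ ^ l) ^ i) ∧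
      ∃ j, 1 ≤ j ∧ ‖(normPoly g l z).coeff j‖ = (‖p‖ ^ l) ^ i := by
  have hgpS : ∀ (k : ℕ), ∀ x ∈ S, (g ^ k) • x ∈ S := by
    intro k
    induction k with
    | zero => intro x hx; simpa using hx
    | succ k ih => intro x hx; rw [pow_succ, mul_smul]; exact ih _ (hgS x hx)
  set ϖ : E := iterNorm g l p with hϖ
  have hϖn : ‖ϖ‖ = ‖p‖ ^ l := norm_iterNorm hiso g l p
  have hϖS : ϖ ∈ S := S.prod_mem fun k _ => hgpS k p hp
  have hϖg : g • ϖ = ϖ := smul_iterNorm g p (hord p hp)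
  have hTS : ∀ x ∈ S, iterTrace g l x ∈ S := fun x hx => S.sum_mem fun k _ => hgpS k x hx
  have hr0 : 0 < ‖p‖ ^ l := by positivity
  have hr1 : ‖p‖ ^ l < 1 := pow_lt_one₀ hp0.le hp1 hl.ne_zero
  have hl1 : 1 ≤ l := hl.one_lt.le
  have hnl : ∀ z ∈ S, ‖(normPoly g l z).coeff l‖ = ‖z‖ ^ l := by
    intro z _
    have := coeff_card_prod_one_add (Finset.range l) (fun i => (g ^ i) • z)
    rw [Finset.card_range] at this
    rw [normPoly, this]
    exact norm_iterNorm hiso g l z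
  have hbig : ∀ z ∈ S, ‖z‖ ≤ ‖p‖ ^ i → ∀ j, l ≤ j →
      ‖(normPoly g l z).coeff j‖ ≤ (‖p‖ ^ l) ^ i := by
    intro z _ hz j hj
    refine (norm_coeff_prod_le _ _ (by positivity) (fun k _ => (hiso _ z).trans_le hz) j).trans ?_
    rw [← pow_mul, ← pow_mul, mul_comm l]
    exact pow_le_pow_of_le_one hp0.le hp1.le (by gcongr)
  rcases lt_or_eq_of_le (IsUltrametricDist.norm_natCast_le_one E l) with hlt | heq
  · -- wild case
    have hmid : ∀ z ∈ S, ‖z‖ ≤ 1 → (∀ w ∈ S, ‖w‖ ≤ ‖z‖ → ‖iterTrace g l w‖ ≤ (‖p‖ ^ l) ^ i) →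
        ∀ j, 1 ≤ j → j < l → ‖(normPoly g l z).coeff j‖ ≤ (‖p‖ ^ l) ^ i := by
      intro z hz hz1 htr j hj hjl
      obtain ⟨j, rfl⟩ : ∃ k, j = k + 1 := ⟨j - 1, by omega⟩
      have h1 := natCast_mul_coeff_normPoly g (l := l) (by omega) (hord z hz) j
      have h2 := congrArg norm h1
      have h3 := norm_natCast_eq_one_of_lt_prime (E := E) hl hlt (j := j + 1) (by omega) hjl
      push_cast at h3
      rw [norm_mul, h3, one_mul] at h2
      rw [h2]
      refine htr _ (S.mul_mem hz ?_) ?_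
      · have : (∏ k ∈ (Finset.range l).erase 0, (1 + C ((g ^ k) • z) * X)) ∈
            Polynomial.lifts S.subtype := by
          refine Subsemiring.prod_mem _ fun k _ => ?_
          refine Subsemiring.add_mem _ (Subsemiring.one_mem _) (Subsemiring.mul_mem _ ?_ ?_)
          · exact C'_mem_lifts (f := S.subtype) ⟨⟨_, hgpS k z hz⟩, rfl⟩
          · exact X_mem_lifts _
        rw [lifts_iff_coeff_lifts] at this
        obtain ⟨y, hy⟩ := this j
        rw [← hy]; exact y.2
      · rw [norm_mul]
        refine mul_le_of_le_one_right (norm_nonneg _) ?_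
        refine (norm_coeff_prod_le _ _ (norm_nonneg z) (fun k _ => (hiso _ z).le) j).trans ?_
        exact pow_le_one₀ (norm_nonneg _) hz1
    have hfin : ∀ z ∈ S, ‖z‖ ≤ ‖p‖ ^ i →
        (∀ w ∈ S, ‖w‖ ≤ ‖z‖ → ‖iterTrace g l w‖ ≤ (‖p‖ ^ l) ^ i) →
        ∀ j, 1 ≤ j → ‖(normPoly g l z).coeff j‖ ≤ (‖p‖ ^ l) ^ i := by
      intro z hz hzi htr j hj
      rcases lt_or_ge j l with h | h
      · exact hmid z hz (hzi.trans (pow_le_one₀ hp0.le hp1.le)) htr j hj h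
      · exact hbig z hz hzi j h
    by_cases hcase : ∀ w ∈ S, ‖w‖ ≤ ‖p‖ ^ i → ‖iterTrace g l w‖ ≤ (‖p‖ ^ l) ^ i
    · refine ⟨p ^ i, S.pow_mem hp i, by simp, hfin _ (S.pow_mem hp i) (by simp) ?_,
        l, hl1, ?_⟩
      · intro w hw hwi
        exact hcase w hw (by simpa using hwi)
      · rw [hnl _ (S.pow_mem hp i), norm_pow, ← pow_mul, ← pow_mul, mul_comm]
    · push Not at hcase
      obtain ⟨w, hwS, hwi, hw⟩ := hcase
      classical
      let P : ℕ → Prop := fun m => ∃ z ∈ S, ‖z‖ = ‖p‖ ^ m ∧ (‖p‖ ^ l) ^ i ≤ ‖iterTrace g l z‖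
      have hbd : ∀ m, P m → m ≤ l * i := by
        rintro m ⟨z, -, hz, hT⟩
        have := hT.trans (norm_iterTrace_le hiso g l z)
        rw [hz, ← pow_mul] at this
        exact (pow_le_pow_iff_right_of_lt_one₀ hp0 hp1).1 this
      have hval : ∀ z ∈ S, ‖z‖ ≤ 1 → (‖p‖ ^ l) ^ i ≤ ‖iterTrace g l z‖ →
          ∃ m : ℕ, ‖z‖ = ‖p‖ ^ m := by
        intro z hz hz1 hT
        have hz0 : z ≠ 0 := by
          rintro rfl
          have : iterTrace g l (0 : E) = 0 := by simp [iterTrace]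
          rw [this, norm_zero] at hT
          exact absurd hT (not_le.2 (by positivity))
        obtain ⟨k, hk⟩ := hvalS z hz hz0
        have hk0 : 0 ≤ k := by
          rw [hk] at hz1
          exact (zpow_le_one_iff_right_of_lt_one₀ hp0 hp1).1 hz1
        lift k to ℕ using hk0
        exact ⟨k, by simpa using hk⟩
      obtain ⟨m₀, hm₀⟩ := hval w hwS (hwi.trans (pow_le_one₀ hp0.le hp1.le)) hw.le
      have hPm₀ : P m₀ := ⟨w, hwS, hm₀, hw.le⟩
      set m := Nat.findGreatest P (l * i) with hm
      obtain ⟨z, hzS, hz, hzT⟩ : P m := Nat.findGreatest_spec (hbd _ hPm₀) hPm₀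
      have hmi : i ≤ m := by
        have h1 : m₀ ≤ m := Nat.le_findGreatest (hbd _ hPm₀) hPm₀
        rw [hm₀] at hwi
        exact ((pow_le_pow_iff_right_of_lt_one₀ hp0 hp1).1 hwi).trans h1
      have hzi : ‖z‖ ≤ ‖p‖ ^ i := by
        rw [hz]; exact pow_le_pow_of_le_one hp0.le hp1.le hmi
      have hmin : ∀ w ∈ S, ‖w‖ ≤ ‖z‖ → ‖iterTrace g l w‖ ≤ (‖p‖ ^ l) ^ i := by
        intro w hwS hwz
        by_contra! hlt
        have hT0 : iterTrace g l w ≠ 0 := by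
          intro h; rw [h, norm_zero] at hlt
          exact absurd hlt (not_lt.2 (by positivity))
        obtain ⟨k, hk⟩ := hvalB _ (hTS w hwS) (smul_iterTrace g w (hord w hwS)) hT0
        have hki : k + 1 ≤ i := by
          rw [hk, ← zpow_natCast, zpow_lt_zpow_iff_right_of_lt_one₀ hr0 hr1] at hlt
          omega
        have hT' : (‖p‖ ^ l) ^ i ≤ ‖iterTrace g l (ϖ * w)‖ := by
          rw [iterTrace_mul_of_fixed g l hϖg, norm_mul, hϖn, hk, ← zpow_natCast,
            ← zpow_one_add₀ hr0.ne', zpow_le_zpow_iff_right_of_lt_one₀ hr0 hr1]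
          omega
        have hwn : ‖ϖ * w‖ ≤ ‖p‖ ^ (l + m) := by
          rw [norm_mul, hϖn, pow_add, ← hz]; gcongr
        obtain ⟨m', hm'⟩ := hval _ (S.mul_mem hϖS hwS)
          (hwn.trans (pow_le_one₀ hp0.le hp1.le)) hT'
        have hPm' : P m' := ⟨_, S.mul_mem hϖS hwS, hm', hT'⟩
        have h1 : m' ≤ m := Nat.le_findGreatest (hbd _ hPm') hPm'
        rw [hm'] at hwn
        have h2 := (pow_le_pow_iff_right_of_lt_one₀ hp0 hp1).1 hwn
        omega
      refine ⟨z, hzS, hzi, hfin z hzS hzi hmin, 1, le_rfl, ?_⟩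
      have h1 := natCast_mul_coeff_normPoly g (l := l) (by omega) (hord z hzS) 0
      rw [coeff_zero_prod_one_add] at h1
      simp only [Nat.cast_zero, zero_add, one_mul, mul_one] at h1
      rw [h1]
      exact le_antisymm (hmin z hzS le_rfl) hzT
  · -- tame case
    have hfix : ∀ k : ℕ, (g ^ k) • ϖ ^ i = ϖ ^ i := by
      intro k
      induction k with
      | zero => simp
      | succ k ih => rw [pow_succ, mul_smul, smul_pow', hϖg, ih]
    have hzn : ‖ϖ ^ i‖ = (‖p‖ ^ l) ^ i := by rw [norm_pow, hϖn]
    refine ⟨ϖ ^ i, S.pow_mem hϖS i, ?_, ?_, 1, le_rfl, ?_⟩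
    · rw [hzn, ← pow_mul]
      exact pow_le_pow_of_le_one hp0.le hp1.le (Nat.le_mul_of_pos_left _ hl.pos)
    · intro j hj
      refine (norm_coeff_prod_le _ _ (norm_nonneg (ϖ ^ i)) (fun k _ => (hiso _ _).le) j).trans ?_
      rw [← hzn]
      exact pow_le_of_le_one (norm_nonneg _) (by rw [hzn]; exact pow_le_one₀ hr0.le hr1.le)
        (by omega)
    · have h1 := natCast_mul_coeff_normPoly g (l := l) (z := ϖ ^ i) (by omega) (hfix l) 0
      rw [coeff_zero_prod_one_add] at h1
      simp only [Nat.cast_zero, zero_add, one_mul, mul_one] at h1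
      rw [h1, iterTrace]
      simp [hfix, heq, hϖn]

/-- Surjectivity of the norm in a cyclic totally ramified extension of prime degree with
algebraically closed residue field. -/
theorem exists_iterNorm_eq [CompleteSpace E] (hiso : ∀ (g : G) (x : E), ‖g • x‖ = ‖x‖)
    (S B : Subfield E) (hS : IsClosed (S : Set E)) (g : G)
    (hgS : ∀ x ∈ S, g • x ∈ S) (hB : ∀ x, x ∈ B ↔ x ∈ S ∧ g • x = x)
    {l : ℕ} (hl : l.Prime) (hord : ∀ x ∈ S, (g ^ l) • x = x) {p : E}
    (hp : p ∈ S) (hp0 : 0 < ‖p‖) (hp1 : ‖p‖ < 1) (hvalS : HasValueBase S ‖p‖)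
    (hvalB : HasValueBase B (‖p‖ ^ l)) (hsol : ResiduallySolvable B) {b : E} (hb : b ∈ B)
    (hb0 : b ≠ 0) : ∃ a ∈ S, iterNorm g l a = b := by
  have hgpS : ∀ (k : ℕ), ∀ x ∈ S, (g ^ k) • x ∈ S := by
    intro k
    induction k with
    | zero => intro x hx; simpa using hx
    | succ k ih => intro x hx; rw [pow_succ, mul_smul]; exact ih _ (hgS x hx)
  have hr0 : 0 < ‖p‖ ^ l := by positivity
  have hr1 : ‖p‖ ^ l < 1 := pow_lt_one₀ hp0.le hp1 hl.ne_zero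
  have hNB : ∀ x ∈ S, iterNorm g l x ∈ B := fun x hx =>
    (hB _).2 ⟨S.prod_mem fun k _ => hgpS k x hx, smul_iterNorm g x (hord x hx)⟩
  set ϖ : E := iterNorm g l p with hϖ
  have hϖn : ‖ϖ‖ = ‖p‖ ^ l := norm_iterNorm hiso g l p
  have hϖB : ϖ ∈ B := hNB p hp
  have hϖ0 : ϖ ≠ 0 := norm_pos_iff.1 (by rw [hϖn]; exact hr0)
  have hcont : Continuous (iterNorm (E := E) g l) := by
    refine continuous_finsetProd _ fun k _ => ?_
    exact (AddMonoidHomClass.isometry_of_norm (MulSemiringAction.toRingHom G E (g ^ k))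
      (hiso _)).continuous
  have hone : ∀ b ∈ B, ‖b - 1‖ < 1 → ∃ a ∈ S, iterNorm g l a = b := by
    intro b hb hb1
    have h0 := hvalB.le_pow_succ hr0 hr1 (i := 0) (B.sub_mem hb B.one_mem) (by simpa using hb1)
    obtain ⟨a, haS, -, ha⟩ := exists_map_eq_of_approx S B hS (iterNorm g l) hr0 hr1 hp0 hp1
      (iterNorm_mul g l) (fun x hx => by rw [norm_iterNorm hiso, hx, one_pow])
      (fun x _ => hcont.continuousAt) hNB (iterNorm_one g l)
      (fun i _ b hb hbi => by
        obtain ⟨z, hzS, hzi, hz, hz'⟩ := exists_normPoly_coeff hiso S g hgS hl hord hp hp0 hp1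
          hvalS (fun b hbS hbg hb0 => hvalB b ((hB b).2 ⟨hbS, hbg⟩) hb0) i
        have hϖi : ϖ ^ i ≠ 0 := pow_ne_zero _ hϖ0
        have hϖin : ‖ϖ ^ i‖ = (‖p‖ ^ l) ^ i := by rw [norm_pow, hϖn]
        obtain ⟨x, hxB, hx1, hx⟩ := hsol (C (ϖ ^ i)⁻¹ * (normPoly g l z - C b))
          (fun j => by
            rw [coeff_C_mul, norm_mul, norm_inv, hϖin, inv_mul_le_one₀ (by positivity),
              coeff_sub, coeff_C]
            split_ifs with hj
            · subst hj
              rw [normPoly, coeff_zero_prod_one_add, norm_sub_rev]; exact hbi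
            · rw [sub_zero]; exact hz j (by omega))
          (by
            obtain ⟨j, hj, hjz⟩ := hz'
            refine ⟨j, hj, ?_⟩
            rw [coeff_C_mul, coeff_sub, coeff_C, if_neg (by omega), sub_zero, norm_mul, norm_inv,
              hϖin, hjz, inv_mul_cancel₀ (by positivity)])
        obtain ⟨hxS, hxg⟩ := (hB x).1 hxB
        rw [eval_mul, eval_C, eval_sub, eval_C, eval_normPoly g l z hxg, norm_mul, norm_inv, hϖin,
          inv_mul_lt_one₀ (by positivity)] at hx
        have hyS : 1 + z * x ∈ S := S.add_mem S.one_mem (S.mul_mem hzS hxS)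
        refine ⟨1 + z * x, hyS, ?_, ?_⟩
        · rw [add_sub_cancel_left, norm_mul]
          calc _ ≤ ‖p‖ ^ i * 1 := by gcongr
            _ = _ := mul_one _
        · rw [norm_sub_rev]
          exact hvalB.le_pow_succ hr0 hr1 (B.sub_mem (hNB _ hyS) hb) hx)
      hb (by simpa using h0)
    exact ⟨a, haS, ha⟩
  have hunit : ∀ b ∈ B, ‖b‖ = 1 → ∃ a ∈ S, iterNorm g l a = b := by
    intro b hb hb1
    obtain ⟨x, hxB, hx1, hx⟩ := hsol (X ^ l - C b)
      (fun j => by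
        rw [coeff_sub, coeff_X_pow, coeff_C]
        refine (norm_sub_le_max_of_ultrametric _ _).trans (max_le ?_ ?_)
        · split_ifs <;> simp
        · split_ifs <;> simp [hb1])
      ⟨l, hl.one_lt.le, by
        rw [coeff_sub, coeff_X_pow, coeff_C, if_pos rfl, if_neg hl.ne_zero]; simp⟩
    simp only [eval_sub, eval_pow, eval_X, eval_C] at hx
    have hx' : ‖x ^ l‖ = 1 := by
      rw [← hb1]
      by_contra hne
      have := norm_sub_eq_max_of_ne hne
      rw [this, hb1] at hx
      exact absurd (lt_of_le_of_lt (le_max_right _ _) hx) (lt_irrefl _)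
    obtain ⟨hxS, hxg⟩ := (hB x).1 hxB
    have hNx : iterNorm g l x = x ^ l := by
      have h : ∀ i : ℕ, (g ^ i) • x = x := by
        intro i
        induction i with
        | zero => simp
        | succ i ih => rw [pow_succ, mul_smul, hxg, ih]
      simp [iterNorm, h]
    have hx0 : x ^ l ≠ 0 := by intro h; rw [h] at hx'; simp at hx'
    obtain ⟨a, haS, ha⟩ := hone (b / x ^ l) (B.div_mem hb (B.pow_mem hxB l)) (by
      rw [div_sub_one hx0, norm_div, hx', div_one, norm_sub_rev]; exact hx)
    refine ⟨x * a, S.mul_mem hxS haS, ?_⟩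
    rw [iterNorm_mul, hNx, ha]
    field_simp
  obtain ⟨k, hk⟩ := hvalB b hb hb0
  obtain ⟨a, haS, ha⟩ := hunit (b / ϖ ^ k) (B.div_mem hb (B.zpow_mem hϖB k)) (by
    rw [norm_div, norm_zpow, hϖn, hk, div_self (by positivity)])
  refine ⟨p ^ k * a, S.mul_mem (S.zpow_mem hp k) haS, ?_⟩
  rw [iterNorm_mul, iterNorm_zpow, ha, ← hϖ]
  field_simp

end NormStep

section Hilbert90

variable {E G : Type*} [Field E] [Group G] [MulSemiringAction G E]

lemma exists_smul_eq_mul_of_prod_eq_one (S : Subfield E) (g : G) (hgS : ∀ x ∈ S, g • x ∈ S)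
    {l : ℕ} (hl : l.Prime) (hord : ∀ x ∈ S, (g ^ l) • x = x) (hne : ∃ x ∈ S, g • x ≠ x) {y : E}
    (hy : y ∈ S) (hy1 : ∏ i ∈ Finset.range l, (g ^ i) • y = 1) :
    ∃ z ∈ S, z ≠ 0 ∧ g • z = y * z := by
  have hgpS : ∀ (k : ℕ), ∀ x ∈ S, (g ^ k) • x ∈ S := by
    intro k
    induction k with
    | zero => intro x hx; simpa using hx
    | succ k ih => intro x hx; rw [pow_succ, mul_smul]; exact ih _ (hgS x hx)
  let χ : ℕ → (S →* E) := fun i =>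
    ((MulSemiringAction.toRingHom G E (g ^ i)).comp S.subtype : S →+* E)
  have hχ : ∀ i (x : S), χ i x = (g ^ i) • (x : E) := fun _ _ => rfl
  have hmul : ∀ (k d : ℕ), (∀ x ∈ S, (g ^ d) • x = x) → ∀ x ∈ S, (g ^ (k * d)) • x = x := by
    intro k d hd x hx
    induction k with
    | zero => simp
    | succ k ih => rw [add_mul, one_mul, pow_add, mul_smul, hd x hx, ih]
  have hinj : Function.Injective fun i : Fin l => χ i := by
    have aux : ∀ i j : ℕ, i < j → j < l → χ i ≠ χ j := by
      intro i j hij hjl h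
      have hd : ∀ x ∈ S, (g ^ (j - i)) • x = x := by
        intro x hx
        have h1 := DFunLike.congr_fun h ⟨x, hx⟩
        rw [hχ, hχ] at h1
        simp only at h1
        rw [show j = i + (j - i) by omega, pow_add, mul_smul] at h1
        exact (smul_left_cancel _ h1).symm
      have hco : Nat.Coprime (j - i) l := Nat.Coprime.symm
        ((Nat.Prime.coprime_iff_not_dvd hl).2 (Nat.not_dvd_of_pos_of_lt (by omega) (by omega)))
      obtain ⟨x, hx, hgx⟩ := hne
      obtain ⟨m, -, hm⟩ := Nat.exists_mul_mod_eq_one_of_coprime hco hl.one_lt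
      apply hgx
      have h1 := hmul m _ hd x hx
      rw [mul_comm, ← Nat.mod_add_div ((j - i) * m) l, hm, pow_add, pow_one, mul_smul, mul_comm l,
        hmul _ l hord x hx] at h1
      exact h1
    intro i j h
    by_contra hne'
    rcases lt_or_gt_of_ne (fun h' => hne' (Fin.ext h') : (i : ℕ) ≠ j) with h' | h'
    · exact aux i j h' j.2 h
    · exact aux j i h' i.2 h.symm
  have hli : LinearIndependent E (fun i : Fin l => (χ i : S → E)) :=
    (linearIndependent_monoidHom S E).comp _ hinj
  let c : ℕ → E := fun i => ∏ k ∈ Finset.range i, (g ^ k) • y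
  have hcS : ∀ i, c i ∈ S := fun i => S.prod_mem fun k _ => hgpS k y hy
  have hc : ∀ i, y * g • c i = c (i + 1) := by
    intro i
    simp only [c]
    rw [Finset.smul_prod', Finset.prod_range_succ' (fun k => (g ^ k) • y), mul_comm]
    simp [smul_smul, pow_succ']
  obtain ⟨θ, hθ⟩ : ∃ θ : S, ∑ i ∈ Finset.range l, c i * (g ^ i) • (θ : E) ≠ 0 := by
    by_contra! h
    have := Fintype.linearIndependent_iff.1 hli (fun i => c i) (by
      funext θ
      have h1 := h θ
      rw [Finset.sum_range] at h1
      simpa [hχ] using h1) ⟨0, hl.pos⟩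
    simp [c] at this
  set z := ∑ i ∈ Finset.range l, c i * (g ^ i) • (θ : E) with hz
  have hzS : z ∈ S := S.sum_mem fun i _ => S.mul_mem (hcS i) (hgpS i _ θ.2)
  have hyz : y * g • z = z := by
    rw [hz, Finset.smul_sum, Finset.mul_sum]
    have : ∀ i, y * g • (c i * (g ^ i) • (θ : E)) = c (i + 1) * (g ^ (i + 1)) • (θ : E) := by
      intro i
      rw [smul_mul', ← mul_assoc, hc, smul_smul, ← pow_succ']
    simp_rw [this]
    obtain ⟨m, rfl⟩ : ∃ m, l = m + 1 := ⟨l - 1, by have := hl.pos; omega⟩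
    rw [Finset.sum_range_succ, Finset.sum_range_succ' (fun i => c i * (g ^ i) • (θ : E))]
    congr 1
    rw [hord _ θ.2]
    simp only [c] at hy1 ⊢
    rw [hy1]
    simp
  refine ⟨z⁻¹, S.inv_mem hzS, inv_ne_zero hθ, ?_⟩
  have hgz : g • z ≠ 0 := by
    intro h; rw [h, mul_zero] at hyz; exact hθ hyz.symm
  rw [smul_inv'']
  rw [inv_eq_iff_eq_inv, mul_inv, inv_inv]
  nth_rewrite 2 [← hyz]
  have hy0 : y ≠ 0 := by rintro rfl; rw [zero_mul] at hyz; exact hθ hyz.symm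
  field_simp

end Hilbert90

section SubgroupNorm

variable {E G : Type*} [CommGroup G] [Finite G]

/-- The subfield of elements fixed by a subgroup. -/
def fixedSub [Field E] [MulSemiringAction G E] (H : Subgroup G) : Subfield E :=
  FixedPoints.subfield H E

omit [Finite G] in
lemma mem_fixedSub [Field E] [MulSemiringAction G E] {H : Subgroup G} {x : E} :
    x ∈ fixedSub (E := E) H ↔ ∀ h ∈ H, h • x = x :=
  ⟨fun hx h hh => hx ⟨h, hh⟩, fun hx h => hx h h.2⟩

/-- The product of the conjugates of `x` under a subgroup. -/
noncomputable def subNorm [Field E] [MulSemiringAction G E] (H : Subgroup G) (x : E) : E :=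
  ∏ h ∈ (Set.toFinite (H : Set G)).toFinset, h • x

section Field
variable [Field E] [MulSemiringAction G E]

lemma subNorm_mul (H : Subgroup G) (x y : E) : subNorm H (x * y) = subNorm H x * subNorm H y := by
  simp [subNorm, Finset.prod_mul_distrib]

lemma subNorm_div (H : Subgroup G) (x y : E) : subNorm H (x / y) = subNorm H x / subNorm H y := by
  simp only [subNorm, div_eq_mul_inv, smul_mul', smul_inv'', Finset.prod_mul_distrib,
    Finset.prod_inv_distrib]

lemma subNorm_ne_zero (H : Subgroup G) {x : E} (hx : x ≠ 0) : subNorm H x ≠ 0 :=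
  Finset.prod_ne_zero_iff.2 fun h _ => (smul_ne_zero_iff_ne h).2 hx

lemma subNorm_smul (H : Subgroup G) (g : G) (x : E) : subNorm H (g • x) = g • subNorm H x := by
  rw [subNorm, subNorm, Finset.smul_prod']
  refine Finset.prod_congr rfl fun h _ => ?_
  rw [smul_smul, smul_smul, mul_comm]

lemma subNorm_mem (H : Subgroup G) (x : E) : subNorm H x ∈ fixedSub (E := E) H := by
  rw [mem_fixedSub]
  intro g hg
  rw [subNorm, Finset.smul_prod']
  refine Finset.prod_bij (fun h _ => g * h) ?_ ?_ ?_ ?_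
  · intro h hh
    simp only [Set.Finite.mem_toFinset, SetLike.mem_coe] at hh ⊢
    exact H.mul_mem hg hh
  · intro a _ b _ h; exact mul_left_cancel h
  · intro b hb
    simp only [Set.Finite.mem_toFinset, SetLike.mem_coe] at hb
    exact ⟨g⁻¹ * b, by simpa using H.mul_mem (H.inv_mem hg) hb, by simp⟩
  · intro a _; rw [smul_smul]

lemma subNorm_bot (x : E) : subNorm (⊥ : Subgroup G) x = x := by
  have : (Set.toFinite ((⊥ : Subgroup G) : Set G)).toFinset = {1} := by
    ext; simp
  rw [subNorm, this]; simp

lemma card_toFinset (H : Subgroup G) : (Set.toFinite (H : Set G)).toFinset.card = Nat.card H := by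
  rw [← Set.ncard_eq_toFinset_card]; rfl

end Field

section Extend

variable {H : Subgroup G} {g : G} {l : ℕ}

lemma exists_prime_pow_mem (hH : H ≠ ⊤) : ∃ (g : G) (l : ℕ), l.Prime ∧ g ∉ H ∧ g ^ l ∈ H := by
  have hcard : Nat.card (G ⧸ H) ≠ 1 := by
    intro h
    exact hH (Subgroup.index_eq_one.1 h)
  obtain ⟨l, hl, hdvd⟩ := Nat.exists_prime_and_dvd hcard
  have := Fact.mk hl
  obtain ⟨y, hy⟩ := exists_prime_orderOf_dvd_card' l hdvd
  obtain ⟨g, rfl⟩ := QuotientGroup.mk_surjective y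
  refine ⟨g, l, hl, ?_, ?_⟩
  · intro hg
    rw [(QuotientGroup.eq_one_iff g).2 hg, orderOf_one] at hy
    exact hl.one_lt.ne hy
  · rw [← QuotientGroup.eq_one_iff, QuotientGroup.mk_pow, ← hy, pow_orderOf_eq_one]

omit [Finite G] in
lemma mem_sup_zpowers_iff (hl : 0 < l) (hgl : g ^ l ∈ H) {x : G} :
    x ∈ H ⊔ Subgroup.zpowers g ↔ ∃ i < l, ∃ h ∈ H, g ^ i * h = x := by
  rw [Subgroup.mem_sup]
  constructor
  · rintro ⟨h, hh, _, ⟨k, rfl⟩, rfl⟩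
    have hl' : (0 : ℤ) < l := by exact_mod_cast hl
    have h1 := Int.emod_add_mul_ediv k l
    refine ⟨(k % l).toNat, ?_, (g ^ l) ^ (k / l) * h, H.mul_mem (H.zpow_mem hgl _) hh, ?_⟩
    · have := Int.emod_lt_of_pos k hl'
      have := Int.emod_nonneg k hl'.ne'
      omega
    · rw [← zpow_natCast g (k % l).toNat, Int.toNat_of_nonneg (Int.emod_nonneg k hl'.ne'),
        ← mul_assoc, ← zpow_natCast g l, ← zpow_mul, ← zpow_add, h1, mul_comm]
  · rintro ⟨i, -, h, hh, rfl⟩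
    exact ⟨h, hh, g ^ i, ⟨i, by simp⟩, mul_comm _ _⟩

omit [Finite G] in
lemma pow_mul_injOn (hl : l.Prime) (hg : g ∉ H) (hgl : g ^ l ∈ H) {i j : ℕ} (hi : i < l)
    (hj : j < l) {a b : G} (ha : a ∈ H) (hb : b ∈ H) (h : g ^ i * a = g ^ j * b) : i = j := by
  have aux : ∀ i j : ℕ, i < j → j < l → ∀ a ∈ H, ∀ b ∈ H, g ^ i * a ≠ g ^ j * b := by
    intro i j hij hjl a ha b hb h
    have h1 : g ^ (j - i) ∈ H := by
      rw [show j = i + (j - i) by omega, pow_add, mul_assoc] at h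
      have h2 := mul_left_cancel h
      rw [show g ^ (j - i) = a * b⁻¹ by rw [h2]; simp]
      exact H.mul_mem ha (H.inv_mem hb)
    have hco : Nat.Coprime (j - i) l := Nat.Coprime.symm
      ((Nat.Prime.coprime_iff_not_dvd hl).2 (Nat.not_dvd_of_pos_of_lt (by omega) (by omega)))
    obtain ⟨m, -, hm⟩ := Nat.exists_mul_mod_eq_one_of_coprime hco hl.one_lt
    apply hg
    have h3 : g ^ ((j - i) * m) ∈ H := by rw [pow_mul]; exact H.pow_mem h1 m
    rw [← Nat.mod_add_div ((j - i) * m) l, hm, pow_add, pow_one, pow_mul] at h3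
    exact (Subgroup.mul_mem_cancel_right H (H.pow_mem hgl _)).1 h3
  by_contra hne
  rcases lt_or_gt_of_ne hne with h' | h'
  · exact aux i j h' hj a ha b hb h
  · exact aux j i h' hi b hb a ha h.symm

lemma prod_sup_zpowers {M : Type*} [CommMonoid M] (hl : l.Prime) (hg : g ∉ H) (hgl : g ^ l ∈ H)
    (f : G → M) :
    ∏ x ∈ (Set.toFinite ((H ⊔ Subgroup.zpowers g : Subgroup G) : Set G)).toFinset, f x =
      ∏ i ∈ Finset.range l, ∏ h ∈ (Set.toFinite (H : Set G)).toFinset, f (g ^ i * h) := by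
  rw [← Finset.prod_product']
  symm
  refine Finset.prod_bij (fun p _ => g ^ p.1 * p.2) ?_ ?_ ?_ ?_
  · rintro ⟨i, h⟩ hp
    simp only [Finset.mem_product, Finset.mem_range, Set.Finite.mem_toFinset,
      SetLike.mem_coe] at hp ⊢
    exact (mem_sup_zpowers_iff hl.pos hgl).2 ⟨i, hp.1, h, hp.2, rfl⟩
  · rintro ⟨i, h⟩ hp ⟨j, h'⟩ hp' heq
    simp only [Finset.mem_product, Finset.mem_range, Set.Finite.mem_toFinset,
      SetLike.mem_coe] at hp hp' heq
    obtain rfl := pow_mul_injOn hl hg hgl hp.1 hp'.1 hp.2 hp'.2 heq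
    rw [mul_left_cancel heq]
  · intro x hx
    simp only [Set.Finite.mem_toFinset, SetLike.mem_coe] at hx
    obtain ⟨i, hi, h, hh, rfl⟩ := (mem_sup_zpowers_iff hl.pos hgl).1 hx
    exact ⟨(i, h), by simp [hi, hh], rfl⟩
  · intros; rfl

lemma card_sup_zpowers (hl : l.Prime) (hg : g ∉ H) (hgl : g ^ l ∈ H) :
    Nat.card (H ⊔ Subgroup.zpowers g : Subgroup G) = l * Nat.card H := by
  have h := prod_sup_zpowers hl hg hgl (fun _ => Multiplicative.ofAdd 1)
  simp only [Finset.prod_const, card_toFinset, Finset.card_range] at h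
  rw [← pow_mul, ← ofAdd_nsmul, ← ofAdd_nsmul] at h
  have := Multiplicative.ofAdd.injective h
  simpa [mul_comm] using this

lemma subNorm_sup_zpowers [NormedField E] [MulSemiringAction G E] (hl : l.Prime) (hg : g ∉ H)
    (hgl : g ^ l ∈ H) (x : E) :
    subNorm (H ⊔ Subgroup.zpowers g) x = iterNorm g l (subNorm H x) := by
  rw [subNorm, prod_sup_zpowers hl hg hgl, iterNorm]
  refine Finset.prod_congr rfl fun i _ => ?_
  rw [subNorm, Finset.smul_prod']
  simp_rw [smul_smul]

omit [Finite G] in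
lemma mem_fixedSub_sup_zpowers [Field E] [MulSemiringAction G E] {x : E} :
    x ∈ fixedSub (E := E) (H ⊔ Subgroup.zpowers g) ↔ x ∈ fixedSub (E := E) H ∧ g • x = x := by
  simp only [mem_fixedSub]
  refine ⟨fun h => ⟨fun k hk => h k (le_sup_left (α := Subgroup G) hk),
    h g (le_sup_right (α := Subgroup G) (Subgroup.mem_zpowers g))⟩, fun ⟨h1, h2⟩ k hk => ?_⟩
  have : H ⊔ Subgroup.zpowers g ≤ MulAction.stabilizer G x := by
    refine sup_le (fun k hk => h1 k hk) ?_
    rw [Subgroup.zpowers_le]; exact h2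
  exact this hk

end Extend

section Main

variable [NormedField E] [IsUltrametricDist E] [CompleteSpace E] [MulSemiringAction G E]

/-- The product of the coboundaries `(σ • f σ) / f σ`. -/
noncomputable def coboundaryProd (f : G → E) : E := ∏ᶠ σ : G, (σ • f σ) / f σ

omit [IsUltrametricDist E] [CompleteSpace E] in
lemma coboundaryProd_mul (f f' : G → E) :
    coboundaryProd (f * f') = coboundaryProd f * coboundaryProd f' := by
  rw [coboundaryProd, coboundaryProd, coboundaryProd,
    ← finprod_mul_distrib (Set.toFinite _) (Set.toFinite _)]
  refine finprod_congr fun σ => ?_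
  simp [mul_div_mul_comm]

omit [Finite G] [IsUltrametricDist E] [CompleteSpace E] in
lemma coboundaryProd_single [DecidableEq G] (g : G) (a : E) :
    coboundaryProd (fun σ => if σ = g then a else 1) = (g • a) / a := by
  rw [coboundaryProd, finprod_eq_single _ g]
  · simp
  · intro x hx; simp [hx]

/-- In a totally ramified abelian extension with algebraically closed residue field the norm is
surjective and its kernel is generated by the elements `(σ • a) / a`. -/
theorem subNorm_surjective_and_ker (hiso : ∀ (g : G) (x : E), ‖g • x‖ = ‖x‖)
    (hsol : ResiduallySolvable (fixedSub (E := E) (⊤ : Subgroup G))) {p : E} (hp0 : 0 < ‖p‖)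
    (hp1 : ‖p‖ < 1)
    (hval : HasValueBase (fixedSub (E := E) (⊤ : Subgroup G)) (‖p‖ ^ Nat.card G)) :
    (∀ b : E, (∀ g : G, g • b = b) → b ≠ 0 → ∃ a, subNorm (⊤ : Subgroup G) a = b) ∧
      ∀ x : E, subNorm (⊤ : Subgroup G) x = 1 →
        ∃ f : G → E, (∀ σ, f σ ≠ 0) ∧ coboundaryProd f = x := by
  classical
  let Q : Subgroup G → Prop := fun H =>
    HasValueBase (fixedSub (E := E) H) (‖p‖ ^ Nat.card H) →
    (∀ b ∈ fixedSub (E := E) H, b ≠ 0 → ∃ a, subNorm H a = b) ∧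
      ∀ x : E, subNorm H x = 1 → ∃ f : G → E, (∀ σ, f σ ≠ 0) ∧ coboundaryProd f = x
  have hQbot : Q ⊥ := by
    intro _
    refine ⟨fun b _ _ => ⟨b, subNorm_bot b⟩, fun x hx => ⟨fun _ => 1, by simp, ?_⟩⟩
    rw [subNorm_bot] at hx
    simp [coboundaryProd, hx]
  suffices hQtop : Q ⊤ by
    obtain ⟨h1, h2⟩ := hQtop (by rwa [Subgroup.card_top])
    exact ⟨fun b hb hb0 => h1 b (mem_fixedSub.2 fun g _ => hb g) hb0, h2⟩
  obtain ⟨H, hH⟩ := (Set.toFinite {H : Subgroup G | Q H}).exists_maximal ⟨⊥, hQbot⟩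
  by_contra hQtop
  have hHtop : H ≠ ⊤ := by rintro rfl; exact hQtop hH.prop
  obtain ⟨g, l, hl, hg, hgl⟩ := exists_prime_pow_mem hHtop
  have hlt : H < H ⊔ Subgroup.zpowers g :=
    left_lt_sup.2 fun h => hg (h (Subgroup.mem_zpowers g))
  refine absurd ?_ (hH.not_prop_of_gt hlt)
  intro hvalH'
  set H' := H ⊔ Subgroup.zpowers g with hH'
  set r := ‖p‖ ^ Nat.card H with hr
  have hr0 : 0 < r := by positivity
  have hr1 : r < 1 := pow_lt_one₀ hp0.le hp1 Nat.card_pos.ne'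
  have hcard : ‖p‖ ^ Nat.card H' = r ^ l := by
    rw [hH', card_sup_zpowers hl hg hgl, hr, ← pow_mul, mul_comm]
  rw [hcard] at hvalH'
  have hgS : ∀ x ∈ fixedSub (E := E) H, g • x ∈ fixedSub (E := E) H := by
    intro x hx
    rw [mem_fixedSub] at hx ⊢
    intro h hh
    rw [smul_smul, mul_comm, ← smul_smul, hx h hh]
  have hord : ∀ x ∈ fixedSub (E := E) H, (g ^ l) • x = x := fun x hx =>
    mem_fixedSub.1 hx _ hgl
  have hgpS : ∀ (k : ℕ), ∀ x ∈ fixedSub (E := E) H, (g ^ k) • x ∈ fixedSub (E := E) H := by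
    intro k
    induction k with
    | zero => intro x hx; simpa using hx
    | succ k ih => intro x hx; rw [pow_succ, mul_smul]; exact ih _ (hgS x hx)
  have hvalH : HasValueBase (fixedSub (E := E) H) r := by
    intro x hx hx0
    obtain ⟨k, hk⟩ := hvalH' (iterNorm g l x)
      (mem_fixedSub_sup_zpowers.2 ⟨Subfield.prod_mem _ fun k _ => hgpS k x hx,
        smul_iterNorm g x (hord x hx)⟩)
      (by rw [← norm_pos_iff, norm_iterNorm hiso]; positivity)
    refine ⟨k, ?_⟩
    rw [norm_iterNorm hiso, ← zpow_natCast, ← zpow_natCast, ← zpow_mul, mul_comm, zpow_mul,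
      zpow_natCast, zpow_natCast] at hk
    exact (pow_left_inj₀ (norm_nonneg _) (by positivity) hl.ne_zero).1 hk
  obtain ⟨hA, hB⟩ := hH.prop hvalH
  set q := subNorm H p with hq
  have hqn : ‖q‖ = r := by
    rw [hq, subNorm, norm_prod]
    simp [hiso, card_toFinset, hr]
  have hqS : q ∈ fixedSub (E := E) H := subNorm_mem H p
  have hclosed : IsClosed (fixedSub (E := E) H : Set E) := by
    have : (fixedSub (E := E) H : Set E) = ⋂ h ∈ H, {x | h • x = x} := by
      ext x; simp [mem_fixedSub]
    rw [this]
    refine isClosed_biInter fun h _ => isClosed_eq ?_ continuous_id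
    exact (AddMonoidHomClass.isometry_of_norm (MulSemiringAction.toRingHom G E h)
      (hiso _)).continuous
  have hsolH' : ResiduallySolvable (fixedSub (E := E) H') := by
    intro f hf hf'
    obtain ⟨x, hx, h⟩ := hsol f hf hf'
    exact ⟨x, mem_fixedSub.2 fun h _ => mem_fixedSub.1 hx h trivial, h⟩
  constructor
  · intro b hb hb0
    obtain ⟨a, haS, ha⟩ := exists_iterNorm_eq hiso (fixedSub (E := E) H) (fixedSub (E := E) H')
      hclosed g hgS (fun x => mem_fixedSub_sup_zpowers) hl hord hqS (by rwa [hqn])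
      (by rwa [hqn]) (by rwa [hqn]) (by rwa [hqn]) hsolH' hb hb0
    have ha0 : a ≠ 0 := by
      rintro rfl
      apply hb0
      rw [← ha, iterNorm]
      exact Finset.prod_eq_zero (Finset.mem_range.2 hl.pos) (by simp)
    obtain ⟨c, hc⟩ := hA a haS ha0
    exact ⟨c, by rw [hH', subNorm_sup_zpowers hl hg hgl, hc, ha]⟩
  · intro x hx
    rw [hH', subNorm_sup_zpowers hl hg hgl] at hx
    obtain ⟨z, hzS, hz0, hz⟩ := exists_smul_eq_mul_of_prod_eq_one (fixedSub (E := E) H) g hgS hl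
      hord (by
        refine ⟨q, hqS, fun h => ?_⟩
        obtain ⟨k, hk⟩ := hvalH' q (mem_fixedSub_sup_zpowers.2 ⟨hqS, h⟩)
          (norm_pos_iff.1 (by rw [hqn]; exact hr0))
        rw [hqn, ← zpow_natCast r l, ← zpow_mul] at hk
        have h1 : (1 : ℤ) = l * k :=
          zpow_right_injective₀ hr0 hr1.ne (by simpa using hk)
        have h2 := Int.eq_one_or_neg_one_of_mul_eq_one h1.symm
        have h3 := hl.one_lt
        omega)
      (subNorm_mem H x) hx
    obtain ⟨c, hc⟩ := hA z hzS hz0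
    have hc0 : c ≠ 0 := by
      rintro rfl
      apply hz0
      rw [← hc, subNorm]
      exact Finset.prod_eq_zero (i := 1) (by simp [H.one_mem]) (by simp)
    have hgc0 : g • c ≠ 0 := (smul_ne_zero_iff_ne g).2 hc0
    obtain ⟨f, hf0, hf⟩ := hB (x / (g • c / c)) (by
      rw [subNorm_div, subNorm_div, subNorm_smul, hc, hz, mul_div_assoc, div_self hz0, mul_one,
        div_self]
      intro h
      rw [h, zero_mul] at hz
      exact (smul_ne_zero_iff_ne g).2 hz0 hz)
    refine ⟨f * (fun σ => if σ = g then c else 1), fun σ => ?_, ?_⟩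
    · simp only [Pi.mul_apply]
      refine mul_ne_zero (hf0 σ) ?_
      split_ifs <;> simp [hc0]
    · rw [coboundaryProd_mul, coboundaryProd_single, hf]
      field_simp

end Main

end SubgroupNorm

section Core

variable {E G : Type*} [CommGroup G] [Finite G] [NormedField E] [MulSemiringAction G E]

omit [Finite G] in
lemma isClosed_fixedSub (hiso : ∀ (g : G) (x : E), ‖g • x‖ = ‖x‖) (H : Subgroup G) :
    IsClosed (fixedSub (E := E) H : Set E) := by
  have : (fixedSub (E := E) H : Set E) = ⋂ h ∈ H, {x | h • x = x} := by
    ext x; simp [mem_fixedSub]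
  rw [this]
  refine isClosed_biInter fun h _ => isClosed_eq ?_ continuous_id
  exact (AddMonoidHomClass.isometry_of_norm (MulSemiringAction.toRingHom G E h)
    (hiso _)).continuous

lemma norm_subNorm (hiso : ∀ (g : G) (x : E), ‖g • x‖ = ‖x‖) (H : Subgroup G) (x : E) :
    ‖subNorm H x‖ = ‖x‖ ^ Nat.card H := by
  rw [subNorm, norm_prod]
  simp [hiso, card_toFinset]

lemma map_subNorm (φ : E ≃+* E) (hφ : ∀ (g : G) x, φ (g • x) = g • φ x) (H : Subgroup G) (x : E) :
    φ (subNorm H x) = subNorm H (φ x) := by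
  rw [subNorm, map_prod, subNorm]
  simp_rw [hφ]

lemma coboundaryProd_map (φ : E ≃+* E) (hφ : ∀ (g : G) x, φ (g • x) = g • φ x)
    (f : G → E) : φ (coboundaryProd f) = coboundaryProd (fun σ => φ (f σ)) := by
  have := MonoidHom.map_finprod (φ : E →* E) (f := fun σ : G => (σ • f σ) / f σ) (Set.toFinite _)
  simp only [MonoidHom.coe_coe] at this
  rw [coboundaryProd, coboundaryProd, this]
  refine finprod_congr fun σ => ?_
  rw [map_div₀, hφ]

lemma subNorm_coboundaryProd (f : G → E) (hf : ∀ σ, f σ ≠ 0) :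
    subNorm (⊤ : Subgroup G) (coboundaryProd f) = 1 := by
  let N : E →* E :=
    { toFun := subNorm (⊤ : Subgroup G)
      map_one' := by simp [subNorm]
      map_mul' := subNorm_mul _ }
  have := MonoidHom.map_finprod N (f := fun σ : G => (σ • f σ) / f σ) (Set.toFinite _)
  change N _ = 1
  rw [coboundaryProd, this]
  refine finprod_eq_one_of_forall_eq_one fun σ => ?_
  change subNorm _ _ = 1
  rw [subNorm_div, subNorm_smul, mem_fixedSub.1 (subNorm_mem (⊤ : Subgroup G) (f σ)) σ trivial,
    div_self (subNorm_ne_zero _ (hf σ))]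

lemma norm_coboundaryProd (hiso : ∀ (g : G) (x : E), ‖g • x‖ = ‖x‖) (f : G → E)
    (hf : ∀ σ, f σ ≠ 0) : ‖coboundaryProd f‖ = 1 := by
  have := MonoidHom.map_finprod (normHom : E →*₀ ℝ).toMonoidHom
    (f := fun σ : G => (σ • f σ) / f σ) (Set.toFinite _)
  change (normHom : E →*₀ ℝ).toMonoidHom _ = 1
  rw [coboundaryProd, this]
  refine finprod_eq_one_of_forall_eq_one fun σ => ?_
  change ‖_‖ = 1
  rw [norm_div, hiso, div_self (norm_ne_zero_iff.2 (hf σ))]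

lemma prod_iterate_div {E : Type*} [Field E] (φ : RingAut E) (n : ℕ) {a : E} (ha : a ≠ 0) :
    ∏ i ∈ Finset.range n, (φ ^ i) (φ a / a) = (φ ^ n) a / a := by
  induction n with
  | zero => simp [ha]
  | succ n ih =>
    rw [Finset.prod_range_succ, ih, map_div₀, pow_succ φ n]
    change _ * ((φ ^ n) (φ a) / (φ ^ n) a) = (φ ^ n) (φ a) / a
    have : (φ ^ n) a ≠ 0 := (map_ne_zero (φ ^ n)).2 ha
    field_simp

lemma norm_iterate_sub_pow_lt [IsUltrametricDist E] (φ : RingAut E) (hφ : ∀ x, ‖φ x‖ = ‖x‖) {q : ℕ}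
    (hfrob : ∀ x, ‖x‖ ≤ 1 → ‖φ x - x ^ q‖ < 1) (n : ℕ) :
    ∀ x, ‖x‖ ≤ 1 → ‖(φ ^ n) x - x ^ q ^ n‖ < 1 := by
  induction n with
  | zero => intro x _; simp
  | succ n ih =>
    intro x hx
    have h1 : (φ ^ (n + 1)) x - x ^ q ^ (n + 1) =
        φ ((φ ^ n) x - x ^ q ^ n) + (φ (x ^ q ^ n) - (x ^ q ^ n) ^ q) := by
      rw [map_sub, pow_succ', pow_succ q, pow_mul]
      change φ ((φ ^ n) x) - _ = _
      ring
    rw [h1]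
    refine (IsUltrametricDist.norm_add_le_max _ _).trans_lt (max_lt ?_ (hfrob _ ?_))
    · rw [hφ]; exact ih x hx
    · rw [norm_pow]; exact pow_le_one₀ (norm_nonneg _) hx

variable [CompleteSpace E] [IsUltrametricDist E]

/-- Data of a complete field with a totally ramified abelian action of `G` and a commuting Frobenius
`φ` fixing a uniformizer. -/
structure FrobeniusData (E G : Type*) [CommGroup G] [Finite G] [NormedField E]
    [MulSemiringAction G E] (φ : RingAut E) (p : E) (q : ℕ) : Prop where
  isometry_smul : ∀ (g : G) (x : E), ‖g • x‖ = ‖x‖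
  isometry : ∀ x, ‖φ x‖ = ‖x‖
  comm : ∀ (g : G) (x : E), φ (g • x) = g • φ x
  map_unif : φ p = p
  unif_pos : 0 < ‖p‖
  unif_lt : ‖p‖ < 1
  value : HasValueBase (⊤ : Subfield E) ‖p‖
  value_fixed : HasValueBase (fixedSub (E := E) (⊤ : Subgroup G)) (‖p‖ ^ Nat.card G)
  two_le : 2 ≤ q
  frob : ∀ x, ‖x‖ ≤ 1 → ‖φ x - x ^ q‖ < 1
  solvable : ResiduallySolvable (fixedSub (E := E) (⊤ : Subgroup G))

namespace FrobeniusData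

variable {φ : RingAut E} {p : E} {q : ℕ}

omit [CompleteSpace E] [IsUltrametricDist E] in
lemma pow_isometry (D : FrobeniusData E G φ p q) (n : ℕ) (x : E) : ‖(φ ^ n) x‖ = ‖x‖ := by
  induction n with
  | zero => simp
  | succ n ih => rw [pow_succ']; exact (D.isometry _).trans ih

omit [CompleteSpace E] [IsUltrametricDist E] in
lemma pow_comm (D : FrobeniusData E G φ p q) (n : ℕ) (g : G) (x : E) :
    (φ ^ n) (g • x) = g • (φ ^ n) x := by
  induction n with
  | zero => simp
  | succ n ih =>
    rw [pow_succ']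
    change φ ((φ ^ n) _) = g • φ ((φ ^ n) _)
    rw [ih, D.comm]

omit [CompleteSpace E] [IsUltrametricDist E] in
lemma pow_unif (D : FrobeniusData E G φ p q) (n : ℕ) : (φ ^ n) p = p := by
  induction n with
  | zero => simp
  | succ n ih => rw [pow_succ']; exact (congrArg φ ih).trans D.map_unif

/-- Passing from `φ` to a power of it. -/
lemma exists_pow_map_eq_top (D : FrobeniusData E G φ p q) {n : ℕ} (hn : n ≠ 0) {u : E}
    (hu : ‖u‖ = 1) : ∃ d : E, ‖d‖ = 1 ∧ (φ ^ n) d = u * d := by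
  obtain ⟨d, -, h⟩ := exists_map_div_eq (⊤ : Subfield E) isClosed_univ
    (fun f hf hf' => by
      obtain ⟨x, -, h⟩ := D.solvable f hf hf'
      exact ⟨x, trivial, h⟩)
    (ϖ := p) trivial D.unif_pos D.unif_lt D.value (φ ^ n) (D.pow_isometry n) (fun _ _ => trivial)
    (D.pow_unif n) (Q := q ^ n) (D.two_le.trans (Nat.le_self_pow hn q))
    (norm_iterate_sub_pow_lt φ D.isometry D.frob n) (u := u) trivial hu
  exact ⟨d, h⟩

lemma exists_pow_map_eq_fixed (D : FrobeniusData E G φ p q) {n : ℕ} (hn : n ≠ 0) {u : E}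
    (huG : ∀ g : G, g • u = u) (hu : ‖u‖ = 1) :
    ∃ d : E, (∀ g : G, g • d = d) ∧ ‖d‖ = 1 ∧ (φ ^ n) d = u * d := by
  have hN : ‖subNorm (⊤ : Subgroup G) p‖ = ‖p‖ ^ Nat.card G := by
    rw [norm_subNorm D.isometry_smul, Subgroup.card_top]
  obtain ⟨d, hd, h⟩ := exists_map_div_eq (fixedSub (E := E) (⊤ : Subgroup G))
    (isClosed_fixedSub D.isometry_smul _) D.solvable (subNorm_mem (⊤ : Subgroup G) p)
    (by rw [hN]; exact pow_pos D.unif_pos _)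
    (by rw [hN]; exact pow_lt_one₀ D.unif_pos.le D.unif_lt Nat.card_pos.ne')
    (by rw [hN]; exact D.value_fixed) (φ ^ n) (D.pow_isometry n)
    (fun x hx => by
      rw [mem_fixedSub] at hx ⊢
      intro g hg
      rw [← D.pow_comm, hx g hg])
    (by rw [map_subNorm _ (D.pow_comm n), D.pow_unif]) (Q := q ^ n)
    (D.two_le.trans (Nat.le_self_pow hn q)) (norm_iterate_sub_pow_lt φ D.isometry D.frob n)
    (u := u) (mem_fixedSub.2 fun g _ => huG g) hu
  exact ⟨d, fun g => mem_fixedSub.1 hd g trivial, h⟩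

/-- Surjectivity of the unramified norm on units. -/
theorem exists_prod_iterate_eq (D : FrobeniusData E G φ p q) {n : ℕ} (hn : n ≠ 0) {u : E}
    (huG : ∀ g : G, g • u = u) (huφ : φ u = u) (hu : ‖u‖ = 1) :
    ∃ x : E, (∀ g : G, g • x = x) ∧ (φ ^ n) x = x ∧ ‖x‖ = 1 ∧
      ∏ i ∈ Finset.range n, (φ ^ i) x = u := by
  obtain ⟨a, haG, ha1, ha⟩ := D.exists_pow_map_eq_fixed hn huG hu
  have ha0 : a ≠ 0 := by rintro rfl; simp at ha1
  refine ⟨φ a / a, fun g => ?_, ?_, ?_, ?_⟩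
  · rw [div_eq_mul_inv, smul_mul', smul_inv'', haG, ← D.comm, haG]
  · have h1 : (φ ^ n) (φ a) = φ ((φ ^ n) a) := by
      change (φ ^ n * φ) a = (φ * φ ^ n) a
      rw [← pow_succ, ← pow_succ']
    have hu0 : u ≠ 0 := by rintro rfl; simp at hu
    rw [map_div₀, h1, ha, map_mul, huφ, mul_div_mul_left _ _ hu0]
  · rw [norm_div, D.isometry, ha1, div_one]
  · rw [prod_iterate_div φ n ha0, ha, mul_div_cancel_right₀ _ ha0]

/-- A unit fixed by `G` and `φ ^ n` whose unramified norm is a norm from the ramified extension is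
itself a norm of a unit fixed by `φ ^ n`. -/
theorem exists_subNorm_eq (D : FrobeniusData E G φ p q) {n : ℕ} (hn : n ≠ 0) {x y : E}
    (hxG : ∀ g : G, g • x = x) (hx : ‖x‖ = 1) (hyφ : φ y = y)
    (hy : ‖y‖ = 1) (hxy : ∏ i ∈ Finset.range n, (φ ^ i) x = subNorm (⊤ : Subgroup G) y) :
    ∃ z : E, (φ ^ n) z = z ∧ ‖z‖ = 1 ∧ subNorm (⊤ : Subgroup G) z = x := by
  have hcomm : ∀ a, (φ ^ n) (φ a) = φ ((φ ^ n) a) := by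
    intro a
    change (φ ^ n * φ) a = (φ * φ ^ n) a
    rw [← pow_succ, ← pow_succ']
  have hne : ∀ {a : E}, ‖a‖ = 1 → a ≠ 0 := by rintro a h rfl; simp at h
  obtain ⟨a, ha1, ha⟩ := D.exists_pow_map_eq_top hn hy
  have ha0 := hne ha1
  set z := φ a / a with hz
  have hz1 : ‖z‖ = 1 := by rw [hz, norm_div, D.isometry, ha1, div_one]
  have hzφ : (φ ^ n) z = z := by
    rw [hz, map_div₀, hcomm, ha, map_mul, hyφ, mul_div_mul_left _ _ (hne hy)]
  have hzy : ∏ i ∈ Finset.range n, (φ ^ i) z = y := by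
    rw [hz, prod_iterate_div φ n ha0, ha, mul_div_cancel_right₀ _ ha0]
  have hNz1 : ‖subNorm (⊤ : Subgroup G) z‖ = 1 := by rw [norm_subNorm D.isometry_smul, hz1, one_pow]
  have hNfix : ∀ (c : E) (g : G), g • subNorm (⊤ : Subgroup G) c = subNorm (⊤ : Subgroup G) c :=
    fun c g => mem_fixedSub.1 (subNorm_mem (⊤ : Subgroup G) c) g trivial
  set x₁ := x / subNorm (⊤ : Subgroup G) z with hx₁
  have hx₁G : ∀ g : G, g • x₁ = x₁ := fun g => by
    rw [hx₁, div_eq_mul_inv, smul_mul', smul_inv'', hxG, hNfix]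
  have hx₁1 : ‖x₁‖ = 1 := by rw [hx₁, norm_div, hx, hNz1, div_one]
  have hx₁φ : ∏ i ∈ Finset.range n, (φ ^ i) x₁ = 1 := by
    simp_rw [hx₁, map_div₀, Finset.prod_div_distrib, map_subNorm _ (D.pow_comm _)]
    have : ∏ i ∈ Finset.range n, subNorm (⊤ : Subgroup G) ((φ ^ i) z) =
        subNorm (⊤ : Subgroup G) y := by
      rw [← hzy, subNorm]
      simp_rw [subNorm, Finset.smul_prod']
      rw [Finset.prod_comm]
    rw [this, hxy, div_self (subNorm_ne_zero _ (hne hy))]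
  obtain ⟨b, hbG, hb1, hb⟩ := D.exists_pow_map_eq_fixed one_ne_zero hx₁G hx₁1
  rw [pow_one] at hb
  have hb0 := hne hb1
  have hbx : φ b / b = x₁ := by rw [hb, mul_div_cancel_right₀ _ hb0]
  have hbψ : (φ ^ n) b = b := by
    have h := prod_iterate_div φ n hb0
    rw [hbx, hx₁φ] at h
    exact ((div_eq_one_iff_eq hb0).1 h.symm)
  obtain ⟨hA, hB⟩ := subNorm_surjective_and_ker D.isometry_smul D.solvable D.unif_pos D.unif_lt
    D.value_fixed
  obtain ⟨c, hc⟩ := hA b hbG hb0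
  have hc1 : ‖c‖ = 1 := by
    have h := norm_subNorm D.isometry_smul (⊤ : Subgroup G) c
    rw [hc, hb1] at h
    exact (pow_eq_one_iff_of_nonneg (norm_nonneg _) Nat.card_pos.ne').1 h.symm
  have hc0 := hne hc1
  obtain ⟨f, hf0, hf⟩ := hB ((φ ^ n) c / c) (by
    rw [subNorm_div, ← map_subNorm _ (D.pow_comm n), hc, hbψ, div_self hb0])
  have he : ∀ σ, ∃ e : E, ‖e‖ = 1 ∧ (φ ^ n) e * f σ = φ (f σ) * e := by
    intro σ
    obtain ⟨k, hk⟩ := D.value (f σ) trivial (hf0 σ)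
    have hp0 : p ≠ 0 := norm_pos_iff.1 D.unif_pos
    have hpk : p ^ k ≠ 0 := zpow_ne_zero _ hp0
    have hu : ‖f σ / p ^ k‖ = 1 := by
      rw [norm_div, norm_zpow, hk, div_self (zpow_ne_zero _ D.unif_pos.ne')]
    obtain ⟨d, hd1, hd⟩ := D.exists_pow_map_eq_top hn hu
    have hd0 := hne hd1
    refine ⟨φ d / d, by rw [norm_div, D.isometry, hd1, div_one], ?_⟩
    have hf0' := hf0 σ
    rw [map_div₀, hcomm, hd, map_mul, map_div₀, map_zpow₀, D.map_unif]
    field_simp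
  choose e he1 he using he
  have he0 : ∀ σ, e σ ≠ 0 := fun σ => hne (he1 σ)
  have hX1 := norm_coboundaryProd D.isometry_smul e he0
  have hX0 := hne hX1
  have hF1 := norm_coboundaryProd D.isometry_smul f hf0
  have hF0 := hne hF1
  have hXψ : (φ ^ n) (coboundaryProd e) * coboundaryProd f =
      φ (coboundaryProd f) * coboundaryProd e := by
    rw [coboundaryProd_map _ (D.pow_comm n), coboundaryProd_map _ D.comm, ← coboundaryProd_mul,
      ← coboundaryProd_mul]
    congr 1
    funext σ
    exact he σ
  set w := φ c / c / coboundaryProd e with hw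
  have hw1 : ‖w‖ = 1 := by rw [hw, norm_div, norm_div, D.isometry, hc1, hX1]; simp
  have hψc : (φ ^ n) c = coboundaryProd f * c := by rw [hf, div_mul_cancel₀ _ hc0]
  have hwψ : (φ ^ n) w = w := by
    have hψX0 : (φ ^ n) (coboundaryProd e) ≠ 0 := (map_ne_zero (φ ^ n)).2 hX0
    have hψX : (φ ^ n) (coboundaryProd e) =
        φ (coboundaryProd f) * coboundaryProd e / coboundaryProd f := by
      rw [← hXψ, mul_div_cancel_right₀ _ hF0]
    have hφF0 : φ (coboundaryProd f) ≠ 0 := by simpa using hF0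
    rw [hw, map_div₀, map_div₀, hcomm, hψc, map_mul, hψX]
    field_simp
  have hwN : subNorm (⊤ : Subgroup G) w = x₁ := by
    rw [hw, subNorm_div, subNorm_div, ← map_subNorm _ D.comm, hc, subNorm_coboundaryProd e he0,
      div_one, hbx]
  refine ⟨z * w, by rw [map_mul, hzφ, hwψ], by rw [norm_mul, hz1, hw1, one_mul], ?_⟩
  rw [subNorm_mul, hwN, hx₁, mul_div_cancel₀ _ (hne hNz1)]

end FrobeniusData

end Core

section Residue

/-- The unit ball of an ultrametric normed field. -/
noncomputable abbrev unitBall (E : Type*) [NormedField E] [IsUltrametricDist E] :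
    ValuationSubring E := (NormedField.valuation (K := E)).valuationSubring

/-- The residue field of an ultrametric normed field. -/
abbrev ResField (E : Type*) [NormedField E] [IsUltrametricDist E] : Type _ :=
  IsLocalRing.ResidueField (unitBall E)

section

variable {E : Type*} [NormedField E] [IsUltrametricDist E]

lemma mem_unitBall {x : E} : x ∈ unitBall E ↔ ‖x‖ ≤ 1 := by
  rw [Valuation.mem_valuationSubring_iff, NormedField.valuation_apply, ← NNReal.coe_le_coe]; simp

lemma residue_eq_zero_iff (x : unitBall E) :
    IsLocalRing.residue (unitBall E) x = 0 ↔ ‖(x : E)‖ < 1 := by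
  rw [IsLocalRing.residue_eq_zero_iff, IsLocalRing.mem_maximalIdeal, mem_nonunits_iff, not_iff_comm]
  have hx := mem_unitBall.1 x.2
  constructor
  · intro h
    have h1 : ‖(x : E)‖ = 1 := le_antisymm hx (not_lt.1 h)
    have h0 : (x : E) ≠ 0 := by intro h0; simp [h0] at h1
    refine IsUnit.of_mul_eq_one ⟨(x : E)⁻¹, mem_unitBall.2 (by simp [h1])⟩ ?_
    ext; simp [h0]
  · intro h hlt
    obtain ⟨y, hy⟩ := h.exists_right_inv
    have : ‖(x : E)‖ * ‖(y : E)‖ = 1 := by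
      rw [← norm_mul, ← MulMemClass.coe_mul, hy]; simp
    have hy := mem_unitBall.1 y.2
    nlinarith [norm_nonneg (x : E), norm_nonneg (y : E)]

lemma residue_eq_iff (x y : unitBall E) :
    IsLocalRing.residue (unitBall E) x = IsLocalRing.residue (unitBall E) y ↔
      ‖(x : E) - y‖ < 1 := by
  rw [← sub_eq_zero, ← map_sub, residue_eq_zero_iff]; simp

omit [IsUltrametricDist E] in
lemma norm_le_one_of_pow_eq {x : E} {Q : ℕ} (hQ : 2 ≤ Q) (h : x ^ Q = x) : ‖x‖ ≤ 1 := by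
  by_contra! h1
  have := congrArg norm h
  rw [norm_pow] at this
  have := pow_lt_pow_right₀ h1 (show 1 < Q by omega)
  simp at this; linarith

omit [IsUltrametricDist E] in
lemma norm_eq_one_of_pow_eq {x : E} {Q : ℕ} (hQ : 2 ≤ Q) (h : x ^ Q = x) (h0 : x ≠ 0) :
    ‖x‖ = 1 := by
  have h1 : x ^ (Q - 1) = 1 := by
    have : x ^ (Q - 1) * x = 1 * x := by rw [← pow_succ, Nat.sub_add_cancel (by omega), h, one_mul]
    exact mul_right_cancel₀ h0 this
  have := congrArg norm h1
  rw [norm_pow, norm_one] at this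
  exact (pow_eq_one_iff_of_nonneg (norm_nonneg _) (by omega)).1 this

lemma norm_lt_one_trans {x y z : E} (h1 : ‖x - y‖ < 1) (h2 : ‖y - z‖ < 1) : ‖x - z‖ < 1 := by
  have := IsUltrametricDist.norm_add_le_max (x - y) (y - z)
  rw [sub_add_sub_cancel] at this
  exact this.trans_lt (max_lt h1 h2)

lemma norm_le_one_of_near {x y : E} (hx : ‖x‖ ≤ 1) (h : ‖x - y‖ < 1) : ‖y‖ ≤ 1 := by
  have := norm_sub_le_max_of_ultrametric x (x - y)
  rw [sub_sub_cancel] at this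
  exact this.trans (max_le hx h.le)

lemma norm_pow_sub_pow_lt {x y : E} (hx : ‖x‖ ≤ 1) (h : ‖x - y‖ < 1) (k : ℕ) :
    ‖x ^ k - y ^ k‖ < 1 := by
  have hy := norm_le_one_of_near hx h
  have h1 := (residue_eq_iff ⟨x, mem_unitBall.2 hx⟩ ⟨y, mem_unitBall.2 hy⟩).2 h
  have := congrArg (· ^ k) h1
  simp only [← map_pow] at this
  simpa using (residue_eq_iff _ _).1 this

lemma charP_resField {p : ℕ} (hp : p.Prime) (h : ‖(p : E)‖ < 1) : CharP (ResField E) p := by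
  refine (CharP.charP_iff_prime_eq_zero hp).2 ?_
  have := (residue_eq_zero_iff ((p : ℕ) : unitBall E)).2 (by simpa using h)
  simpa using this

/-- Two Teichmüller elements congruent modulo the maximal ideal are equal. -/
lemma eq_of_pow_eq_of_near {x y : E} {p k : ℕ} (hp : p.Prime) (hk : k ≠ 0) (h : ‖(p : E)‖ < 1)
    (hx : x ^ p ^ k = x) (hy : y ^ p ^ k = y) (hxy : ‖x - y‖ < 1) : x = y := by
  have := charP_resField hp h
  have hQ : 2 ≤ p ^ k := hp.two_le.trans (Nat.le_self_pow hk p)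
  have hx1 := norm_le_one_of_pow_eq hQ hx
  have hy1 := norm_le_one_of_pow_eq hQ hy
  by_contra hne
  let X : unitBall E := ⟨x, mem_unitBall.2 hx1⟩
  let Y : unitBall E := ⟨y, mem_unitBall.2 hy1⟩
  have hXY : IsLocalRing.residue _ X = IsLocalRing.residue _ Y := (residue_eq_iff X Y).2 hxy
  have h1 := Commute.geom_sum₂_mul (Commute.all X Y) (p ^ k)
  have h2 : IsLocalRing.residue _
      (∑ i ∈ Finset.range (p ^ k), X ^ i * Y ^ (p ^ k - 1 - i)) = 0 := by
    simp only [map_sum, map_mul, map_pow, hXY]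
    rw [Finset.sum_congr rfl (g := fun _ => IsLocalRing.residue _ Y ^ (p ^ k - 1))]
    · simp [hk]
    · intro i hi
      rw [← pow_add]; congr 1; simp at hi; omega
  rw [residue_eq_zero_iff] at h2
  have h3 : X ^ p ^ k - Y ^ p ^ k = X - Y := by ext; simp [X, Y, hx, hy]
  rw [h3] at h1
  have h4 := congrArg (fun z : unitBall E => ‖(z : E)‖) h1
  simp only [MulMemClass.coe_mul, norm_mul] at h4
  have h5 : 0 < ‖((X - Y : unitBall E) : E)‖ := by
    simpa [X, Y] using norm_pos_iff.2 (sub_ne_zero.2 hne)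
  nlinarith

end

/-- The residue field of `K` has `q` elements, and the norm on `Ω` is Galois invariant. -/
structure ResidueData (K Ω : Type*) [NormedField K] [NormedField Ω] [NormedAlgebra K Ω]
    (p q : ℕ) : Prop where
  prime : p.Prime
  exists_pow : ∃ r, r ≠ 0 ∧ q = p ^ r
  norm_p : ‖(p : Ω)‖ < 1
  frob : ∀ a : K, ‖a‖ ≤ 1 → ‖a ^ q - a‖ < 1
  reps : ∃ S : Finset K, S.card = q ∧ (∀ s ∈ S, ‖s‖ ≤ 1) ∧
    ∀ s ∈ S, ∀ t ∈ S, ‖s - t‖ < 1 → s = t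
  inv : ∀ (σ : Ω ≃ₐ[K] Ω) (x : Ω), ‖σ x‖ = ‖x‖

namespace ResidueData

variable {K Ω : Type*} [NormedField K] [NormedField Ω] [NormedAlgebra K Ω] [IsUltrametricDist Ω]
  {p q : ℕ}

omit [IsUltrametricDist Ω] in
lemma two_le (D : ResidueData K Ω p q) : 2 ≤ q := by
  obtain ⟨r, hr, rfl⟩ := D.exists_pow
  exact D.prime.two_le.trans (Nat.le_self_pow hr p)

omit [IsUltrametricDist Ω] in
lemma two_le_pow (D : ResidueData K Ω p q) {m : ℕ} (hm : m ≠ 0) : 2 ≤ q ^ m :=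
  D.two_le.trans (Nat.le_self_pow hm q)

omit [IsUltrametricDist Ω] in
lemma exists_pow_pow (D : ResidueData K Ω p q) {m : ℕ} (hm : m ≠ 0) :
    ∃ r, r ≠ 0 ∧ q ^ m = p ^ r := by
  obtain ⟨r, hr, rfl⟩ := D.exists_pow
  exact ⟨r * m, by positivity, (pow_mul _ _ _).symm⟩

lemma norm_coeff_le {g : Polynomial Ω} (hg : g.Splits) (hm : g.Monic) (hr : ∀ x ∈ g.roots, ‖x‖ ≤ 1)
    (i : ℕ) : ‖g.coeff i‖ ≤ 1 := by
  have : g ∈ Polynomial.lifts (unitBall Ω).subtype := by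
    rw [hg.eq_prod_roots_of_monic hm]
    refine Subsemiring.multiset_prod_mem _ _ fun f hf => ?_
    obtain ⟨x, hx, rfl⟩ := Multiset.mem_map.1 hf
    refine (Polynomial.mem_lifts _).2 ⟨X - C ⟨x, mem_unitBall.2 (hr x hx)⟩, by simp⟩
  obtain ⟨a, ha⟩ := (lifts_iff_coeff_lifts _).1 this i
  rw [← ha]
  exact mem_unitBall.1 a.2

omit [IsUltrametricDist Ω] in
lemma norm_minpoly_root (D : ResidueData K Ω p q) [Algebra.IsAlgebraic K Ω] [IsAlgClosed Ω]
    {F : Type*} [Field F] [Algebra K F] [Algebra F Ω] [IsScalarTower K F Ω] {x y : Ω}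
    (hy : y ∈ ((minpoly F x).map (algebraMap F Ω)).roots) : ‖y‖ = ‖x‖ := by
  have : Algebra.IsAlgebraic F Ω := Algebra.IsAlgebraic.tower_top (K := K) F
  have : IsAlgClosure F Ω := ⟨inferInstance, inferInstance⟩
  have : Normal F Ω := IsAlgClosure.normal F Ω
  have hc : IsConjRoot F x y := by
    refine (isConjRoot_iff_aeval_eq_zero (Algebra.IsIntegral.isIntegral x)).2 ?_
    have := (mem_roots'.1 hy).2
    rwa [IsRoot, eval_map_algebraMap] at this
  obtain ⟨σ, hσ⟩ := isConjRoot_iff_exists_algEquiv.1 hc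
  have := D.inv (σ.restrictScalars K) y
  rw [← this, ← hσ]; rfl

lemma norm_minpoly_coeff (D : ResidueData K Ω p q) [Algebra.IsAlgebraic K Ω] [IsAlgClosed Ω]
    {F : Type*} [Field F] [Algebra K F] [Algebra F Ω] [IsScalarTower K F Ω] {x : Ω}
    (hx : ‖x‖ ≤ 1) (i : ℕ) : ‖algebraMap F Ω ((minpoly F x).coeff i)‖ ≤ 1 := by
  have : Algebra.IsAlgebraic F Ω := Algebra.IsAlgebraic.tower_top (K := K) F
  rw [← coeff_map]
  refine norm_coeff_le (IsAlgClosed.splits _)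
    ((minpoly.monic (Algebra.IsIntegral.isIntegral x)).map _) (fun y hy => ?_) i
  rw [D.norm_minpoly_root hy]; exact hx

lemma exists_near_pow (D : ResidueData K Ω p q) [Algebra.IsAlgebraic K Ω] [IsAlgClosed Ω] {x : Ω}
    (hx : ‖x‖ ≤ 1) : ∃ m, m ≠ 0 ∧ ‖x ^ q ^ m - x‖ < 1 := by
  have hprime : Fact p.Prime := ⟨D.prime⟩
  have := charP_resField D.prime D.norm_p
  let _ : Algebra (ZMod p) (ResField Ω) := ZMod.algebra _ p
  set g := (minpoly K x).map (algebraMap K Ω) with hg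
  have hmonic : g.Monic := (minpoly.monic (Algebra.IsIntegral.isIntegral x)).map _
  obtain ⟨G, hG, hdeg, hGm⟩ := lifts_and_natDegree_eq_and_monic (f := (unitBall Ω).subtype)
    ((lifts_iff_coeff_lifts g).2 fun i =>
      ⟨⟨g.coeff i, mem_unitBall.2 (by rw [hg, coeff_map]; exact D.norm_minpoly_coeff hx i)⟩, rfl⟩)
    hmonic
  let X' : unitBall Ω := ⟨x, mem_unitBall.2 hx⟩
  have hXint : IsIntegral (ZMod p) (IsLocalRing.residue _ X') := by
    refine IsIntegral.of_aeval_monic_of_isIntegral_coeff (p := G.map (IsLocalRing.residue _))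
      (hGm.map _) ?_ ?_ ?_
    · rw [hGm.natDegree_map, hdeg, hg, natDegree_map]
      exact (minpoly.natDegree_pos (Algebra.IsIntegral.isIntegral x)).ne'
    · have h0 : G.eval X' = 0 := by
        apply Subtype.ext
        have : (unitBall Ω).subtype (G.eval X') = (G.map (unitBall Ω).subtype).eval x := by
          rw [eval_map]; exact (eval₂_at_apply (unitBall Ω).subtype X').symm
        change (unitBall Ω).subtype _ = _
        rw [this, hG, hg, eval_map_algebraMap, minpoly.aeval]; rfl
      rw [eval_map, eval₂_at_apply, h0, map_zero]
      exact isIntegral_zero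
    · intro i
      rw [coeff_map]
      have hc : ((G.coeff i : unitBall Ω) : Ω) = algebraMap K Ω ((minpoly K x).coeff i) := by
        rw [← coeff_map, ← hg, ← hG, coeff_map]; rfl
      have hn : ‖(minpoly K x).coeff i‖ ≤ 1 := by
        rw [← norm_algebraMap' Ω, ← hc]; exact mem_unitBall.1 (G.coeff i).2
      have h1 := D.frob _ hn
      rw [← norm_algebraMap' Ω, map_sub, map_pow, ← hc] at h1
      have h2 := (residue_eq_iff (G.coeff i ^ q) (G.coeff i)).2 (by simpa using h1)
      rw [map_pow] at h2
      refine ⟨X ^ q - X, ?_, by simp [h2]⟩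
      exact monic_X_pow_sub (by rw [degree_X]; exact_mod_cast D.two_le)
  have : FiniteDimensional (ZMod p)
      (IntermediateField.adjoin (ZMod p) {IsLocalRing.residue _ X'}) :=
    IntermediateField.adjoin.finiteDimensional hXint
  set A := IntermediateField.adjoin (ZMod p) {IsLocalRing.residue _ X'}
  let a : A := ⟨_, IntermediateField.mem_adjoin_simple_self (ZMod p) (IsLocalRing.residue _ X')⟩
  have : Finite A := Module.finite_of_finite (ZMod p)
  have := Fintype.ofFinite A
  refine ⟨Module.finrank (ZMod p) A, Module.finrank_pos.ne', ?_⟩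
  obtain ⟨r, hr, rfl⟩ := D.exists_pow
  have h1 := FiniteField.pow_card_pow r a
  rw [← Nat.card_eq_fintype_card, Module.natCard_eq_pow_finrank (K := ZMod p), Nat.card_zmod,
    ← pow_mul, mul_comm, pow_mul] at h1
  have h2 := congrArg (algebraMap A (ResField Ω)) h1
  rw [map_pow] at h2
  have h3 := (residue_eq_iff (X' ^ (p ^ r) ^ Module.finrank (ZMod p) A) X').1 (by
    rw [map_pow]; exact h2)
  simpa using h3

end ResidueData

end Residue

section Teich

/-- Teichmüller representatives: `x ^ q ^ m = x` for some positive `m`. -/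
def IsTeich {E : Type*} [Monoid E] (q : ℕ) (x : E) : Prop := ∃ m, m ≠ 0 ∧ x ^ q ^ m = x

lemma pow_pow_mul_eq {E : Type*} [Monoid E] {q m : ℕ} {x : E} (h : x ^ q ^ m = x) (k : ℕ) :
    x ^ q ^ (m * k) = x := by
  induction k with
  | zero => simp
  | succ k ih => rw [Nat.mul_succ, pow_add, pow_mul, ih, h]

lemma pow_pow_eq_of_dvd {E : Type*} [Monoid E] {q m N : ℕ} {x : E} (h : x ^ q ^ m = x)
    (hN : m ∣ N) : x ^ q ^ N = x := by
  obtain ⟨k, rfl⟩ := hN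
  exact pow_pow_mul_eq h k

lemma IsTeich.mul {E : Type*} [CommMonoid E] {q : ℕ} {x y : E} (hx : IsTeich q x)
    (hy : IsTeich q y) : IsTeich q (x * y) := by
  obtain ⟨m, hm, h⟩ := hx
  obtain ⟨m', hm', h'⟩ := hy
  refine ⟨m * m', by positivity, ?_⟩
  rw [mul_pow, pow_pow_mul_eq h, mul_comm m, pow_pow_mul_eq h']

lemma IsTeich.one {E : Type*} [Monoid E] (q : ℕ) : IsTeich q (1 : E) := ⟨1, one_ne_zero, by simp⟩

lemma IsTeich.pow {E : Type*} [Monoid E] {q : ℕ} {x : E} (hx : IsTeich q x) (k : ℕ) :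
    IsTeich q (x ^ k) := by
  obtain ⟨m, hm, h⟩ := hx
  exact ⟨m, hm, by rw [← pow_mul, mul_comm, pow_mul, h]⟩

lemma IsTeich.map {E E' F : Type*} [Monoid E] [Monoid E'] [FunLike F E E'] [MonoidHomClass F E E']
    {q : ℕ} {x : E} (hx : IsTeich q x) (f : F) : IsTeich q (f x) := by
  obtain ⟨m, hm, h⟩ := hx
  exact ⟨m, hm, by rw [← map_pow, h]⟩

namespace ResidueData

variable {K Ω : Type*} [NormedField K] [NormedField Ω] [NormedAlgebra K Ω] [IsUltrametricDist Ω]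
  {p q : ℕ}

lemma teich_eq_of_near (D : ResidueData K Ω p q) {x y : Ω} (hx : IsTeich q x)
    (hy : IsTeich q y) (h : ‖x - y‖ < 1) : x = y := by
  obtain ⟨m, hm, h1⟩ := hx
  obtain ⟨m', hm', h2⟩ := hy
  obtain ⟨r, hr, hr'⟩ := D.exists_pow_pow (m := m * m') (by positivity)
  refine eq_of_pow_eq_of_near D.prime hr D.norm_p ?_ ?_ h
  · rw [← hr', pow_pow_mul_eq h1]
  · rw [← hr', mul_comm, pow_pow_mul_eq h2]

omit [IsUltrametricDist Ω] in
lemma teich_norm_le (D : ResidueData K Ω p q) {x : Ω} (hx : IsTeich q x) : ‖x‖ ≤ 1 := by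
  obtain ⟨m, hm, h⟩ := hx
  exact norm_le_one_of_pow_eq (D.two_le_pow hm) h

omit [IsUltrametricDist Ω] in
lemma teich_norm_eq (D : ResidueData K Ω p q) {x : Ω} (hx : IsTeich q x) (h0 : x ≠ 0) :
    ‖x‖ = 1 := by
  obtain ⟨m, hm, h⟩ := hx
  exact norm_eq_one_of_pow_eq (D.two_le_pow hm) h h0

omit [IsUltrametricDist Ω] [NormedAlgebra K Ω] [NormedField K] in
lemma exists_near_root [IsAlgClosed Ω] {f : Polynomial Ω} (hf : f.Monic) {x : Ω}
    (hx : ‖f.eval x‖ < 1) :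
    ∃ y ∈ f.roots, ‖x - y‖ < 1 := by
  by_contra! h
  rw [(IsAlgClosed.splits f).eq_prod_roots_of_monic hf, eval_multiset_prod,
    Multiset.map_map, ← coe_nnnorm, ← NNReal.coe_one, NNReal.coe_lt_coe] at hx
  have := map_multiset_prod (nnnormHom : Ω →*₀ NNReal)
    (Multiset.map (eval x ∘ fun a => X - C a) f.roots)
  change ‖(Multiset.map (eval x ∘ fun a => X - C a) f.roots).prod‖₊ = _ at this
  rw [this, Multiset.map_map] at hx
  have h2 : (1 : NNReal) ≤
      (Multiset.map ((nnnormHom : Ω →*₀ NNReal) ∘ (eval x ∘ fun a => X - C a)) f.roots).prod := by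
    refine Multiset.one_le_prod fun a ha => ?_
    obtain ⟨b, hb, rfl⟩ := Multiset.mem_map.1 ha
    have := h b hb
    simpa [← NNReal.coe_le_coe] using this
  exact absurd hx (not_lt.2 h2)

lemma exists_teich_near (D : ResidueData K Ω p q) [Algebra.IsAlgebraic K Ω] [IsAlgClosed Ω] {x : Ω}
    (hx : ‖x‖ ≤ 1) : ∃ ζ, IsTeich q ζ ∧ ‖x - ζ‖ < 1 := by
  obtain ⟨m, hm, h⟩ := D.exists_near_pow hx
  have hQ := D.two_le_pow hm
  obtain ⟨ζ, hζ, h1⟩ := exists_near_root (f := X ^ q ^ m - X) (x := x)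
    (monic_X_pow_sub (by rw [degree_X]; exact_mod_cast hQ)) (by simpa using h)
  refine ⟨ζ, ⟨m, hm, ?_⟩, h1⟩
  have := (mem_roots'.1 hζ).2
  simpa [sub_eq_zero] using this

lemma exists_near_base (D : ResidueData K Ω p q) {x : Ω} (hx : ‖x‖ ≤ 1) (h : ‖x ^ q - x‖ < 1) :
    ∃ a : K, ‖a‖ ≤ 1 ∧ ‖x - algebraMap K Ω a‖ < 1 := by
  classical
  obtain ⟨S, hS, hS1, hinj⟩ := D.reps
  let f : Polynomial (ResField Ω) := X ^ q - X
  have hf : f.Monic := monic_X_pow_sub (by rw [degree_X]; exact_mod_cast D.two_le)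
  have hdeg : f.natDegree = q := by
    have : f.degree = (q : ℕ) := by
      rw [degree_sub_eq_left_of_degree_lt] <;> simp only [degree_X_pow, degree_X]
      exact_mod_cast D.two_le
    exact natDegree_eq_of_degree_eq_some this
  let r : S → ResField Ω := fun s => IsLocalRing.residue _
    ⟨algebraMap K Ω s, mem_unitBall.2 (by rw [norm_algebraMap']; exact hS1 s s.2)⟩
  have hr : Function.Injective r := by
    intro s t hst
    have := (residue_eq_iff _ _).1 hst
    simp only [← map_sub, norm_algebraMap'] at this
    exact Subtype.ext (hinj s s.2 t t.2 this)
  have himg : Finset.image r Finset.univ ⊆ f.roots.toFinset := by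
    intro y hy
    obtain ⟨s, -, rfl⟩ := Finset.mem_image.1 hy
    rw [Multiset.mem_toFinset, mem_roots hf.ne_zero]
    simp only [f, IsRoot, eval_sub, eval_pow, eval_X, sub_eq_zero, r, ← map_pow]
    rw [residue_eq_iff]
    have := D.frob s (hS1 s s.2)
    rw [← norm_algebraMap' Ω] at this
    simpa using this
  have heq := Finset.eq_of_subset_of_card_le himg (by
    rw [Finset.card_image_of_injective _ hr]
    refine (Multiset.toFinset_card_le _).trans ((card_roots' f).trans ?_)
    simp [hS, hdeg])
  have hxr : IsLocalRing.residue _ (⟨x, mem_unitBall.2 hx⟩ : unitBall Ω) ∈ f.roots.toFinset := by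
    rw [Multiset.mem_toFinset, mem_roots hf.ne_zero]
    simp only [f, IsRoot, eval_sub, eval_pow, eval_X, sub_eq_zero, ← map_pow]
    rw [residue_eq_iff]
    simpa using h
  rw [← heq] at hxr
  obtain ⟨s, -, hs⟩ := Finset.mem_image.1 hxr
  refine ⟨s, hS1 s s.2, ?_⟩
  exact (residue_eq_iff _ _).1 hs.symm

lemma natCast_ne_zero (D : ResidueData K Ω p q) {m : ℕ} (hm : m ≠ 0) :
    ‖((q ^ m - 1 : ℕ) : Ω)‖ = 1 := by
  obtain ⟨r, hr, h⟩ := D.exists_pow_pow hm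
  have h1 : ‖((q ^ m : ℕ) : Ω)‖ < 1 := by
    rw [h]; push_cast; rw [norm_pow]
    exact pow_lt_one₀ (norm_nonneg _) D.norm_p hr
  have h2 : 1 ≤ q ^ m := by have := D.two_le_pow hm; omega
  rw [Nat.cast_sub h2, ← norm_neg]
  apply norm_eq_one_of_norm_sub_one_lt
  simp only [Nat.cast_one, neg_sub, sub_sub_cancel_left, norm_neg]
  exact h1

lemma exists_primitive (D : ResidueData K Ω p q) [IsAlgClosed Ω] {m : ℕ} (hm : m ≠ 0) :
    ∃ ζ : Ω, IsPrimitiveRoot ζ (q ^ m - 1) ∧ ζ ^ q ^ m = ζ ∧ ζ ≠ 0 ∧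
      ∀ x : Ω, x ^ q ^ m = x → x ≠ 0 → ∃ i, x = ζ ^ i := by
  have hne : NeZero ((q ^ m - 1 : ℕ) : Ω) := ⟨by
    have := D.natCast_ne_zero hm; intro h; rw [h] at this; simp at this⟩
  have hQ := D.two_le_pow hm
  have hpos : NeZero (q ^ m - 1) := ⟨by omega⟩
  obtain ⟨ζ, hζ⟩ := HasEnoughRootsOfUnity.exists_primitiveRoot Ω (q ^ m - 1)
  have hsplit : q ^ m = q ^ m - 1 + 1 := by omega
  refine ⟨ζ, hζ, ?_, hζ.ne_zero (by omega), fun x hx h0 => ?_⟩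
  · rw [hsplit, pow_succ, hζ.pow_eq_one, one_mul]
  · have : x ^ (q ^ m - 1) = 1 := by
      apply mul_right_cancel₀ h0
      rw [← pow_succ, ← hsplit, hx, one_mul]
    obtain ⟨i, -, hi⟩ := hζ.eq_pow_of_pow_eq_one this
    exact ⟨i, hi.symm⟩

/-- A `K`-automorphism acts on the Teichmüller elements of level `m` as a power of Frobenius. -/
lemma exists_frob_exponent (D : ResidueData K Ω p q) [IsAlgClosed Ω] (σ : Ω ≃ₐ[K] Ω)
    {m : ℕ} (hm : m ≠ 0) : ∃ i, ∀ x : Ω, x ^ q ^ m = x → σ x = x ^ q ^ i := by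
  obtain ⟨ζ, -, hζ, hζ0, hgen⟩ := D.exists_primitive hm
  suffices h : ∃ i, σ ζ = ζ ^ q ^ i by
    obtain ⟨i, hi⟩ := h
    have hq : q ^ i ≠ 0 := pow_ne_zero _ (by have := D.two_le; omega)
    refine ⟨i, fun x hx => ?_⟩
    rcases eq_or_ne x 0 with rfl | h0
    · rw [map_zero, zero_pow hq]
    · obtain ⟨j, rfl⟩ := hgen x hx h0
      rw [map_pow, hi, ← pow_mul, ← pow_mul, mul_comm]
  have := charP_resField D.prime D.norm_p
  have : ExpChar (ResField Ω) p := ExpChar.prime D.prime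
  obtain ⟨r, hr, hqr⟩ := D.exists_pow
  have hT : IsTeich q ζ := ⟨m, hm, hζ⟩
  let Z : unitBall Ω := ⟨ζ, mem_unitBall.2 (D.teich_norm_le hT)⟩
  let W : unitBall Ω := ⟨σ ζ, mem_unitBall.2 (D.teich_norm_le (hT.map σ))⟩
  let z := IsLocalRing.residue _ Z
  have hz : z ^ q ^ m = z := by
    simp only [z, ← map_pow]; congr 1; ext; simpa [Z] using hζ
  let h : Polynomial (ResField Ω) := ∏ i ∈ Finset.range m, (X - C (z ^ q ^ i))
  have hcoeff : ∀ j, (h.coeff j) ^ q = h.coeff j := by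
    intro j
    have h1 : h.map (iterateFrobenius (ResField Ω) p r) = h := by
      simp only [h, Polynomial.map_prod, Polynomial.map_sub, map_X, map_C, iterateFrobenius_def,
        ← hqr]
      obtain ⟨m', rfl⟩ := Nat.exists_eq_succ_of_ne_zero hm
      rw [Finset.prod_range_succ, Finset.prod_range_succ']
      simp only [← pow_mul, ← pow_succ]
      rw [hz]; simp
    have := congrArg (fun f => f.coeff j) h1
    simpa [coeff_map, iterateFrobenius_def, ← hqr] using this
  have hlift : ∀ j, ∃ a : K, ‖a‖ ≤ 1 ∧ ∃ ha : algebraMap K Ω a ∈ unitBall Ω,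
      IsLocalRing.residue (unitBall Ω) ⟨algebraMap K Ω a, ha⟩ = h.coeff j := by
    intro j
    obtain ⟨c, hc⟩ := IsLocalRing.residue_surjective (h.coeff j)
    have h1 := hcoeff j
    rw [← hc, ← map_pow, residue_eq_iff] at h1
    obtain ⟨a, ha, hca⟩ := D.exists_near_base (mem_unitBall.1 c.2) (by simpa using h1)
    refine ⟨a, ha, mem_unitBall.2 (by rwa [norm_algebraMap']), ?_⟩
    rw [← hc, eq_comm, residue_eq_iff]
    exact hca
  choose a ha1 ha hres using hlift
  have hval : ∀ Y : unitBall Ω, h.eval (IsLocalRing.residue _ Y) = IsLocalRing.residue _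
      (∑ j ∈ Finset.range (h.natDegree + 1), ⟨algebraMap K Ω (a j), ha j⟩ * Y ^ j) := by
    intro Y
    rw [eval_eq_sum_range]
    simp [hres]
  have hz0 : h.eval z = 0 := by
    rw [eval_prod]
    exact Finset.prod_eq_zero (i := 0) (Finset.mem_range.2 (by omega)) (by simp)
  have hw0 : h.eval (IsLocalRing.residue _ W) = 0 := by
    rw [hval, residue_eq_zero_iff] at hz0 ⊢
    rw [← D.inv σ] at hz0
    simpa [Z, W] using hz0
  rw [eval_prod, Finset.prod_eq_zero_iff] at hw0
  obtain ⟨i, -, hi⟩ := hw0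
  refine ⟨i, D.teich_eq_of_near (hT.map σ) (hT.pow _) ?_⟩
  have h2 : IsLocalRing.residue _ W = IsLocalRing.residue _ (Z ^ q ^ i) := by
    simpa [sub_eq_zero, z] using hi
  simpa using (residue_eq_iff _ _).1 h2

/-- Over a field with the same residue field as `K` there is a Frobenius automorphism at each
finite level. -/
lemma exists_frob_level (D : ResidueData K Ω p q) [Algebra.IsAlgebraic K Ω] [IsAlgClosed Ω]
    {F : Type*} [Field F] [Algebra K F] [Algebra F Ω] [IsScalarTower K F Ω]
    (hF : ∀ a : F, ‖algebraMap F Ω a‖ ≤ 1 → ‖algebraMap F Ω a ^ q - algebraMap F Ω a‖ < 1)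
    {m : ℕ} (hm : m ≠ 0) :
    ∃ σ : Ω ≃ₐ[F] Ω, ∀ x : Ω, x ^ q ^ m = x → σ x = x ^ q := by
  obtain ⟨ζ, -, hζ, hζ0, hgen⟩ := D.exists_primitive hm
  have hq0 : q ≠ 0 := by have := D.two_le; omega
  suffices h : ∃ σ : Ω ≃ₐ[F] Ω, σ ζ = ζ ^ q by
    obtain ⟨σ, hσ⟩ := h
    refine ⟨σ, fun x hx => ?_⟩
    rcases eq_or_ne x 0 with rfl | h0
    · simp [hq0]
    · obtain ⟨j, rfl⟩ := hgen x hx h0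
      rw [map_pow, hσ, ← pow_mul, ← pow_mul, mul_comm]
  have := charP_resField D.prime D.norm_p
  have : ExpChar (ResField Ω) p := ExpChar.prime D.prime
  obtain ⟨r, hr, hqr⟩ := D.exists_pow
  have hT : IsTeich q ζ := ⟨m, hm, hζ⟩
  have hn := D.teich_norm_le hT
  have : Algebra.IsAlgebraic F Ω := Algebra.IsAlgebraic.tower_top (K := K) F
  have : IsAlgClosure F Ω := ⟨inferInstance, inferInstance⟩
  have : Normal F Ω := IsAlgClosure.normal F Ω
  have hmonic := (minpoly.monic (Algebra.IsIntegral.isIntegral (R := F) ζ))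
  set g := minpoly F ζ with hg
  let Z : unitBall Ω := ⟨ζ, mem_unitBall.2 hn⟩
  have hc : ∀ i, algebraMap F Ω (g.coeff i) ∈ unitBall Ω := fun i =>
    mem_unitBall.2 (D.norm_minpoly_coeff hn i)
  have hval : ∀ Y : unitBall Ω, ((∑ j ∈ Finset.range (g.natDegree + 1),
      ⟨algebraMap F Ω (g.coeff j), hc j⟩ * Y ^ j : unitBall Ω) : Ω) = aeval (Y : Ω) g := by
    intro Y
    rw [aeval_eq_sum_range]
    simp [Algebra.smul_def]
  have hsmall : ‖aeval (ζ ^ q) g‖ < 1 := by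
    have h1 := hval (Z ^ q)
    simp only [SubmonoidClass.coe_pow, Z] at h1
    rw [← h1, ← residue_eq_zero_iff]
    have h2 : IsLocalRing.residue (unitBall Ω) (∑ j ∈ Finset.range (g.natDegree + 1),
      ⟨algebraMap F Ω (g.coeff j), hc j⟩ * Z ^ j) = 0 := by
      rw [residue_eq_zero_iff, hval, minpoly.aeval]; simp
    have h3 := congrArg (iterateFrobenius (ResField Ω) p r) h2
    rw [map_zero, map_sum, map_sum] at h3
    rw [map_sum, ← h3]
    refine Finset.sum_congr rfl fun j _ => ?_
    have h4 : IsLocalRing.residue (unitBall Ω) ⟨algebraMap F Ω (g.coeff j), hc j⟩ ^ q =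
        IsLocalRing.residue (unitBall Ω) ⟨algebraMap F Ω (g.coeff j), hc j⟩ := by
      rw [← map_pow, residue_eq_iff]
      simpa using hF _ (mem_unitBall.1 (hc j))
    simp only [map_mul, map_pow, iterateFrobenius_def, ← hqr]
    rw [h4, ← pow_mul]
  obtain ⟨y, hy, hy1⟩ := exists_near_root (f := g.map (algebraMap F Ω)) (x := ζ ^ q)
    (hmonic.map _) (by rwa [eval_map_algebraMap])
  have hconj : IsConjRoot F ζ y := by
    refine (isConjRoot_iff_aeval_eq_zero (Algebra.IsIntegral.isIntegral ζ)).2 ?_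
    have := (mem_roots'.1 hy).2
    rwa [IsRoot, eval_map_algebraMap] at this
  obtain ⟨σ, hσ⟩ := isConjRoot_iff_exists_algEquiv.1 hconj
  have hσ' : ζ = σ y := hσ.symm
  have hy' : IsTeich q y := by
    have : y = σ.symm ζ := by rw [hσ']; simp
    rw [this]
    exact hT.map σ.symm
  have := D.teich_eq_of_near (hT.pow q) hy' hy1
  refine ⟨σ.symm, ?_⟩
  rw [this, hσ']; simp

end ResidueData

end Teich

section Galois

/-- A separable element fixed by all automorphisms lies in the base field. -/
lemma mem_range_of_fixed {F Ω : Type*} [Field F] [Field Ω] [Algebra F Ω]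
    [Normal F Ω] [IsAlgClosed Ω] {x : Ω} (hx : IsSeparable F x)
    (h : ∀ σ : Ω ≃ₐ[F] Ω, σ x = x) : x ∈ (algebraMap F Ω).range := by
  have key := notMem_iff_exists_ne_and_isConjRoot (K := F) (x := x) hx (IsAlgClosed.splits _)
  by_contra hn
  obtain ⟨y, hy, hc⟩ := key.1 (fun hb => hn (by
    obtain ⟨a, ha⟩ := Algebra.mem_bot.1 hb
    exact ⟨a, ha⟩))
  obtain ⟨σ, hσ⟩ := isConjRoot_iff_exists_algEquiv.1 hc.symm
  exact hy ((h σ).symm.trans hσ)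

/-- A limit of a sequence of automorphisms of an algebraic extension along an ultrafilter. -/
lemma exists_limit_algEquiv {F Ω : Type*} [Field F] [Field Ω] [Algebra F Ω]
    [Algebra.IsAlgebraic F Ω] (θ : ℕ → (Ω ≃ₐ[F] Ω)) :
    ∃ σ : Ω ≃ₐ[F] Ω, ∀ x y, (∀ᶠ m in Filter.atTop, θ m x = y) → σ x = y := by
  classical
  let U := Filter.hyperfilter ℕ
  have hU : (U : Filter ℕ) ≤ Filter.atTop := Nat.hyperfilter_le_atTop
  have h1 : ∀ x, ∃ y, ∀ᶠ m in (U : Filter ℕ), θ m x = y := by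
    intro x
    have hne : minpoly F x ≠ 0 := minpoly.ne_zero (Algebra.IsIntegral.isIntegral x)
    have hfin : ((minpoly F x).rootSet Ω).Finite := rootSet_finite _ _
    have : (⋃ y ∈ (minpoly F x).rootSet Ω, {m | θ m x = y}) ∈ U := by
      refine Filter.mem_of_superset Filter.univ_mem fun m _ => ?_
      simp only [Set.mem_iUnion]
      refine ⟨θ m x, (mem_rootSet.2 ⟨hne, ?_⟩), rfl⟩
      rw [aeval_algEquiv, AlgHom.comp_apply, minpoly.aeval]; simp
    obtain ⟨y, -, hy⟩ := (Ultrafilter.finite_biUnion_mem_iff hfin).1 this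
    exact ⟨y, hy⟩
  choose f hf using h1
  have huniq : ∀ x y, (∀ᶠ m in (U : Filter ℕ), θ m x = y) → f x = y := by
    intro x y hy
    obtain ⟨m, h1, h2⟩ := ((hf x).and hy).exists
    exact h1.symm.trans h2
  let g : Ω →ₐ[F] Ω :=
    { toFun := f
      map_one' := huniq _ _ (by simp)
      map_mul' := fun x y => huniq _ _ (by
        filter_upwards [hf x, hf y] with m h1 h2; rw [map_mul, h1, h2])
      map_zero' := huniq _ _ (by simp)
      map_add' := fun x y => huniq _ _ (by
        filter_upwards [hf x, hf y] with m h1 h2; rw [map_add, h1, h2])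
      commutes' := fun a => huniq _ _ (by simp) }
  exact ⟨AlgEquiv.ofBijective g (Algebra.IsAlgebraic.algHom_bijective g),
    fun x y h => huniq x y (h.filter_mono hU)⟩

namespace ResidueData

variable {K Ω : Type*} [NormedField K] [NormedField Ω] [NormedAlgebra K Ω] [IsUltrametricDist Ω]
  {p q : ℕ}

lemma teich_separable (D : ResidueData K Ω p q) {F : Type*} [Field F] [Algebra F Ω] {x : Ω}
    (hx : IsTeich q x) : IsSeparable F x := by
  rcases eq_or_ne x 0 with rfl | h0
  · have := isSeparable_algebraMap (F := F) (K := Ω) (0 : F)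
    rwa [map_zero] at this
  obtain ⟨m, hm, h⟩ := hx
  have hQ := D.two_le_pow hm
  have hsplit : q ^ m = q ^ m - 1 + 1 := by omega
  have h1 : x ^ (q ^ m - 1) = 1 := by
    apply mul_right_cancel₀ h0
    rw [← pow_succ, ← hsplit, h, one_mul]
  have hs : (X ^ (q ^ m - 1) - 1 : F[X]).Separable := by
    rw [X_pow_sub_one_separable_iff]
    intro h0
    have := congrArg (algebraMap F Ω) h0
    have h2 := D.natCast_ne_zero hm
    rw [map_natCast, map_zero] at this
    rw [this] at h2; simp at h2
  exact hs.of_dvd (minpoly.dvd _ _ (by simp [h1]))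

omit [IsUltrametricDist Ω] in
lemma pow_factorial_eq {x : Ω} {m M : ℕ} (hm : m ≠ 0) (h : x ^ q ^ m = x) (hM : m ≤ M) :
    x ^ q ^ M.factorial = x :=
  pow_pow_eq_of_dvd h (Nat.dvd_factorial (by omega) hM)

lemma exists_frobenius (D : ResidueData K Ω p q) [Algebra.IsAlgebraic K Ω] [IsAlgClosed Ω]
    {F : Type*} [Field F] [Algebra K F] [Algebra F Ω] [IsScalarTower K F Ω]
    (hF : ∀ a : F, ‖algebraMap F Ω a‖ ≤ 1 → ‖algebraMap F Ω a ^ q - algebraMap F Ω a‖ < 1) :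
    ∃ φ : Ω ≃ₐ[F] Ω, ∀ x : Ω, IsTeich q x → φ x = x ^ q := by
  have : Algebra.IsAlgebraic F Ω := Algebra.IsAlgebraic.tower_top (K := K) F
  choose θ hθ using fun m : ℕ => D.exists_frob_level hF (Nat.factorial_ne_zero m)
  obtain ⟨φ, hφ⟩ := exists_limit_algEquiv θ
  refine ⟨φ, fun x ⟨m, hm, h⟩ => hφ _ _ ?_⟩
  filter_upwards [Filter.eventually_ge_atTop m] with M hM
  exact hθ M x (pow_factorial_eq hm h hM)

omit [IsUltrametricDist Ω] in
lemma frob_pow_apply {φ : Ω ≃ₐ[K] Ω} (hφ : ∀ x : Ω, IsTeich q x → φ x = x ^ q) {x : Ω}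
    (hx : IsTeich q x) (i : ℕ) : (φ ^ i) x = x ^ q ^ i := by
  induction i with
  | zero => simp
  | succ i ih => rw [pow_succ', AlgEquiv.mul_apply, ih, hφ _ (hx.pow _), ← pow_mul, ← pow_succ]

lemma exists_lift (D : ResidueData K Ω p q) [Algebra.IsAlgebraic K Ω] [IsAlgClosed Ω]
    {φ : Ω ≃ₐ[K] Ω} (hφ : ∀ x : Ω, IsTeich q x → φ x = x ^ q) (τ : Ω ≃ₐ[K] Ω) :
    ∃ θ : Ω ≃ₐ[K] Ω, (∀ x, IsTeich q x → θ x = x) ∧ ∀ y, φ (τ y) = τ y → θ y = τ y := by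
  choose i hi using fun m : ℕ => D.exists_frob_exponent τ (Nat.factorial_ne_zero m)
  obtain ⟨θ, hθ⟩ := exists_limit_algEquiv (fun m => (φ ^ i m)⁻¹ * τ)
  have hinv : ∀ (n : ℕ) x y, (φ ^ n) x = y → (φ ^ n)⁻¹ y = x := by
    rintro n x _ rfl
    rw [← AlgEquiv.mul_apply, inv_mul_cancel]; rfl
  refine ⟨θ, fun x hx => hθ _ _ ?_, fun y hy => hθ _ _ (.of_forall fun m => ?_)⟩
  · obtain ⟨m, hm, h⟩ := hx
    filter_upwards [Filter.eventually_ge_atTop m] with M hM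
    rw [AlgEquiv.mul_apply]
    apply hinv
    rw [frob_pow_apply hφ ⟨m, hm, h⟩, hi M x (pow_factorial_eq hm h hM)]
  · rw [AlgEquiv.mul_apply]
    apply hinv
    induction i m with
    | zero => simp
    | succ k ih => rw [pow_succ, AlgEquiv.mul_apply, hy, ih]

end ResidueData

end Galois

section Value

open IntermediateField

/-- The extension of `F` generated by the Teichmüller elements. -/
abbrev teichField (F Ω : Type*) [Field F] [Field Ω] [Algebra F Ω] (q : ℕ) :
    IntermediateField F Ω := adjoin F {x : Ω | IsTeich q x}

lemma eq_on_teichField {F Ω Ω' : Type*} [Field F] [Field Ω] [Field Ω'] [Algebra F Ω] {q : ℕ}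
    {f g : Ω →+* Ω'} (hF : ∀ a : F, f (algebraMap F Ω a) = g (algebraMap F Ω a))
    (hT : ∀ x, IsTeich q x → f x = g x) {x : Ω} (hx : x ∈ teichField F Ω q) : f x = g x := by
  induction hx using adjoin_induction with
  | mem x hx => exact hT x hx
  | algebraMap a => exact hF a
  | add x y _ _ h1 h2 => rw [map_add, map_add, h1, h2]
  | inv x _ h => rw [map_inv₀, map_inv₀, h]
  | mul x y _ _ h1 h2 => rw [map_mul, map_mul, h1, h2]

lemma map_mem_teichField {F Ω : Type*} [Field F] [Field Ω] [Algebra F Ω] {q : ℕ}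
    {f : Ω →+* Ω} (hF : ∀ a : F, f (algebraMap F Ω a) ∈ teichField F Ω q) {x : Ω}
    (hx : x ∈ teichField F Ω q) : f x ∈ teichField F Ω q := by
  induction hx using adjoin_induction with
  | mem x hx => exact subset_adjoin _ _ (IsTeich.map hx f)
  | algebraMap a => exact hF a
  | add x y _ _ h1 h2 => rw [map_add]; exact add_mem h1 h2
  | inv x _ h => rw [map_inv₀]; exact inv_mem h
  | mul x y _ _ h1 h2 => rw [map_mul]; exact mul_mem h1 h2

lemma exists_level {F Ω : Type*} [Field F] [Field Ω] [Algebra F Ω] {q : ℕ} {x : Ω}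
    (hx : x ∈ teichField F Ω q) : ∃ m, m ≠ 0 ∧ x ∈ adjoin F {x : Ω | x ^ q ^ m = x} := by
  have mono : ∀ {m k : ℕ}, m ∣ k →
      adjoin F {x : Ω | x ^ q ^ m = x} ≤ adjoin F {x : Ω | x ^ q ^ k = x} := fun h =>
    adjoin.mono _ _ _ fun y hy => pow_pow_eq_of_dvd hy h
  induction hx using adjoin_induction with
  | mem x hx =>
    obtain ⟨m, hm, h⟩ := hx
    exact ⟨m, hm, subset_adjoin _ _ h⟩
  | algebraMap a => exact ⟨1, one_ne_zero, _root_.algebraMap_mem _ a⟩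
  | add x y _ _ h1 h2 =>
    obtain ⟨m, hm, h⟩ := h1
    obtain ⟨k, hk, h'⟩ := h2
    exact ⟨m * k, by positivity, add_mem (mono (Dvd.intro _ rfl) h)
      (mono (Dvd.intro_left _ rfl) h')⟩
  | inv x _ h =>
    obtain ⟨m, hm, h⟩ := h
    exact ⟨m, hm, inv_mem h⟩
  | mul x y _ _ h1 h2 =>
    obtain ⟨m, hm, h⟩ := h1
    obtain ⟨k, hk, h'⟩ := h2
    exact ⟨m * k, by positivity, mul_mem (mono (Dvd.intro _ rfl) h)
      (mono (Dvd.intro_left _ rfl) h')⟩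

lemma eq_on_level {F Ω : Type*} [Field F] [Field Ω] [Algebra F Ω] {q m : ℕ}
    {f g : Ω →+* Ω} (hF : ∀ a : F, f (algebraMap F Ω a) = g (algebraMap F Ω a))
    (hT : ∀ x : Ω, x ^ q ^ m = x → f x = g x) {x : Ω}
    (hx : x ∈ adjoin F {x : Ω | x ^ q ^ m = x}) : f x = g x := by
  induction hx using adjoin_induction with
  | mem x hx => exact hT x hx
  | algebraMap a => exact hF a
  | add x y _ _ h1 h2 => rw [map_add, map_add, h1, h2]
  | inv x _ h => rw [map_inv₀, map_inv₀, h]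
  | mul x y _ _ h1 h2 => rw [map_mul, map_mul, h1, h2]

namespace ResidueData

variable {K Ω : Type*} [NormedField K] [NormedField Ω] [NormedAlgebra K Ω] [IsUltrametricDist Ω]
  {p q : ℕ} {F : Type*} [Field F] [Algebra K F] [Algebra F Ω] [IsScalarTower K F Ω]

omit [Algebra K F] [IsScalarTower K F Ω] in
lemma separable_of_mem_teichField (D : ResidueData K Ω p q) {x : Ω}
    (hx : x ∈ teichField F Ω q) : IsSeparable F x := by
  have : Algebra.IsSeparable F (teichField F Ω q) :=
    (isSeparable_adjoin_iff_isSeparable _ _).2 fun y hy => D.teich_separable hy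
  have h := Algebra.IsSeparable.isSeparable F (⟨x, hx⟩ : teichField F Ω q)
  rw [IsSeparable, minpoly_eq] at h
  exact h

omit [IsUltrametricDist Ω] in
lemma pow_apply_of_fixed {φ : Ω ≃ₐ[K] Ω} {x : Ω} (h : φ x = x) (i : ℕ) : (φ ^ i) x = x := by
  induction i with
  | zero => simp
  | succ k ih => rw [pow_succ, AlgEquiv.mul_apply, h, ih]

lemma mem_range_of_frob_fixed (D : ResidueData K Ω p q) [Algebra.IsAlgebraic K Ω]
    [IsAlgClosed Ω] {φ : Ω ≃ₐ[K] Ω} (hφ : ∀ x : Ω, IsTeich q x → φ x = x ^ q)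
    (hφF : ∀ a : F, φ (algebraMap F Ω a) = algebraMap F Ω a) {x : Ω}
    (hx : x ∈ teichField F Ω q) (h : φ x = x) : x ∈ (algebraMap F Ω).range := by
  have : Algebra.IsAlgebraic F Ω := Algebra.IsAlgebraic.tower_top (K := K) F
  have : IsAlgClosure F Ω := ⟨inferInstance, inferInstance⟩
  have : Normal F Ω := IsAlgClosure.normal F Ω
  obtain ⟨m, hm, hxm⟩ := exists_level hx
  refine mem_range_of_fixed (D.separable_of_mem_teichField hx) fun σ => ?_
  obtain ⟨i, hi⟩ := D.exists_frob_exponent (σ.restrictScalars K) hm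
  have := eq_on_level (q := q) (m := m) (f := (σ : Ω →+* Ω)) (g := ((φ ^ i : Ω ≃ₐ[K] Ω) : Ω →+* Ω))
    (fun a => by
      have := pow_apply_of_fixed (hφF a) i
      simpa using this.symm)
    (fun y hy => by
      have h1 := hi y hy
      have h2 := frob_pow_apply hφ ⟨m, hm, hy⟩ i
      exact h1.trans h2.symm) hxm
  exact this.trans (pow_apply_of_fixed h i)

/-- Adjoining Teichmüller elements does not enlarge the value group. -/
lemma exists_norm_eq (D : ResidueData K Ω p q) [Algebra.IsAlgebraic K Ω]
    [IsAlgClosed Ω] {φ : Ω ≃ₐ[K] Ω} (hφ : ∀ x : Ω, IsTeich q x → φ x = x ^ q)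
    (hφF : ∀ a : F, φ (algebraMap F Ω a) = algebraMap F Ω a) {x : Ω}
    (hx : x ∈ teichField F Ω q) : ∃ a : F, ‖algebraMap F Ω a‖ = ‖x‖ := by
  rcases eq_or_ne x 0 with rfl | h0
  · exact ⟨0, by simp⟩
  obtain ⟨m, hm, hxm⟩ := exists_level hx
  obtain ⟨ζ, hζp, hζ, hζ0, -⟩ := D.exists_primitive hm
  have hT : IsTeich q ζ := ⟨m, hm, hζ⟩
  have hQ := D.two_le_pow hm
  set N := q ^ m - 1 with hN
  have hφm : (φ ^ m) x = x := by
    refine eq_on_level (q := q) (m := m) (f := ((φ ^ m : Ω ≃ₐ[K] Ω) : Ω →+* Ω))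
      (g := RingHom.id Ω) (fun a => ?_) (fun y hy => ?_) hxm
    · simpa using pow_apply_of_fixed (hφF a) m
    · have := frob_pow_apply hφ ⟨m, hm, hy⟩ m
      rw [hy] at this; exact this
  have hinv : ∀ i y, ‖(φ ^ i) y‖ = ‖y‖ := fun i y => D.inv _ _
  have hζ1 := D.teich_norm_eq hT hζ0
  let a : ℕ → Ω := fun j => ∑ i ∈ Finset.range m, (φ ^ i) (ζ ^ j * x)
  have hmem : ∀ j, ∃ b : F, algebraMap F Ω b = a j := by
    intro j
    have hy : ζ ^ j * x ∈ teichField F Ω q :=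
      mul_mem (pow_mem (subset_adjoin F {x : Ω | IsTeich q x} hT) j) hx
    have hpow : ∀ i : ℕ, (φ ^ i) (ζ ^ j * x) ∈ teichField F Ω q := fun i =>
      map_mem_teichField (f := ((φ ^ i : Ω ≃ₐ[K] Ω) : Ω →+* Ω)) (fun b => by
        have := pow_apply_of_fixed (hφF b) i
        simp only [RingHom.coe_coe]
        rw [this]; exact _root_.algebraMap_mem _ b) hy
    refine D.mem_range_of_frob_fixed hφ hφF (sum_mem fun i _ => hpow i) ?_
    have hm' : (φ ^ m) (ζ ^ j * x) = ζ ^ j * x := by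
      rw [map_mul, map_pow, hφm, frob_pow_apply hφ hT, hζ]
    obtain ⟨m', rfl⟩ := Nat.exists_eq_succ_of_ne_zero hm
    change _ = ∑ i ∈ Finset.range (m' + 1), (φ ^ i) (ζ ^ j * x)
    rw [map_sum, Finset.sum_range_succ, Finset.sum_range_succ']
    simp only [← AlgEquiv.mul_apply, ← pow_succ']
    rw [hm']; simp
  have hle : ∀ j, ‖a j‖ ≤ ‖x‖ := fun j =>
    IsUltrametricDist.norm_sum_le_of_forall_le_of_nonneg (norm_nonneg _) fun i _ => by
      rw [hinv, norm_mul, norm_pow, hζ1, one_pow, one_mul]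
  by_contra! hne
  have hlt : ∀ j, ‖a j‖ < ‖x‖ := by
    intro j
    obtain ⟨b, hb⟩ := hmem j
    exact lt_of_le_of_ne (hle j) (hb ▸ hne b)
  have hsum : (N : Ω) * x = ∑ j ∈ Finset.range N, (ζ ^ j)⁻¹ * a j := by
    simp only [a, Finset.mul_sum]
    rw [Finset.sum_comm]
    have hterm : ∀ i ∈ Finset.range m, ∑ j ∈ Finset.range N, (ζ ^ j)⁻¹ * (φ ^ i) (ζ ^ j * x) =
        if i = 0 then N * x else 0 := by
      intro i hi
      have h1 : ∀ j, (ζ ^ j)⁻¹ * (φ ^ i) (ζ ^ j * x) = (ζ ^ (q ^ i - 1)) ^ j * (φ ^ i) x := by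
        intro j
        have hqi : 1 ≤ q ^ i := Nat.one_le_pow _ _ (by have := D.two_le; omega)
        have : (ζ ^ q ^ i) ^ j = (ζ ^ (q ^ i - 1)) ^ j * ζ ^ j := by
          rw [← mul_pow, ← pow_succ, Nat.sub_add_cancel hqi]
        rw [map_mul, map_pow, frob_pow_apply hφ hT, this]
        field_simp
      rw [Finset.sum_congr rfl fun j _ => h1 j, ← Finset.sum_mul]
      split_ifs with hi0
      · subst hi0; simp
      · have hqi := D.two_le_pow hi0
        have hlt : q ^ i < q ^ m :=
          Nat.pow_lt_pow_right (by have := D.two_le; omega) (Finset.mem_range.1 hi)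
        have hne1 : ζ ^ (q ^ i - 1) ≠ 1 := hζp.pow_ne_one_of_pos_of_lt (by omega) (by omega)
        rw [geom_sum_eq hne1, ← pow_mul, mul_comm, mul_comm (q ^ i - 1), pow_mul, hζp.pow_eq_one]
        simp
    rw [Finset.sum_congr rfl hterm]
    simp [hm]
  have hxpos : 0 < ‖x‖ := norm_pos_iff.2 h0
  have hb := congrArg norm hsum
  rw [norm_mul, D.natCast_ne_zero hm, one_mul] at hb
  have hNne : (Finset.range N).Nonempty := ⟨0, Finset.mem_range.2 (by omega)⟩
  obtain ⟨j, -, hj⟩ := IsUltrametricDist.exists_norm_finsetSum_le_of_nonempty hNne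
    (fun j => (ζ ^ j)⁻¹ * a j)
  rw [← hb, norm_mul, norm_inv, norm_pow, hζ1, one_pow, inv_one, one_mul] at hj
  exact absurd (hlt j) (not_lt.2 hj)

end ResidueData

end Value

section Completion

open UniformSpace

variable {E : Type*} [NormedField E]

lemma exists_completion_near (x : Completion E) {ε : ℝ} (hε : 0 < ε) :
    ∃ y : E, ‖x - y‖ < ε := by
  obtain ⟨_, ⟨y, rfl⟩, hy⟩ := Metric.mem_closure_iff.1
    ((Completion.denseRange_coe (α := E)) x) ε hε
  exact ⟨y, by rwa [← dist_eq_norm]⟩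

instance instIsUltrametricDistCompletion [IsUltrametricDist E] :
    IsUltrametricDist (Completion E) := by
  refine IsUltrametricDist.isUltrametricDist_of_forall_norm_add_le_max_norm fun x y => ?_
  induction x, y using Completion.induction_on₂ with
  | hp => exact isClosed_le (by fun_prop) (by fun_prop)
  | ih x y =>
    rw [← Completion.coe_add, Completion.norm_coe, Completion.norm_coe, Completion.norm_coe]
    exact IsUltrametricDist.norm_add_le_max x y

/-- The extension of an isometric endomorphism to the completion. -/
noncomputable def completionHom (f : E →+* E) (hf : ∀ x, ‖f x‖ = ‖x‖) :
    Completion E →+* Completion E :=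
  Completion.mapRingHom f (AddMonoidHomClass.isometry_of_norm f hf).continuous

lemma completionHom_coe (f : E →+* E) (hf : ∀ x, ‖f x‖ = ‖x‖) (x : E) :
    completionHom f hf x = (f x : E) :=
  Completion.map_coe (AddMonoidHomClass.isometry_of_norm f hf).uniformContinuous x

lemma continuous_completionHom (f : E →+* E) (hf : ∀ x, ‖f x‖ = ‖x‖) :
    Continuous (completionHom f hf) := Completion.continuous_map

lemma completionHom_comp (f g : E →+* E) (hf : ∀ x, ‖f x‖ = ‖x‖) (hg : ∀ x, ‖g x‖ = ‖x‖)
    (h : ∀ x, f (g x) = x) (x : Completion E) : completionHom f hf (completionHom g hg x) = x := by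
  induction x using Completion.induction_on with
  | hp =>
    refine isClosed_eq ?_ continuous_id
    exact (continuous_completionHom f hf).comp (continuous_completionHom g hg)
  | ih x => rw [completionHom_coe, completionHom_coe, h]

/-- The extension of an isometric automorphism to the completion. -/
noncomputable def completionAut (φ : RingAut E) (hφ : ∀ x, ‖φ x‖ = ‖x‖) :
    RingAut (Completion E) :=
  have h2 : ∀ x, ‖(φ.symm : E →+* E) x‖ = ‖x‖ := fun x => by
    rw [← hφ]; simp
  { completionHom (φ : E →+* E) hφ with
    invFun := completionHom (φ.symm : E →+* E) h2
    left_inv := completionHom_comp _ _ _ _ fun x => by simp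
    right_inv := completionHom_comp _ _ _ _ fun x => by simp }

lemma completionAut_coe (φ : RingAut E) (hφ : ∀ x, ‖φ x‖ = ‖x‖) (x : E) :
    completionAut φ hφ x = (φ x : E) := completionHom_coe (φ : E →+* E) hφ x

lemma continuous_completionAut (φ : RingAut E) (hφ : ∀ x, ‖φ x‖ = ‖x‖) :
    Continuous (completionAut φ hφ) := continuous_completionHom (φ : E →+* E) hφ

lemma norm_completionAut (φ : RingAut E) (hφ : ∀ x, ‖φ x‖ = ‖x‖) (x : Completion E) :
    ‖completionAut φ hφ x‖ = ‖x‖ := by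
  induction x using Completion.induction_on with
  | hp => exact isClosed_eq (continuous_completionAut φ hφ).norm continuous_norm
  | ih x => rw [completionAut_coe, Completion.norm_coe, Completion.norm_coe, hφ]

lemma completion_smul_eq {G : Type*} [Group G] [MulSemiringAction G E]
    (h : ∀ (g : G) (x : E), ‖g • x‖ = ‖x‖) (g : G) (x : Completion E) :
    g • x = completionAut (MulSemiringAction.toRingEquiv G E g) (h g) x := rfl

lemma completion_smul_coe {G : Type*} [Group G] [MulSemiringAction G E]
    (h : ∀ (g : G) (x : E), ‖g • x‖ = ‖x‖) (g : G) (x : E) :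
    g • (x : Completion E) = ((g • x : E) : Completion E) :=
  completionAut_coe (MulSemiringAction.toRingEquiv G E g) (h g) x

lemma continuous_completion_smul {G : Type*} [Group G] [MulSemiringAction G E]
    (h : ∀ (g : G) (x : E), ‖g • x‖ = ‖x‖) (g : G) :
    Continuous fun x : Completion E => g • x :=
  continuous_completionAut (MulSemiringAction.toRingEquiv G E g) (h g)

/-- The extension of an isometric action to the completion. -/
@[reducible]
noncomputable def completionAction {G : Type*} [Group G] [MulSemiringAction G E]
    (h : ∀ (g : G) (x : E), ‖g • x‖ = ‖x‖) : MulSemiringAction G (Completion E) where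
  one_smul x := by
    induction x using Completion.induction_on with
    | hp => exact isClosed_eq (continuous_completion_smul h _) continuous_id
    | ih x => rw [completion_smul_coe h, one_smul]
  mul_smul g g' x := by
    induction x using Completion.induction_on with
    | hp =>
      refine isClosed_eq (continuous_completion_smul h _) ?_
      exact (continuous_completion_smul h _).comp (continuous_completion_smul h _)
    | ih x => rw [completion_smul_coe h, completion_smul_coe h, completion_smul_coe h, mul_smul]
  smul_zero g := by rw [completion_smul_eq h, map_zero]
  smul_add g x y := by rw [completion_smul_eq h, map_add]; rfl
  smul_one g := by rw [completion_smul_eq h, map_one]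
  smul_mul g x y := by rw [completion_smul_eq h, map_mul]; rfl

lemma coe_action {G : Type*} [Group G] [MulSemiringAction G E]
    (h : ∀ (g : G) (x : E), ‖g • x‖ = ‖x‖) (g : G) (x : E) :
    letI := completionAction h
    g • (x : Completion E) = ((g • x : E) : Completion E) :=
  completionAut_coe (MulSemiringAction.toRingEquiv G E g) (h g) x

lemma continuous_action {G : Type*} [Group G] [MulSemiringAction G E]
    (h : ∀ (g : G) (x : E), ‖g • x‖ = ‖x‖) (g : G) :
    letI := completionAction h
    Continuous fun x : Completion E => g • x :=
  continuous_completionAut (MulSemiringAction.toRingEquiv G E g) (h g)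

lemma norm_action {G : Type*} [Group G] [MulSemiringAction G E]
    (h : ∀ (g : G) (x : E), ‖g • x‖ = ‖x‖) (g : G) (x : Completion E) :
    letI := completionAction h
    ‖g • x‖ = ‖x‖ :=
  norm_completionAut (MulSemiringAction.toRingEquiv G E g) (h g) x

variable {G : Type*} [CommGroup G] [Finite G] [MulSemiringAction G E]

lemma FrobeniusData.completion [IsUltrametricDist E] {φ : RingAut E} {p : E} {q : ℕ}
    (D : FrobeniusData E G φ p q) {c : E} (hc : ∑ᶠ g : G, g • c = 1) :
    letI := completionAction D.isometry_smul
    FrobeniusData (Completion E) G (completionAut φ D.isometry) (p : Completion E) q := by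
  have := Fintype.ofFinite G
  let _ := completionAction D.isometry_smul
  have hiso := norm_action D.isometry_smul
  have coe_smul := coe_action D.isometry_smul
  have cont := continuous_action D.isometry_smul
  have hdense : ∀ x ∈ fixedSub (E := Completion E) (⊤ : Subgroup G), ∀ ε : ℝ, 0 < ε →
      ∃ y ∈ fixedSub (E := E) (⊤ : Subgroup G), ‖x - (y : Completion E)‖ < ε := by
    intro x hx ε hε
    rw [finsum_eq_sum_of_fintype] at hc
    obtain ⟨y, hy⟩ := exists_completion_near x (ε := ε / (1 + ‖c‖)) (by positivity)
    refine ⟨∑ g : G, g • (c * y), mem_fixedSub.2 fun h _ => ?_, ?_⟩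
    · rw [Finset.smul_sum]
      simp_rw [smul_smul]
      exact Fintype.sum_equiv (Equiv.mulLeft h) _ _ fun g => rfl
    · have hx1 : x = ∑ g : G, g • ((c : Completion E) * x) := by
        have h1 : ∀ g : G, g • ((c : Completion E) * x) = ((g • c : E) : Completion E) * x := by
          intro g
          rw [smul_mul', mem_fixedSub.1 hx g trivial, coe_smul]
        have h2 : ((∑ g : G, g • c : E) : Completion E) = ∑ g : G, ((g • c : E) : Completion E) :=
          map_sum (Completion.coeRingHom (α := E)) _ _
        rw [Finset.sum_congr rfl fun g _ => h1 g, ← Finset.sum_mul, ← h2, hc]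
        exact (one_mul x).symm
      have h2 : ((∑ g : G, g • (c * y) : E) : Completion E) =
          ∑ g : G, g • ((c : Completion E) * (y : Completion E)) := by
        refine (map_sum (Completion.coeRingHom (α := E)) _ _).trans ?_
        refine Finset.sum_congr rfl fun g _ => ?_
        rw [← Completion.coe_mul, coe_smul]; rfl
      rw [h2]
      nth_rewrite 1 [hx1]
      rw [← Finset.sum_sub_distrib]
      refine lt_of_le_of_lt (IsUltrametricDist.norm_sum_le_of_forall_le_of_nonneg
        (C := ‖c‖ * (ε / (1 + ‖c‖))) (by positivity) fun g _ => ?_) ?_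
      · rw [← smul_sub, hiso, ← mul_sub, norm_mul, Completion.norm_coe]
        gcongr
      · rw [mul_div_assoc', div_lt_iff₀ (by positivity)]
        nlinarith [norm_nonneg c]
  have hnorm : ∀ (x : Completion E) (y : E), ‖x - y‖ < ‖x‖ → ‖x‖ = ‖y‖ := by
    intro x y h
    by_contra hne
    rw [← Completion.norm_coe y] at hne
    rw [norm_sub_eq_max_of_ne hne] at h
    exact absurd (le_max_left _ _) (not_le.2 h)
  refine
    { isometry_smul := hiso
      isometry := norm_completionAut φ _
      comm := fun g x => ?_
      map_unif := by rw [completionAut_coe, D.map_unif]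
      unif_pos := by rw [Completion.norm_coe]; exact D.unif_pos
      unif_lt := by rw [Completion.norm_coe]; exact D.unif_lt
      value := fun x _ h0 => ?_
      value_fixed := fun x hx h0 => ?_
      two_le := D.two_le
      frob := fun x hx => ?_
      solvable := fun f hf ⟨j, hj, hfj⟩ => ?_ }
  · induction x using Completion.induction_on with
    | hp =>
      refine isClosed_eq ((continuous_completionAut φ D.isometry).comp (cont g)) ?_
      exact (cont g).comp (continuous_completionAut φ D.isometry)
    | ih x => rw [completionAut_coe, coe_smul, coe_smul, completionAut_coe, D.comm]
  · obtain ⟨y, hy⟩ := exists_completion_near x (norm_pos_iff.2 h0)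
    have h := hnorm x y hy
    rw [h, Completion.norm_coe]
    refine D.value y trivial ?_
    rintro rfl
    rw [norm_zero, norm_eq_zero] at h; exact h0 h
  · obtain ⟨y, hyf, hy⟩ := hdense x hx _ (norm_pos_iff.2 h0)
    have h := hnorm x y hy
    rw [h, Completion.norm_coe]
    refine D.value_fixed y hyf ?_
    rintro rfl
    rw [norm_zero, norm_eq_zero] at h; exact h0 h
  · obtain ⟨y, hy⟩ := exists_completion_near x one_pos
    have hy1 := norm_le_one_of_near hx hy
    rw [Completion.norm_coe] at hy1
    have h1 : ‖completionAut φ D.isometry x - completionAut φ D.isometry y‖ < 1 := by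
      rw [← map_sub, norm_completionAut]; exact hy
    have h2 : ‖completionAut φ D.isometry y - (y : Completion E) ^ q‖ < 1 := by
      have := D.frob y hy1
      rw [← Completion.norm_coe, Completion.coe_sub] at this
      rw [completionAut_coe]
      have h3 : ((y ^ q : E) : Completion E) = (y : Completion E) ^ q :=
        map_pow (Completion.coeRingHom (α := E)) y q
      rwa [h3] at this
    have h3 := norm_pow_sub_pow_lt hx hy q
    rw [norm_sub_rev] at h3
    exact norm_lt_one_trans h1 (norm_lt_one_trans h2 h3)
  · choose a ha using fun i => exists_completion_near (f.coeff i) one_pos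
    have ha1 : ∀ i, ‖a i‖ ≤ 1 := fun i => by
      have := norm_le_one_of_near (hf i) (ha i)
      rwa [Completion.norm_coe] at this
    have hjd : j ≤ f.natDegree := le_natDegree_of_ne_zero (by
      intro h; rw [h, norm_zero] at hfj; exact zero_ne_one hfj)
    let f' : E[X] := ∑ i ∈ Finset.range (f.natDegree + 1), monomial i (a i)
    have hcoeff : ∀ i, f'.coeff i = if i < f.natDegree + 1 then a i else 0 := by
      intro i
      simp [f', finsetSum_coeff, coeff_monomial]
    obtain ⟨x, hx, hx1, hfx⟩ := D.solvable f' (fun i => by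
      rw [hcoeff]; split_ifs
      · exact ha1 i
      · simp) ⟨j, hj, by
        rw [hcoeff, if_pos (by omega)]
        have := hnorm _ _ ((ha j).trans_eq hfj.symm)
        rw [← Completion.norm_coe, ← Completion.norm_coe] at *
        rw [hfj] at this
        simpa using this.symm⟩
    refine ⟨x, mem_fixedSub.2 fun g hg => ?_, by rwa [Completion.norm_coe], ?_⟩
    · rw [coe_smul, mem_fixedSub.1 hx g hg]
    · have h1 : ((f'.eval x : E) : Completion E) =
          ∑ i ∈ Finset.range (f.natDegree + 1), (a i : Completion E) * (x : Completion E) ^ i := by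
        change Completion.coeRingHom (f'.eval x) = _
        simp only [f', eval_finsetSum, eval_monomial, map_sum, map_mul, map_pow]
        rfl
      rw [eval_eq_sum_range]
      have h2 : ‖∑ i ∈ Finset.range (f.natDegree + 1), f.coeff i * (x : Completion E) ^ i -
          ((f'.eval x : E) : Completion E)‖ < 1 := by
        rw [h1, ← Finset.sum_sub_distrib]
        obtain ⟨i, -, hi⟩ := IsUltrametricDist.exists_norm_finsetSum_le_of_nonempty
          (Finset.nonempty_range_add_one (n := f.natDegree))
          (fun i => f.coeff i * (x : Completion E) ^ i -
            (a i : Completion E) * (x : Completion E) ^ i)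
        refine hi.trans_lt ?_
        rw [← sub_mul, norm_mul, norm_pow, Completion.norm_coe]
        calc _ ≤ ‖f.coeff i - a i‖ * 1 := by
              gcongr; exact pow_le_one₀ (norm_nonneg _) hx1
          _ < 1 := by rw [mul_one]; exact ha i
      have h3 := norm_lt_one_trans (z := 0) h2 (by
        rw [sub_zero, Completion.norm_coe]; exact hfx)
      rwa [sub_zero] at h3

end Completion

section TotallyRamified

/-- Restriction of an automorphism to a subfield preserved by it and by its inverse. -/
noncomputable def restrictAut {Ω : Type*} [Field Ω] {S : Type*} [SetLike S Ω] [SubfieldClass S Ω]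
    (s : S) (f : Ω ≃+* Ω) (h : ∀ x ∈ s, f x ∈ s) (h' : ∀ x ∈ s, f.symm x ∈ s) : RingAut s where
  toFun x := ⟨f x, h x x.2⟩
  invFun x := ⟨f.symm x, h' x x.2⟩
  left_inv x := by ext; simp
  right_inv x := by ext; simp
  map_mul' x y := by ext; simp
  map_add' x y := by ext; simp

lemma norm_root_le_one {Ω : Type*} [NormedField Ω] [IsUltrametricDist Ω] {f : Polynomial Ω}
    (hf : ∀ i, ‖f.coeff i‖ ≤ 1) (hl : ‖f.leadingCoeff‖ = 1) {x : Ω} (hx : f.eval x = 0) :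
    ‖x‖ ≤ 1 := by
  by_contra! h1
  have h0 : f.natDegree ≠ 0 := by
    intro h0
    rw [eq_C_of_natDegree_eq_zero h0, eval_C] at hx
    rw [leadingCoeff, h0, hx] at hl
    simp at hl
  obtain ⟨d, hd⟩ := Nat.exists_eq_add_one_of_ne_zero h0
  rw [eval_eq_sum_range, Finset.sum_range_succ, add_comm] at hx
  have h2 := congrArg norm (eq_neg_of_add_eq_zero_left hx)
  rw [norm_neg, norm_mul, coeff_natDegree, hl, one_mul, norm_pow] at h2
  have h3 : ‖∑ i ∈ Finset.range f.natDegree, f.coeff i * x ^ i‖ ≤ ‖x‖ ^ d := by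
    refine IsUltrametricDist.norm_sum_le_of_forall_le_of_nonneg (by positivity) fun i hi => ?_
    rw [norm_mul, norm_pow]
    have hi : i ≤ d := by simp at hi; omega
    calc _ ≤ 1 * ‖x‖ ^ i := by gcongr; exact hf i
      _ ≤ ‖x‖ ^ d := by rw [one_mul]; exact pow_le_pow_right₀ h1.le hi
  rw [hd] at h2 h3
  rw [← h2] at h3
  exact absurd (pow_lt_pow_right₀ h1 (Nat.lt_succ_self d)) (not_lt.2 h3)

namespace ResidueData

variable {K Ω : Type*} [NormedField K] [NormedField Ω] [NormedAlgebra K Ω] [IsUltrametricDist Ω]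
  {p q : ℕ} {L : Type*} [Field L] [Algebra K L] [Algebra L Ω] [IsScalarTower K L Ω]

omit [IsUltrametricDist Ω] [Algebra K L] [IsScalarTower K L Ω] in
lemma map_mem_teichField_of_mem_range {θ : Ω ≃ₐ[K] Ω}
    (hθ : ∀ y : L, ∃ z : L, θ (algebraMap L Ω y) = algebraMap L Ω z) {x : Ω}
    (hx : x ∈ teichField L Ω q) : θ x ∈ teichField L Ω q := by
  refine map_mem_teichField (f := (θ : Ω →+* Ω)) (fun a => ?_) hx
  obtain ⟨z, hz⟩ := hθ a
  exact (show θ (algebraMap L Ω a) ∈ _ from hz ▸ _root_.algebraMap_mem _ z)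

/-- Lifts to `Ω` of the elements of the Galois group acting trivially on Teichmüller elements. -/
structure GaloisLift {G : Type*} [CommGroup G] (q : ℕ) (e : G ≃* (L ≃ₐ[K] L))
    (θ : G → Ω ≃ₐ[K] Ω) : Prop where
  teich : ∀ g x, IsTeich q x → θ g x = x
  base : ∀ g y, θ g (algebraMap L Ω y) = algebraMap L Ω (e g y)

lemma exists_galoisLift (D : ResidueData K Ω p q) [Algebra.IsAlgebraic K Ω] [IsAlgClosed Ω]
    [Normal K L] {φ : Ω ≃ₐ[K] Ω} (hφ : ∀ x : Ω, IsTeich q x → φ x = x ^ q)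
    (hφL : ∀ a : L, φ (algebraMap L Ω a) = algebraMap L Ω a) {G : Type*} [CommGroup G]
    (e : G ≃* (L ≃ₐ[K] L)) : ∃ θ : G → Ω ≃ₐ[K] Ω, GaloisLift q e θ := by
  have : IsAlgClosure K Ω := ⟨inferInstance, inferInstance⟩
  have : Normal K Ω := IsAlgClosure.normal K Ω
  choose θ hθ hθ' using fun g => D.exists_lift hφ ((e g).liftNormal Ω)
  refine ⟨θ, hθ, fun g y => ?_⟩
  have h := AlgEquiv.liftNormal_commutes (e g) Ω y
  rw [hθ', h]
  rw [h, hφL]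

namespace GaloisLift

variable {G : Type*} [CommGroup G] {e : G ≃* (L ≃ₐ[K] L)} {θ : G → Ω ≃ₐ[K] Ω}

omit [IsUltrametricDist Ω] [IsScalarTower K L Ω]

lemma mem (H : GaloisLift q e θ) (g : G) {x : Ω} (hx : x ∈ teichField L Ω q) :
    θ g x ∈ teichField L Ω q :=
  map_mem_teichField_of_mem_range (fun y => ⟨_, H.base g y⟩) hx

/-- The action of the Galois group on the field generated by the Teichmüller elements. -/
@[reducible]
noncomputable def action (H : GaloisLift q e θ) : MulSemiringAction G (teichField L Ω q) where
  smul g x := ⟨θ g x, H.mem g x.2⟩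
  one_smul x := Subtype.ext <| by
    refine eq_on_teichField (f := (θ 1 : Ω →+* Ω)) (g := RingHom.id Ω) (fun a => ?_)
      (fun x hx => H.teich 1 x hx) x.2
    simp [H.base]
  mul_smul g h x := Subtype.ext <| by
    refine eq_on_teichField (f := (θ (g * h) : Ω →+* Ω))
      (g := (θ g : Ω →+* Ω).comp (θ h : Ω →+* Ω)) (fun a => ?_) (fun x hx => ?_) x.2
    · simp [H.base]
    · simp [H.teich _ _ hx]
  smul_zero g := Subtype.ext (map_zero (θ g))
  smul_add g x y := Subtype.ext (map_add (θ g) _ _)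
  smul_one g := Subtype.ext (map_one (θ g))
  smul_mul g x y := Subtype.ext (map_mul (θ g) _ _)

lemma coe_smul (H : GaloisLift q e θ) (g : G) (x : teichField L Ω q) :
    letI := H.action
    ((g • x : teichField L Ω q) : Ω) = θ g x := rfl

end GaloisLift

/-- The Frobenius of the field generated by the Teichmüller elements. -/
noncomputable def frobAut (q : ℕ) (φ : Ω ≃ₐ[K] Ω)
    (hφL : ∀ a : L, φ (algebraMap L Ω a) = algebraMap L Ω a) : RingAut (teichField L Ω q) :=
  restrictAut (teichField L Ω q) (φ : Ω ≃+* Ω)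
    (fun _ hx => map_mem_teichField_of_mem_range (θ := φ) (fun y => ⟨y, hφL y⟩) hx)
    (fun _ hx => map_mem_teichField_of_mem_range (θ := φ.symm)
      (fun y => ⟨y, by rw [AlgEquiv.symm_apply_eq, hφL]⟩) hx)

/-- An element of `L(T)` fixed by the Galois group of `L / K` lies in `K(T)`. -/
lemma GaloisLift.mem_of_fixed (D : ResidueData K Ω p q) [Algebra.IsAlgebraic K Ω] [IsAlgClosed Ω]
    [FiniteDimensional K L] [IsGalois K L] {G : Type*} [CommGroup G]
    {e : G ≃* (L ≃ₐ[K] L)} {θ : G → Ω ≃ₐ[K] Ω} (H : GaloisLift q e θ) {x : Ω}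
    (hx : x ∈ teichField L Ω q) (hfix : ∀ g, θ g x = x) : x ∈ teichField K Ω q := by
  have : IsAlgClosure K Ω := ⟨inferInstance, inferInstance⟩
  have : Normal K Ω := IsAlgClosure.normal K Ω
  have hsL : IsSeparable L x := D.separable_of_mem_teichField hx
  have hsK : IsSeparable K x := IsSeparable.of_algebra_isSeparable_of_isSeparable K hsL
  have hs : IsSeparable (teichField K Ω q) x := hsK.tower_top _
  obtain ⟨y, rfl⟩ := mem_range_of_fixed hs fun σ => by
    let τ : L ≃ₐ[K] L := (σ.restrictScalars K).restrictNormal L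
    obtain ⟨g, hg⟩ := e.surjective τ
    rw [← hfix g]
    nth_rewrite 1 [hfix g]
    refine eq_on_teichField (f := (σ : Ω →+* Ω)) (g := (θ g : Ω →+* Ω)) (fun a => ?_)
      (fun y hy => ?_) hx
    · have := AlgEquiv.restrictNormal_commutes (σ.restrictScalars K) L a
      simp only [RingHom.coe_coe, H.base, hg]
      exact this.symm
    · simp only [RingHom.coe_coe, H.teich _ _ hy]
      exact σ.commutes ⟨y, IntermediateField.subset_adjoin _ _ hy⟩
  exact y.2

/-- The field generated by `L` and the Teichmüller elements carries the data needed for the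
norm computations. -/
lemma frobeniusData (D : ResidueData K Ω p q) [Algebra.IsAlgebraic K Ω] [IsAlgClosed Ω]
    [FiniteDimensional K L] [IsGalois K L] {φ : Ω ≃ₐ[K] Ω}
    (hφ : ∀ x : Ω, IsTeich q x → φ x = x ^ q)
    (hφL : ∀ a : L, φ (algebraMap L Ω a) = algebraMap L Ω a) {G : Type*} [CommGroup G] [Finite G]
    {e : G ≃* (L ≃ₐ[K] L)} {θ : G → Ω ≃ₐ[K] Ω} (H : GaloisLift q e θ) {π : L}
    (hπ0 : 0 < ‖algebraMap L Ω π‖) (hπ1 : ‖algebraMap L Ω π‖ < 1)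
    (hL : ∀ a : L, a ≠ 0 → ∃ k : ℤ, ‖algebraMap L Ω a‖ = ‖algebraMap L Ω π‖ ^ k)
    (hK : ∀ a : K, a ≠ 0 → ∃ k : ℤ, ‖a‖ = (‖algebraMap L Ω π‖ ^ Nat.card G) ^ k) :
    letI := H.action
    FrobeniusData (teichField L Ω q) G (frobAut q φ hφL) (algebraMap L (teichField L Ω q) π) q := by
  let _ := H.action
  have hφK : ∀ a : K, φ (algebraMap K Ω a) = algebraMap K Ω a := φ.commutes
  have hnorm : ∀ x : teichField L Ω q, ‖x‖ = ‖(x : Ω)‖ := fun x => rfl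
  have hT : ∀ ζ : Ω, IsTeich q ζ → ζ ∈ teichField L Ω q := fun ζ hζ =>
    IntermediateField.subset_adjoin _ _ hζ
  refine
    { isometry_smul := fun g x => D.inv _ _
      isometry := fun x => D.inv φ _
      comm := fun g x => Subtype.ext ?_
      map_unif := Subtype.ext (hφL π)
      unif_pos := hπ0
      unif_lt := hπ1
      value := fun x _ h0 => ?_
      value_fixed := fun x hx h0 => ?_
      two_le := D.two_le
      frob := fun x hx => ?_
      solvable := fun f hf ⟨j, hj, hfj⟩ => ?_ }
  · change φ (θ g x) = θ g (φ x)
    refine eq_on_teichField (f := (φ : Ω →+* Ω).comp (θ g : Ω →+* Ω))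
      (g := (θ g : Ω →+* Ω).comp (φ : Ω →+* Ω)) (fun a => ?_) (fun y hy => ?_) x.2
    · simp [H.base, hφL]
    · simp [H.teich _ _ hy, hφ _ hy, map_pow]
  · obtain ⟨a, ha⟩ := D.exists_norm_eq hφ hφL x.2
    have ha0 : a ≠ 0 := by
      rintro rfl
      rw [map_zero, norm_zero, eq_comm, norm_eq_zero] at ha
      exact h0 (Subtype.ext ha)
    obtain ⟨k, hk⟩ := hL a ha0
    exact ⟨k, by rw [hnorm, ← ha, hk]; rfl⟩
  · have hx' := H.mem_of_fixed D x.2 fun g =>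
      congrArg Subtype.val (mem_fixedSub.1 hx g trivial)
    obtain ⟨a, ha⟩ := D.exists_norm_eq (F := K) hφ hφK hx'
    have ha0 : a ≠ 0 := by
      rintro rfl
      rw [map_zero, norm_zero, eq_comm, norm_eq_zero] at ha
      exact h0 (Subtype.ext ha)
    obtain ⟨k, hk⟩ := hK a ha0
    exact ⟨k, by rw [hnorm, ← ha, norm_algebraMap', hk]; rfl⟩
  · obtain ⟨ζ, hζ, h1⟩ := D.exists_teich_near (x := (x : Ω)) hx
    have h2 : ‖φ (x : Ω) - ζ ^ q‖ < 1 := by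
      rw [← hφ ζ hζ, ← map_sub, D.inv]; exact h1
    have h3 := norm_pow_sub_pow_lt (show ‖(x : Ω)‖ ≤ 1 from hx) h1 q
    rw [norm_sub_rev] at h3
    change ‖φ (x : Ω) - (x : Ω) ^ q‖ < 1
    exact norm_lt_one_trans h2 h3
  · let a : ℕ → Ω := fun i => if ‖f.coeff i‖ = 1 then (f.coeff i : Ω) else 0
    have ha : ∀ i, ‖a i‖ ≤ 1 := fun i => by
      simp only [a]; split_ifs with h
      · exact h.le
      · simp
    have hjd : j ≤ f.natDegree := le_natDegree_of_ne_zero (by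
      intro h; rw [h, norm_zero] at hfj; exact zero_ne_one hfj)
    let f' : Polynomial Ω := ∑ i ∈ Finset.range (f.natDegree + 1), monomial i (a i)
    have hcoeff : ∀ i, f'.coeff i = if i < f.natDegree + 1 then a i else 0 := by
      intro i
      simp [f', finsetSum_coeff, coeff_monomial]
    have hf'j : f'.coeff j ≠ 0 := by
      rw [hcoeff, if_pos (by omega)]
      simp only [a, if_pos hfj]
      intro h
      rw [hnorm, h, norm_zero] at hfj
      exact zero_ne_one hfj
    have hlead : ‖f'.leadingCoeff‖ = 1 := by
      have h0 : f'.leadingCoeff ≠ 0 := leadingCoeff_ne_zero.2 (by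
        rintro h; rw [h] at hf'j; simp at hf'j)
      rw [leadingCoeff, hcoeff] at h0 ⊢
      split_ifs at h0 ⊢ with h
      · simp only [a] at h0 ⊢
        split_ifs at h0 ⊢ with h'
        · exact h'
        · exact absurd rfl h0
      · exact absurd rfl h0
    obtain ⟨x, hx⟩ := IsAlgClosed.exists_root f' (fun h => by
      have h1 := natDegree_eq_zero_iff_degree_le_zero.2 h.le
      have := le_natDegree_of_ne_zero hf'j
      omega)
    have hx1 : ‖x‖ ≤ 1 := norm_root_le_one (fun i => by
      rw [hcoeff]; split_ifs
      · exact ha i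
      · simp) hlead hx
    obtain ⟨ζ, hζ, h1⟩ := D.exists_teich_near hx1
    refine ⟨⟨ζ, hT ζ hζ⟩, mem_fixedSub.2 fun g _ => Subtype.ext (H.teich g ζ hζ),
      D.teich_norm_le hζ, ?_⟩
    have h2 : f'.eval x = ∑ i ∈ Finset.range (f.natDegree + 1), a i * x ^ i := by
      simp only [f', eval_finsetSum, eval_monomial]
    have h3 : ((f.eval ⟨ζ, hT ζ hζ⟩ : teichField L Ω q) : Ω) =
        ∑ i ∈ Finset.range (f.natDegree + 1), (f.coeff i : Ω) * ζ ^ i := by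
      rw [eval_eq_sum_range]
      simp
    rw [hnorm, h3]
    have h4 : (∑ i ∈ Finset.range (f.natDegree + 1), (f.coeff i : Ω) * ζ ^ i) =
        ∑ i ∈ Finset.range (f.natDegree + 1), ((f.coeff i : Ω) * ζ ^ i - a i * x ^ i) := by
      rw [Finset.sum_sub_distrib, ← h2, show f'.eval x = 0 from hx, sub_zero]
    rw [h4]
    obtain ⟨i, -, hi⟩ := IsUltrametricDist.exists_norm_finsetSum_le_of_nonempty
      (Finset.nonempty_range_add_one (n := f.natDegree))
      (fun i => (f.coeff i : Ω) * ζ ^ i - a i * x ^ i)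
    refine hi.trans_lt ?_
    simp only [a]
    split_ifs with h
    · rw [← mul_sub, norm_mul, norm_sub_rev, ← hnorm, h, one_mul]
      exact norm_pow_sub_pow_lt hx1 h1 i
    · rw [zero_mul, sub_zero, norm_mul, norm_pow, ← hnorm]
      calc _ ≤ ‖f.coeff i‖ * 1 := by
            gcongr; exact pow_le_one₀ (norm_nonneg _) (D.teich_norm_le hζ)
        _ < 1 := by rw [mul_one]; exact lt_of_le_of_ne (hf i) h

end ResidueData

end TotallyRamified

section ResidueDegreeOne

variable {K Ω : Type*} [NormedField K] [NormedField Ω] [NormedAlgebra K Ω] [IsUltrametricDist Ω]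

omit [IsUltrametricDist Ω] in
lemma norm_mul_pow_injective {ϖ : Ω} (h0 : 0 < ‖ϖ‖) (h1 : ‖ϖ‖ < 1) {n : ℕ}
    (hK : ∀ a : K, a ≠ 0 → ∃ k : ℤ, ‖a‖ = (‖ϖ‖ ^ n) ^ k) {a b : K} (ha : a ≠ 0) (hb : b ≠ 0)
    {i j : ℕ} (hi : i < n) (hj : j < n)
    (h : ‖algebraMap K Ω a * ϖ ^ i‖ = ‖algebraMap K Ω b * ϖ ^ j‖) : i = j := by
  obtain ⟨k, hk⟩ := hK a ha
  obtain ⟨l, hl⟩ := hK b hb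
  simp only [norm_mul, norm_pow, norm_algebraMap', hk, hl] at h
  rw [← zpow_natCast, ← zpow_natCast, ← zpow_natCast, ← zpow_mul, ← zpow_mul, ← zpow_add₀ h0.ne',
    ← zpow_add₀ h0.ne'] at h
  have h2 := zpow_right_injective₀ h0 h1.ne h
  have h3 := congrArg (· % (n : ℤ)) h2
  simp only [Int.mul_add_emod_self_left] at h3
  rw [Int.emod_eq_of_lt (by omega) (by omega), Int.emod_eq_of_lt (by omega) (by omega)] at h3
  exact_mod_cast h3

lemma norm_term_le_norm_sum {ϖ : Ω} (h0 : 0 < ‖ϖ‖) (h1 : ‖ϖ‖ < 1) {n : ℕ}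
    (hK : ∀ a : K, a ≠ 0 → ∃ k : ℤ, ‖a‖ = (‖ϖ‖ ^ n) ^ k) (c : Fin n → K) (i : Fin n) :
    ‖algebraMap K Ω (c i) * ϖ ^ (i : ℕ)‖ ≤ ‖∑ j, algebraMap K Ω (c j) * ϖ ^ (j : ℕ)‖ := by
  classical
  by_cases hi : c i = 0
  · simp [hi]
  have h2 : ∑ j, algebraMap K Ω (c j) * ϖ ^ (j : ℕ) =
      ∑ j with c j ≠ 0, algebraMap K Ω (c j) * ϖ ^ (j : ℕ) := by
    refine (Finset.sum_filter_of_ne (p := fun j => c j ≠ 0) fun j _ h h' => h ?_).symm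
    rw [h', map_zero, zero_mul]
  rw [h2, ← coe_nnnorm, ← coe_nnnorm, NNReal.coe_le_coe,
    IsUltrametricDist.nnnorm_sum_eq_sup_of_pairwise_ne]
  · exact Finset.le_sup (f := fun j => ‖algebraMap K Ω (c j) * ϖ ^ (j : ℕ)‖₊) (by simpa using hi)
  · intro j hj l hl hne h
    simp only [Finset.coe_filter, Finset.mem_univ, true_and, Set.mem_ofPred_eq] at hj hl
    refine hne (Fin.ext (norm_mul_pow_injective h0 h1 hK hj hl j.2 l.2 ?_))
    exact congrArg NNReal.toReal h

/-- In a totally ramified extension every integer is congruent to an integer of the base field. -/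
lemma exists_near_of_totallyRamified {L : Type*} [Field L] [Algebra K L] [Algebra L Ω]
    [IsScalarTower K L Ω] [FiniteDimensional K L] {π : L} (h0 : 0 < ‖algebraMap L Ω π‖)
    (h1 : ‖algebraMap L Ω π‖ < 1)
    (hK : ∀ a : K, a ≠ 0 → ∃ k : ℤ, ‖a‖ = (‖algebraMap L Ω π‖ ^ Module.finrank K L) ^ k) {x : L}
    (hx : ‖algebraMap L Ω x‖ ≤ 1) :
    ∃ a : K, ‖a‖ ≤ 1 ∧ ‖algebraMap L Ω x - algebraMap K Ω a‖ < 1 := by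
  set n := Module.finrank K L with hn
  set ϖ := algebraMap L Ω π with hϖ
  have hmap : ∀ c : Fin n → K, algebraMap L Ω (∑ i, c i • π ^ (i : ℕ)) =
      ∑ i, algebraMap K Ω (c i) * ϖ ^ (i : ℕ) := by
    intro c
    rw [map_sum]
    refine Finset.sum_congr rfl fun i _ => ?_
    rw [Algebra.smul_def, map_mul, map_pow, ← IsScalarTower.algebraMap_apply]
  have hli : LinearIndependent K fun i : Fin n => π ^ (i : ℕ) := by
    refine Fintype.linearIndependent_iff.2 fun c hc i => ?_
    have h2 := norm_term_le_norm_sum h0 h1 hK c i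
    rw [← hmap, hc, map_zero, norm_zero, norm_mul, norm_pow, norm_algebraMap'] at h2
    by_contra hne
    have : 0 < ‖c i‖ * ‖ϖ‖ ^ (i : ℕ) := mul_pos (norm_pos_iff.2 hne) (by positivity)
    linarith
  have hpos : 0 < n := Module.finrank_pos
  have : Nonempty (Fin n) := ⟨⟨0, hpos⟩⟩
  let b := basisOfLinearIndependentOfCardEqFinrank hli (by simp [hn])
  let c := b.repr x
  have hxc : algebraMap L Ω x = ∑ i, algebraMap K Ω (c i) * ϖ ^ (i : ℕ) := by
    rw [← hmap]
    congr 1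
    have := b.sum_repr x
    simp only [b, coe_basisOfLinearIndependentOfCardEqFinrank] at this
    exact this.symm
  have hle : ∀ i, ‖algebraMap K Ω (c i) * ϖ ^ (i : ℕ)‖ ≤ 1 := fun i => by
    rw [hxc] at hx
    exact (norm_term_le_norm_sum h0 h1 hK c i).trans hx
  let i0 : Fin n := ⟨0, hpos⟩
  refine ⟨c i0, by simpa [i0, norm_algebraMap'] using hle i0, ?_⟩
  rw [hxc, ← Finset.add_sum_erase _ _ (Finset.mem_univ i0)]
  simp only [i0, pow_zero, mul_one, add_sub_cancel_left]
  rcases (Finset.univ.erase i0).eq_empty_or_nonempty with he | he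
  · rw [he]; simp
  obtain ⟨i, hi, hi'⟩ := IsUltrametricDist.exists_norm_finsetSum_le_of_nonempty he
    (fun i => algebraMap K Ω (c i) * ϖ ^ (i : ℕ))
  refine hi'.trans_lt (lt_of_le_of_ne (hle i) fun h => ?_)
  have hci : c i ≠ 0 := by rintro h'; rw [h'] at h; simp at h
  have := norm_mul_pow_injective h0 h1 hK hci one_ne_zero i.2 i0.2 (by simpa [i0] using h)
  exact (Finset.mem_erase.1 hi).1 (Fin.ext this)

lemma ResidueData.frob_of_totallyRamified {p q : ℕ} (D : ResidueData K Ω p q)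
    {L : Type*} [Field L] [Algebra K L] [Algebra L Ω]
    [IsScalarTower K L Ω] [FiniteDimensional K L] {π : L} (h0 : 0 < ‖algebraMap L Ω π‖)
    (h1 : ‖algebraMap L Ω π‖ < 1)
    (hK : ∀ a : K, a ≠ 0 → ∃ k : ℤ, ‖a‖ = (‖algebraMap L Ω π‖ ^ Module.finrank K L) ^ k) (x : L)
    (hx : ‖algebraMap L Ω x‖ ≤ 1) : ‖algebraMap L Ω x ^ q - algebraMap L Ω x‖ < 1 := by
  obtain ⟨a, ha, hxa⟩ := exists_near_of_totallyRamified h0 h1 hK hx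
  have h2 := D.frob a ha
  rw [← norm_algebraMap' Ω, map_sub, map_pow] at h2
  exact norm_lt_one_trans (norm_pow_sub_pow_lt hx hxa q)
    (norm_lt_one_trans h2 (by rwa [norm_sub_rev]))

end ResidueDegreeOne

/-- Successive approximation: if every element of `V` is approximated by an element of the
closed subgroup `W` with relative error `r < 1`, then `V ≤ W`. -/
lemma AddSubgroup.le_of_isClosed_of_approx {E : Type*} [SeminormedAddCommGroup E]
    {V W : AddSubgroup E} (hWV : W ≤ V) (hW : IsClosed (W : Set E)) {r : ℝ} (hr0 : 0 ≤ r)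
    (hr1 : r < 1) (h : ∀ x ∈ V, ∃ w ∈ W, ‖x - w‖ ≤ r * ‖x‖) : V ≤ W := by
  intro x hx
  have key : ∀ k : ℕ, ∃ w ∈ W, ‖x - w‖ ≤ r ^ k * ‖x‖ := by
    intro k
    induction k with
    | zero => exact ⟨0, W.zero_mem, by simp⟩
    | succ k ih =>
      obtain ⟨w, hw, h1⟩ := ih
      obtain ⟨w', hw', h2⟩ := h (x - w) (V.sub_mem hx (hWV hw))
      refine ⟨w + w', W.add_mem hw hw', ?_⟩
      rw [← sub_sub, pow_succ', mul_assoc]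
      exact h2.trans (mul_le_mul_of_nonneg_left h1 hr0)
  have hcl : x ∈ _root_.closure (W : Set E) := by
    refine Metric.mem_closure_iff.2 fun ε hε => ?_
    have ht : Filter.Tendsto (fun k : ℕ => r ^ k * ‖x‖) Filter.atTop (nhds 0) := by
      simpa using (tendsto_pow_atTop_nhds_zero_of_lt_one hr0 hr1).mul_const ‖x‖
    obtain ⟨k, hk⟩ := (ht.eventually_lt_const hε).exists
    obtain ⟨w, hw, h1⟩ := key k
    exact ⟨w, hw, by rw [dist_eq_norm]; exact h1.trans_lt hk⟩
  rwa [hW.closure_eq] at hcl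

namespace ResidueData

section

variable {K Ω : Type*} [NormedField K] [NormedField Ω] [NormedAlgebra K Ω] [IsUltrametricDist Ω]
  {p q : ℕ} {F : Type*} [Field F] [Algebra K F] [Algebra F Ω] [IsScalarTower K F Ω]

lemma exists_teich_near_mem (D : ResidueData K Ω p q) [Algebra.IsAlgebraic K Ω] [IsAlgClosed Ω]
    {x : F} (hx : ‖algebraMap F Ω x‖ ≤ 1) :
    ∃ ζ : F, IsTeich q (algebraMap F Ω ζ) ∧ ‖algebraMap F Ω x - algebraMap F Ω ζ‖ < 1 := by
  have : Algebra.IsAlgebraic F Ω := Algebra.IsAlgebraic.tower_top (K := K) F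
  have : IsAlgClosure F Ω := ⟨inferInstance, inferInstance⟩
  have : Normal F Ω := IsAlgClosure.normal F Ω
  obtain ⟨ζ, hζ, h⟩ := D.exists_teich_near hx
  obtain ⟨z, rfl⟩ := mem_range_of_fixed (D.teich_separable (F := F) hζ) fun σ => by
    refine D.teich_eq_of_near (hζ.map (σ : Ω →+* Ω)) hζ ?_
    have h1 := D.inv (σ.restrictScalars K) (algebraMap F Ω x - ζ)
    rw [map_sub] at h1
    change ‖σ (algebraMap F Ω x) - σ ζ‖ = _ at h1
    rw [σ.commutes] at h1
    refine norm_lt_one_trans (y := algebraMap F Ω x) ?_ h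
    rw [norm_sub_rev]; exact h1.trans_lt h
  exact ⟨z, hζ, h⟩

end

section Unramified

variable {K Ω : Type*} [NontriviallyNormedField K] [CompleteSpace K] [NormedField Ω]
  [NormedAlgebra K Ω] [IsUltrametricDist Ω]
  {p q : ℕ} {F : Type*} [Field F] [Algebra K F] [Algebra F Ω] [IsScalarTower K F Ω]
  [FiniteDimensional K F]

lemma mem_teichField_of_unramified (D : ResidueData K Ω p q) [Algebra.IsAlgebraic K Ω]
    [IsAlgClosed Ω] {r : ℝ} (hr0 : 0 < r) (hr1 : r < 1)
    (hK : ∀ a : K, a ≠ 0 → ∃ k : ℤ, ‖a‖ = r ^ k)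
    (hF : ∀ a : F, a ≠ 0 → ∃ c : K, ‖algebraMap F Ω a‖ = ‖c‖) (x : F) :
    algebraMap F Ω x ∈ teichField K Ω q := by
  let R : Submodule K Ω := (IsScalarTower.toAlgHom K F Ω).range.toSubmodule
  let W : Submodule K Ω := (teichField K Ω q).toSubalgebra.toSubmodule ⊓ R
  have : FiniteDimensional K R := by
    have := LinearMap.finiteDimensional_range (IsScalarTower.toAlgHom K F Ω).toLinearMap
    exact this
  have : FiniteDimensional K W := Submodule.finiteDimensional_of_le (inf_le_right : W ≤ R)
  have hcl : IsClosed (W : Set Ω) := W.closed_of_finiteDimensional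
  have hle : R.toAddSubgroup ≤ W.toAddSubgroup := by
    refine AddSubgroup.le_of_isClosed_of_approx (fun y hy => hy.2) hcl hr0.le hr1 ?_
    rintro _ ⟨y, rfl⟩
    change ∃ w ∈ W, ‖algebraMap F Ω y - w‖ ≤ r * ‖algebraMap F Ω y‖
    rcases eq_or_ne y 0 with rfl | h0
    · exact ⟨0, W.zero_mem, by simp⟩
    obtain ⟨c, hc⟩ := hF y h0
    have hc0 : c ≠ 0 := by
      rintro rfl
      simp [h0] at hc
    set y' := (algebraMap K F c)⁻¹ * y with hy'
    have hyy : algebraMap F Ω y = algebraMap K Ω c * algebraMap F Ω y' := by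
      rw [hy', map_mul, map_inv₀, ← IsScalarTower.algebraMap_apply, mul_inv_cancel_left₀]
      simpa using hc0
    have hn : ‖algebraMap F Ω y'‖ = 1 := by
      rw [hyy, norm_mul, norm_algebraMap'] at hc
      have := norm_pos_iff.2 hc0
      exact mul_left_cancel₀ this.ne' (by rw [hc, mul_one])
    obtain ⟨ζ, hζ, h1⟩ := D.exists_teich_near_mem hn.le
    refine ⟨algebraMap K Ω c * algebraMap F Ω ζ, ⟨?_, algebraMap K F c * ζ, ?_⟩, ?_⟩
    · exact (teichField K Ω q).mul_mem (_root_.algebraMap_mem (teichField K Ω q) c)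
        (IntermediateField.subset_adjoin K {x : Ω | IsTeich q x} hζ)
    · simp [← IsScalarTower.algebraMap_apply]
    · rw [hyy, ← mul_sub, norm_mul, norm_mul, hn, mul_one, mul_comm]
      refine mul_le_mul_of_nonneg_right ?_ (norm_nonneg _)
      rcases eq_or_ne (y' - ζ) 0 with h2 | h2
      · rw [← map_sub, h2, map_zero, norm_zero]; exact hr0.le
      obtain ⟨d, hd⟩ := hF _ h2
      have hd0 : d ≠ 0 := by
        rintro rfl
        rw [norm_zero, norm_eq_zero] at hd
        exact h2 ((map_eq_zero _).1 hd)
      obtain ⟨k, hk⟩ := hK d hd0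
      rw [← map_sub, hd, hk] at h1 ⊢
      have hk1 : 1 ≤ k := by
        by_contra! hlt
        exact absurd h1 (not_lt.2 (one_le_zpow_of_nonpos₀ hr0 hr1.le (by omega)))
      calc r ^ k ≤ r ^ (1 : ℤ) := zpow_le_zpow_right_of_le_one₀ hr0 hr1.le hk1
        _ = r := zpow_one r
  exact (hle (⟨x, rfl⟩ : algebraMap F Ω x ∈ R)).1

end Unramified

section FrobeniusOrbit

variable {K Ω : Type*} [NormedField K] [NormedField Ω]
  [NormedAlgebra K Ω] [IsUltrametricDist Ω]
  {p q : ℕ} {F : Type*} [Field F] [Algebra K F] [Algebra F Ω] [IsScalarTower K F Ω]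

omit [IsUltrametricDist Ω] in
lemma exists_algEquiv_extend [Algebra.IsAlgebraic K Ω] [IsAlgClosed Ω] (f : F →ₐ[K] Ω) :
    ∃ σ : Ω ≃ₐ[K] Ω, ∀ x, σ (algebraMap F Ω x) = f x := by
  have : IsAlgClosure K Ω := ⟨inferInstance, inferInstance⟩
  have : Normal K Ω := IsAlgClosure.normal K Ω
  refine ⟨AlgEquiv.ofBijective (f.liftNormal Ω) (Algebra.IsAlgebraic.algHom_bijective _),
    fun x => ?_⟩
  exact AlgHom.liftNormal_commutes f Ω x

variable [FiniteDimensional K F]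

omit [FiniteDimensional K F] in
lemma isSeparable_of_mem_teichField (D : ResidueData K Ω p q)
    (hF : ∀ x : F, algebraMap F Ω x ∈ teichField K Ω q) : Algebra.IsSeparable K F :=
  ⟨fun x => (D.separable_of_mem_teichField (hF x)).of_algHom (IsScalarTower.toAlgHom K F Ω)⟩

lemma exists_frob_exponent_field (D : ResidueData K Ω p q) [IsAlgClosed Ω] {φ : Ω ≃ₐ[K] Ω}
    (hφ : ∀ x : Ω, IsTeich q x → φ x = x ^ q)
    (hF : ∀ x : F, algebraMap F Ω x ∈ teichField K Ω q) (σ : Ω ≃ₐ[K] Ω) {m : ℕ} (hm : m ≠ 0) :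
    ∃ i : ℕ, (∀ x : F, σ (algebraMap F Ω x) = (φ ^ i) (algebraMap F Ω x)) ∧
      ∀ y : Ω, y ^ q ^ m = y → σ y = (φ ^ i) y := by
  have := D.isSeparable_of_mem_teichField hF
  obtain ⟨α, hα⟩ := Field.exists_primitive_element K F
  obtain ⟨l, hl, hαl⟩ := exists_level (hF α)
  obtain ⟨i, hi⟩ := D.exists_frob_exponent σ (m := l * m) (by positivity)
  have hT : ∀ y : Ω, y ^ q ^ (l * m) = y → σ y = (φ ^ i) y := fun y hy => by
    rw [hi y hy, frob_pow_apply hφ ⟨l * m, by positivity, hy⟩]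
  refine ⟨i, fun x => ?_, fun y hy => hT y (pow_pow_eq_of_dvd hy (Dvd.intro_left _ rfl))⟩
  have h1 : σ (algebraMap F Ω α) = (φ ^ i) (algebraMap F Ω α) :=
    eq_on_level (f := (σ : Ω →+* Ω)) (g := ((φ ^ i : Ω ≃ₐ[K] Ω) : Ω →+* Ω)) (q := q) (m := l)
      (fun a => by simp [AlgEquiv.commutes])
      (fun y hy => hT y (pow_pow_eq_of_dvd hy (Dvd.intro _ rfl))) hαl
  have hx : x ∈ IntermediateField.adjoin K {α} := hα ▸ IntermediateField.mem_top
  induction hx using IntermediateField.adjoin_induction with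
  | mem x hx => rw [Set.mem_singleton_iff.1 hx, h1]
  | algebraMap a => simp [← IsScalarTower.algebraMap_apply, AlgEquiv.commutes]
  | add x y _ _ h1 h2 => simp only [map_add, h1, h2]
  | inv x _ h => simp only [map_inv₀, h]
  | mul x y _ _ h1 h2 => simp only [map_mul, h1, h2]

/-- The embedding of `F` twisted by an automorphism. -/
noncomputable def twist (φ : Ω ≃ₐ[K] Ω) (f : F →ₐ[K] Ω) : F →ₐ[K] Ω := (φ : Ω →ₐ[K] Ω).comp f

omit [IsUltrametricDist Ω] [FiniteDimensional K F] in
lemma twist_iterate (φ : Ω ≃ₐ[K] Ω) (i : ℕ) (x : F) :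
    ((twist φ)^[i] (IsScalarTower.toAlgHom K F Ω)) x = (φ ^ i) (algebraMap F Ω x) := by
  induction i with
  | zero => simp
  | succ i ih =>
    rw [Function.iterate_succ_apply', pow_succ', AlgEquiv.mul_apply, ← ih]; rfl

omit [IsUltrametricDist Ω] in
lemma minimalPeriod_pos (φ : Ω ≃ₐ[K] Ω) :
    0 < Function.minimalPeriod (twist φ) (IsScalarTower.toAlgHom K F Ω) := by
  have hinj : Function.Injective (twist (F := F) φ) := fun f g h => AlgHom.ext fun x =>
    φ.injective (DFunLike.congr_fun h x)
  exact Function.minimalPeriod_pos_of_mem_periodicPts (hinj.mem_periodicPts _)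

lemma exists_twist_eq (D : ResidueData K Ω p q) [Algebra.IsAlgebraic K Ω]
    [IsAlgClosed Ω] {φ : Ω ≃ₐ[K] Ω} (hφ : ∀ x : Ω, IsTeich q x → φ x = x ^ q)
    (hF : ∀ x : F, algebraMap F Ω x ∈ teichField K Ω q) (f : F →ₐ[K] Ω) :
    ∃ i < Function.minimalPeriod (twist φ) (IsScalarTower.toAlgHom K F Ω),
      (twist φ)^[i] (IsScalarTower.toAlgHom K F Ω) = f := by
  obtain ⟨σ, hσ⟩ := exists_algEquiv_extend f
  obtain ⟨i, hi, -⟩ := D.exists_frob_exponent_field hφ hF σ one_ne_zero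
  refine ⟨i % Function.minimalPeriod (twist φ) (IsScalarTower.toAlgHom K F Ω),
    Nat.mod_lt _ (minimalPeriod_pos φ), ?_⟩
  rw [Function.iterate_mod_minimalPeriod_eq]
  ext x
  rw [twist_iterate, ← hi, hσ]

lemma prod_embeddings (D : ResidueData K Ω p q) [Algebra.IsAlgebraic K Ω]
    [IsAlgClosed Ω] {φ : Ω ≃ₐ[K] Ω} (hφ : ∀ x : Ω, IsTeich q x → φ x = x ^ q)
    (hF : ∀ x : F, algebraMap F Ω x ∈ teichField K Ω q) {M : Type*} [CommMonoid M]
    (u : (F →ₐ[K] Ω) → M) :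
    ∏ f, u f = ∏ i ∈ Finset.range
      (Function.minimalPeriod (twist φ) (IsScalarTower.toAlgHom K F Ω)),
        u ((twist φ)^[i] (IsScalarTower.toAlgHom K F Ω)) := by
  symm
  refine Finset.prod_bij (fun i _ => (twist φ)^[i] (IsScalarTower.toAlgHom K F Ω))
    (fun _ _ => Finset.mem_univ _) (fun i hi j hj h => ?_) (fun f _ => ?_) fun _ _ => rfl
  · exact Function.iterate_injOn_Iio_minimalPeriod (Finset.mem_range.1 hi) (Finset.mem_range.1 hj) h
  · obtain ⟨i, hi, h⟩ := D.exists_twist_eq hφ hF f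
    exact ⟨i, Finset.mem_range.2 hi, h⟩

lemma minimalPeriod_eq (D : ResidueData K Ω p q) [Algebra.IsAlgebraic K Ω]
    [IsAlgClosed Ω] {φ : Ω ≃ₐ[K] Ω} (hφ : ∀ x : Ω, IsTeich q x → φ x = x ^ q)
    (hF : ∀ x : F, algebraMap F Ω x ∈ teichField K Ω q) :
    Function.minimalPeriod (twist φ) (IsScalarTower.toAlgHom K F Ω) = Module.finrank K F := by
  have := D.isSeparable_of_mem_teichField hF
  have h := D.prod_embeddings hφ hF fun _ => Multiplicative.ofAdd 1
  simp only [Finset.prod_const, Finset.card_univ, Finset.card_range, AlgHom.card K F Ω] at h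
  simpa [← ofAdd_nsmul] using h.symm

/-- The norm of an unramified extension is a product over powers of the Frobenius. -/
lemma norm_eq_prod_frob (D : ResidueData K Ω p q) [Algebra.IsAlgebraic K Ω]
    [IsAlgClosed Ω] {φ : Ω ≃ₐ[K] Ω} (hφ : ∀ x : Ω, IsTeich q x → φ x = x ^ q)
    (hF : ∀ x : F, algebraMap F Ω x ∈ teichField K Ω q) (x : F) :
    algebraMap K Ω (Algebra.norm K x) =
      ∏ i ∈ Finset.range (Module.finrank K F), (φ ^ i) (algebraMap F Ω x) := by
  have := D.isSeparable_of_mem_teichField hF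
  rw [Algebra.norm_eq_prod_embeddings, D.prod_embeddings hφ hF, D.minimalPeriod_eq hφ hF]
  simp only [twist_iterate]

lemma frob_pow_finrank (D : ResidueData K Ω p q) [Algebra.IsAlgebraic K Ω]
    [IsAlgClosed Ω] {φ : Ω ≃ₐ[K] Ω} (hφ : ∀ x : Ω, IsTeich q x → φ x = x ^ q)
    (hF : ∀ x : F, algebraMap F Ω x ∈ teichField K Ω q) (x : F) :
    (φ ^ Module.finrank K F) (algebraMap F Ω x) = algebraMap F Ω x := by
  rw [← twist_iterate, ← D.minimalPeriod_eq hφ hF, Function.iterate_minimalPeriod]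
  rfl

lemma mem_range_of_frob_pow_fixed (D : ResidueData K Ω p q) [Algebra.IsAlgebraic K Ω]
    [IsAlgClosed Ω] {φ : Ω ≃ₐ[K] Ω} (hφ : ∀ x : Ω, IsTeich q x → φ x = x ^ q)
    (hF : ∀ x : F, algebraMap F Ω x ∈ teichField K Ω q) {η : Ω} (hη : IsTeich q η)
    (h : (φ ^ Module.finrank K F) η = η) : η ∈ (algebraMap F Ω).range := by
  have : Algebra.IsAlgebraic F Ω := Algebra.IsAlgebraic.tower_top (K := K) F
  have : IsAlgClosure F Ω := ⟨inferInstance, inferInstance⟩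
  have : Normal F Ω := IsAlgClosure.normal F Ω
  refine mem_range_of_fixed (D.teich_separable (F := F) hη) fun σ => ?_
  obtain ⟨m, hm, hηm⟩ := hη
  obtain ⟨i, hi, hi'⟩ := D.exists_frob_exponent_field hφ hF (σ.restrictScalars K) hm
  have hper : Function.IsPeriodicPt (twist φ) i (IsScalarTower.toAlgHom K F Ω) := by
    refine AlgHom.ext fun x => ?_
    rw [twist_iterate, ← hi]
    exact σ.commutes x
  have hdvd := hper.minimalPeriod_dvd
  rw [D.minimalPeriod_eq hφ hF] at hdvd
  obtain ⟨k, rfl⟩ := hdvd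
  rw [pow_mul] at hi'
  exact (hi' η hηm).trans (pow_apply_of_fixed h k)

end FrobeniusOrbit

end ResidueData

namespace ResidueData

section Compositum

lemma mem_teichField_of_base {K L Ω : Type*} [Field K] [Field L] [Field Ω] [Algebra K L]
    [Algebra L Ω] [Algebra K Ω] [IsScalarTower K L Ω] {q : ℕ} {x : Ω} (hx : x ∈ teichField K Ω q) :
    x ∈ teichField L Ω q := by
  induction hx using IntermediateField.adjoin_induction with
  | mem x hx => exact IntermediateField.subset_adjoin _ _ hx
  | algebraMap a =>
    rw [IsScalarTower.algebraMap_apply K L Ω]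
    exact _root_.algebraMap_mem _ _
  | add x y _ _ h1 h2 => exact add_mem h1 h2
  | inv x _ h => exact inv_mem h
  | mul x y _ _ h1 h2 => exact mul_mem h1 h2

variable {K F L M : Type*} [Field F] [Field L] [Field M] [Algebra F M] [Algebra L M]

lemma compositum_hom_ext [CommRing K] [Algebra K F] [Algebra K M] [IsScalarTower K F M]
    (hcomp : Algebra.adjoin K (Set.range (algebraMap F M) ∪ Set.range (algebraMap L M)) = ⊤)
    {R : Type*} [CommRing R] {f g : M →+* R}
    (hF : ∀ x : F, f (algebraMap F M x) = g (algebraMap F M x))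
    (hL : ∀ x : L, f (algebraMap L M x) = g (algebraMap L M x)) (z : M) : f z = g z := by
  have hz : z ∈ Algebra.adjoin K (Set.range (algebraMap F M) ∪ Set.range (algebraMap L M)) :=
    hcomp ▸ Algebra.mem_top
  induction hz using Algebra.adjoin_induction with
  | mem x hx =>
    rcases hx with ⟨y, rfl⟩ | ⟨y, rfl⟩
    · exact hF y
    · exact hL y
  | algebraMap a => rw [IsScalarTower.algebraMap_apply K F M, hF]
  | add x y _ _ h1 h2 => rw [map_add, map_add, h1, h2]
  | mul x y _ _ h1 h2 => rw [map_mul, map_mul, h1, h2]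

variable {Ω : Type*} [NormedField K] [NormedField Ω] [NormedAlgebra K Ω]
  {p q : ℕ} [Algebra K F] [Algebra K L] [Algebra K M] [IsScalarTower K F M] [IsScalarTower K L M]
  [Algebra F Ω] [Algebra L Ω] [Algebra M Ω] [IsScalarTower K F Ω] [IsScalarTower K L Ω]
  [IsScalarTower F M Ω] [IsScalarTower L M Ω]

omit [IsScalarTower K L M] [IsScalarTower K F Ω] in
lemma compositum_mem_teichField
    (hcomp : Algebra.adjoin K (Set.range (algebraMap F M) ∪ Set.range (algebraMap L M)) = ⊤)
    (hF : ∀ x : F, algebraMap F Ω x ∈ teichField K Ω q) (z : M) :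
    algebraMap M Ω z ∈ teichField L Ω q := by
  have hz : z ∈ Algebra.adjoin K (Set.range (algebraMap F M) ∪ Set.range (algebraMap L M)) :=
    hcomp ▸ Algebra.mem_top
  have hF' : ∀ x : F, algebraMap M Ω (algebraMap F M x) ∈ teichField L Ω q := fun x => by
    rw [← IsScalarTower.algebraMap_apply]
    exact mem_teichField_of_base (hF x)
  induction hz using Algebra.adjoin_induction with
  | mem x hx =>
    rcases hx with ⟨y, rfl⟩ | ⟨y, rfl⟩
    · exact hF' y
    · rw [← IsScalarTower.algebraMap_apply]
      exact _root_.algebraMap_mem _ _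
  | algebraMap a =>
    rw [IsScalarTower.algebraMap_apply K F M]
    exact hF' _
  | add x y _ _ h1 h2 => rw [map_add]; exact add_mem h1 h2
  | mul x y _ _ h1 h2 => rw [map_mul]; exact mul_mem h1 h2

variable {G : Type*} [CommGroup G] {e : G ≃* (L ≃ₐ[K] L)} {θ : G → Ω ≃ₐ[K] Ω}

omit [IsScalarTower K F Ω] [IsScalarTower K L Ω] [Algebra K F] in
lemma GaloisLift.apply_unramified (H : GaloisLift q e θ)
    (hF : ∀ x : F, algebraMap F Ω x ∈ teichField K Ω q) (g : G) (x : F) :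
    θ g (algebraMap F Ω x) = algebraMap F Ω x :=
  eq_on_teichField (f := (θ g : Ω →+* Ω)) (g := RingHom.id Ω) (fun a => (θ g).commutes a)
    (fun y hy => H.teich g y hy) (hF x)

/-- The embedding of the compositum attached to an element of the Galois group. -/
noncomputable def GaloisLift.embed (H : GaloisLift q e θ)
    (hF : ∀ x : F, algebraMap F Ω x ∈ teichField K Ω q) (g : G) : M →ₐ[F] Ω where
  __ := (θ g : Ω →+* Ω).comp (algebraMap M Ω)
  commutes' x := by
    have := H.apply_unramified hF g x
    simpa [← IsScalarTower.algebraMap_apply] using this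

omit [Algebra L M] [Algebra K F] [Algebra K M] [IsScalarTower K F M] [IsScalarTower K L M]
  [IsScalarTower K F Ω] [IsScalarTower K L Ω] [IsScalarTower L M Ω] in
lemma GaloisLift.embed_apply (H : GaloisLift q e θ)
    (hF : ∀ x : F, algebraMap F Ω x ∈ teichField K Ω q) (g : G) (z : M) :
    H.embed hF g z = θ g (algebraMap M Ω z) := rfl

lemma GaloisLift.embed_bijective (H : GaloisLift q e θ) [Algebra.IsAlgebraic K Ω] [IsAlgClosed Ω]
    [Normal K L]
    (hcomp : Algebra.adjoin K (Set.range (algebraMap F M) ∪ Set.range (algebraMap L M)) = ⊤)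
    (hF : ∀ x : F, algebraMap F Ω x ∈ teichField K Ω q) :
    Function.Bijective (H.embed (M := M) hF) := by
  constructor
  · intro g h hgh
    refine e.injective (AlgEquiv.ext fun y => (algebraMap L Ω).injective ?_)
    rw [← H.base, ← H.base, IsScalarTower.algebraMap_apply L M Ω]
    exact DFunLike.congr_fun hgh (algebraMap L M y)
  · intro f
    let f0 : L →ₐ[K] Ω :=
      { (f : M →+* Ω).comp (algebraMap L M) with
        commutes' := fun a => by
          simp [← IsScalarTower.algebraMap_apply K L M, IsScalarTower.algebraMap_apply K F M,
            ← IsScalarTower.algebraMap_apply K F Ω] }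
    obtain ⟨σ, hσ⟩ := exists_algEquiv_extend f0
    have : IsAlgClosure K Ω := ⟨inferInstance, inferInstance⟩
    have : Normal K Ω := IsAlgClosure.normal K Ω
    obtain ⟨g, hg⟩ := e.surjective (σ.restrictNormal L)
    refine ⟨g, AlgHom.ext fun z => ?_⟩
    refine compositum_hom_ext hcomp (f := ((H.embed hF g : M →ₐ[F] Ω) : M →+* Ω))
      (g := (f : M →+* Ω))
      (fun x => ?_) (fun y => ?_) z
    · simp only [RingHom.coe_coe, AlgHom.commutes]
    · simp only [RingHom.coe_coe, H.embed_apply]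
      rw [← IsScalarTower.algebraMap_apply, H.base, hg, AlgEquiv.restrictNormal_commutes, hσ]
      rfl

variable [IsUltrametricDist Ω]

/-- An element of the compositum fixed by the Galois group lies in the unramified part. -/
lemma GaloisLift.mem_range_of_fixed' (D : ResidueData K Ω p q) (H : GaloisLift q e θ)
    [Algebra.IsAlgebraic K Ω] [IsAlgClosed Ω] [IsGalois K L] [IsScalarTower K M Ω]
    (hcomp : Algebra.adjoin K (Set.range (algebraMap F M) ∪ Set.range (algebraMap L M)) = ⊤)
    (hF : ∀ x : F, algebraMap F Ω x ∈ teichField K Ω q) {z : M}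
    (hz : ∀ g, θ g (algebraMap M Ω z) = algebraMap M Ω z) :
    ∃ x : F, algebraMap F Ω x = algebraMap M Ω z := by
  have : Algebra.IsAlgebraic F Ω := Algebra.IsAlgebraic.tower_top (K := K) F
  have : IsAlgClosure F Ω := ⟨inferInstance, inferInstance⟩
  have : Normal F Ω := IsAlgClosure.normal F Ω
  have hsL : IsSeparable L (algebraMap M Ω z) :=
    D.separable_of_mem_teichField (compositum_mem_teichField hcomp hF z)
  have hsK : IsSeparable K (algebraMap M Ω z) :=
    IsSeparable.of_algebra_isSeparable_of_isSeparable K hsL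
  refine mem_range_of_fixed (hsK.tower_top F) fun σ => ?_
  obtain ⟨g, hg⟩ := (H.embed_bijective hcomp hF).2
    ((σ : Ω →ₐ[F] Ω).comp (IsScalarTower.toAlgHom F M Ω))
  have := DFunLike.congr_fun hg z
  rw [H.embed_apply, hz] at this
  exact this.symm

lemma GaloisLift.norm_compositum (D : ResidueData K Ω p q) (H : GaloisLift q e θ) [Fintype G]
    [Algebra.IsAlgebraic K Ω] [IsAlgClosed Ω] [IsGalois K L] [IsScalarTower K M Ω]
    [FiniteDimensional F M]
    (hcomp : Algebra.adjoin K (Set.range (algebraMap F M) ∪ Set.range (algebraMap L M)) = ⊤)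
    (hF : ∀ x : F, algebraMap F Ω x ∈ teichField K Ω q) (z : M) :
    algebraMap F Ω (Algebra.norm F z) = ∏ g, θ g (algebraMap M Ω z) := by
  have : Algebra.IsSeparable F M := ⟨fun z => by
    have hsL : IsSeparable L (algebraMap M Ω z) :=
      D.separable_of_mem_teichField (compositum_mem_teichField hcomp hF z)
    have hsK : IsSeparable K (algebraMap M Ω z) :=
      IsSeparable.of_algebra_isSeparable_of_isSeparable K hsL
    exact (hsK.tower_top F).of_algHom (IsScalarTower.toAlgHom F M Ω)⟩
  rw [Algebra.norm_eq_prod_embeddings]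
  exact (Fintype.prod_equiv (Equiv.ofBijective _ (H.embed_bijective hcomp hF)) _ _
    fun g => rfl).symm

omit [IsUltrametricDist Ω] in
lemma GaloisLift.norm_base (H : GaloisLift q e θ) [Fintype G] [FiniteDimensional K L]
    [IsGalois K L] (y : L) :
    algebraMap K Ω (Algebra.norm K y) = ∏ g, θ g (algebraMap L Ω y) := by
  rw [IsScalarTower.algebraMap_apply K L Ω, Algebra.norm_eq_prod_automorphisms, map_prod]
  exact (Fintype.prod_equiv e.toEquiv _ _ fun g => H.base g y).symm

end Compositum

end ResidueData

section Descent

open UniformSpace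

lemma isClosed_range_of_finiteDimensional {K M E : Type*} [NontriviallyNormedField K]
    [CompleteSpace K] [Field M] [Algebra K M] [FiniteDimensional K M] [NormedField E]
    (f : M →+* E) (h : ∀ a : K, ‖f (algebraMap K M a)‖ = ‖a‖) : IsClosed (Set.range f) := by
  let _ : Algebra K E := (f.comp (algebraMap K M)).toAlgebra
  let _ : NormedSpace K E := ⟨fun a x => by
    rw [Algebra.smul_def, norm_mul]
    exact (congrArg (· * ‖x‖) (h a)).le⟩
  let g : M →ₗ[K] E :=
    { toFun := f
      map_add' := map_add f
      map_smul' := fun a x => by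
        rw [Algebra.smul_def, map_mul, RingHom.id_apply, Algebra.smul_def]
        rfl }
  exact (LinearMap.range g).closed_of_finiteDimensional

lemma completionAut_pow_coe {E : Type*} [NormedField E] (φ : RingAut E) (hφ : ∀ x, ‖φ x‖ = ‖x‖)
    (n : ℕ) (x : E) : (completionAut φ hφ ^ n) x = ((φ ^ n) x : E) := by
  induction n with
  | zero => rfl
  | succ n ih =>
    rw [pow_succ', pow_succ', RingAut.mul_apply, ih, completionAut_coe, RingAut.mul_apply]

namespace ResidueData

variable {K F L M Ω E : Type*} [NontriviallyNormedField K] [CompleteSpace K] [NormedField Ω]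
  [NormedAlgebra K Ω] [IsUltrametricDist Ω] {p q : ℕ}
  [Field F] [Field L] [Field M] [Algebra F M] [Algebra L M]
  [Algebra K F] [Algebra K M] [IsScalarTower K F M]
  [Algebra F Ω] [Algebra L Ω] [Algebra M Ω] [IsScalarTower K F Ω]
  [IsScalarTower F M Ω] [IsScalarTower L M Ω] [IsScalarTower K M Ω]
  [Algebra.IsAlgebraic K Ω] [IsAlgClosed Ω] [FiniteDimensional K F]
  [FiniteDimensional F M] [NormedField E] [IsUltrametricDist E]

/-- The elements of the completion fixed by a power of the Frobenius come from the compositum. -/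
lemma exists_of_completion_fixed (D : ResidueData K Ω p q) {φ : Ω ≃ₐ[K] Ω}
    (hφ : ∀ x : Ω, IsTeich q x → φ x = x ^ q)
    (hφL : ∀ a : L, φ (algebraMap L Ω a) = algebraMap L Ω a)
    (hcomp : Algebra.adjoin K (Set.range (algebraMap F M) ∪ Set.range (algebraMap L M)) = ⊤)
    (hF : ∀ x : F, algebraMap F Ω x ∈ teichField K Ω q)
    {j : E →+* Ω} (hj : ∀ x, ‖j x‖ = ‖x‖) {Φ : RingAut E} (hΦ : ∀ x, ‖Φ x‖ = ‖x‖)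
    (hjΦ : ∀ x, j (Φ x) = φ (j x)) {κ : M →+* E} (hκ : ∀ z, j (κ z) = algebraMap M Ω z)
    (hjT : ∀ ζ, IsTeich q ζ → ∃ y, j y = ζ) {π : L}
    (hπ0 : 0 < ‖algebraMap L Ω π‖) (hπ1 : ‖algebraMap L Ω π‖ < 1)
    (hval : ∀ x : E, x ≠ 0 → ∃ k : ℤ, ‖x‖ = ‖algebraMap L Ω π‖ ^ k)
    {x : Completion E} (hx : (completionAut Φ hΦ ^ Module.finrank K F) x = x) :
    ∃ z : M, (κ z : Completion E) = x := by
  set ψ : RingAut (Completion E) := completionAut Φ hΦ ^ Module.finrank K F with hψdef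
  have hjpow : ∀ (n : ℕ) (y : E), j ((Φ ^ n) y) = (φ ^ n) (j y) := fun n y => by
    induction n with
    | zero => rfl
    | succ n ih => rw [pow_succ', pow_succ', RingAut.mul_apply, hjΦ, ih, AlgEquiv.mul_apply]
  have hψcoe : ∀ y : E, ψ (y : Completion E) = ((Φ ^ Module.finrank K F) y : E) := fun y =>
    completionAut_pow_coe _ _ _ _
  have hψnorm : ∀ y, ‖ψ y‖ = ‖y‖ := fun y => by
    rw [hψdef]
    induction Module.finrank K F with
    | zero => rfl
    | succ n ih => rw [pow_succ', RingAut.mul_apply, norm_completionAut, ih]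
  have hψfix : ∀ y : E, (φ ^ Module.finrank K F) (j y) = j y → ψ (y : Completion E) = y := by
    intro y hy
    rw [hψcoe, j.injective ((hjpow _ y).trans hy)]
  have hfix : ∀ z : M, (φ ^ Module.finrank K F) (algebraMap M Ω z) = algebraMap M Ω z := by
    intro z
    refine compositum_hom_ext hcomp
      (f := ((φ ^ Module.finrank K F : Ω ≃ₐ[K] Ω) : Ω →+* Ω).comp (algebraMap M Ω))
      (g := algebraMap M Ω) (fun x => ?_) (fun y => ?_) z
    · have := D.frob_pow_finrank hφ hF x
      simpa [← IsScalarTower.algebraMap_apply] using this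
    · have := pow_apply_of_fixed (hφL y) (Module.finrank K F)
      simpa [← IsScalarTower.algebraMap_apply] using this
  let V : AddSubgroup (Completion E) := (ψ.toRingHom.eqLocus (RingHom.id _)).toAddSubgroup
  let ι : M →+* Completion E := (Completion.coeRingHom (α := E)).comp κ
  have hι : ∀ z, ι z = (κ z : Completion E) := fun z => rfl
  let W : AddSubgroup (Completion E) := ι.toAddMonoidHom.range
  have hιfix : ∀ z, ψ (ι z) = ι z := fun z => hψfix _ (by rw [hκ, hfix])
  have hWV : W ≤ V := by
    rintro _ ⟨z, rfl⟩
    exact hιfix z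
  have hιnorm : ∀ z, ‖ι z‖ = ‖algebraMap M Ω z‖ := fun z => by
    rw [hι, Completion.norm_coe, ← hj, hκ]
  have : FiniteDimensional K M := FiniteDimensional.trans K F M
  have hW : IsClosed (W : Set (Completion E)) :=
    isClosed_range_of_finiteDimensional (K := K) ι fun a => by
      rw [hιnorm, ← IsScalarTower.algebraMap_apply, norm_algebraMap']
  have hπι : ‖ι (algebraMap L M π)‖ = ‖algebraMap L Ω π‖ := by
    rw [hιnorm, ← IsScalarTower.algebraMap_apply]
  refine AddSubgroup.le_of_isClosed_of_approx hWV hW hπ0.le hπ1 ?_ hx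
  intro x hx
  rcases eq_or_ne x 0 with rfl | hx0
  · exact ⟨0, W.zero_mem, by simp⟩
  have hvalC : ∀ x : Completion E, x ≠ 0 → ∃ k : ℤ, ‖x‖ = ‖algebraMap L Ω π‖ ^ k := by
    intro x hx0
    obtain ⟨y, hy⟩ := exists_completion_near x (norm_pos_iff.2 hx0)
    have h : ‖x‖ = ‖y‖ := by
      by_contra hne
      rw [← Completion.norm_coe y] at hne
      rw [norm_sub_eq_max_of_ne hne] at hy
      exact absurd (le_max_left _ _) (not_le.2 hy)
    rw [h]
    refine hval y ?_
    rintro rfl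
    rw [norm_zero, norm_eq_zero] at h
    exact hx0 h
  obtain ⟨k, hk⟩ := hvalC x hx0
  set t : Completion E := ι (algebraMap L M π) ^ k with ht
  have htn : ‖t‖ = ‖x‖ := by rw [ht, norm_zpow, hπι, hk]
  have ht0 : t ≠ 0 := norm_pos_iff.1 (htn ▸ norm_pos_iff.2 hx0)
  have hu1 : ‖x / t‖ = 1 := by rw [norm_div, htn, div_self (norm_pos_iff.2 hx0).ne']
  have hψu : ψ (x / t) = x / t := by
    rw [map_div₀, ht, map_zpow₀, hιfix, show ψ x = x from hx]
  obtain ⟨y, hy⟩ := exists_completion_near (x / t) one_pos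
  have hy1 : ‖j y‖ ≤ 1 := by
    rw [hj, ← Completion.norm_coe]
    exact norm_le_one_of_near hu1.le hy
  obtain ⟨ζ, hζ, h1⟩ := D.exists_teich_near hy1
  obtain ⟨y', rfl⟩ := hjT ζ hζ
  have h2 : ‖x / t - (y' : Completion E)‖ < 1 := by
    refine norm_lt_one_trans hy ?_
    rw [← Completion.coe_sub, Completion.norm_coe, ← hj, map_sub]
    exact h1
  have hfixζ : (φ ^ Module.finrank K F) (j y') = j y' := by
    refine D.teich_eq_of_near ?_ hζ ?_
    · rw [frob_pow_apply hφ hζ]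
      exact hζ.pow _
    · rw [← hjpow, ← map_sub, hj, ← Completion.norm_coe, Completion.coe_sub, ← hψcoe]
      refine norm_lt_one_trans (y := x / t) ?_ h2
      rw [← hψu]
      rw [← map_sub, hψnorm, norm_sub_rev]
      exact h2
  obtain ⟨a, ha⟩ := D.mem_range_of_frob_pow_fixed hφ hF hζ hfixζ
  have ha' : ι (algebraMap F M a) = y' := by
    rw [hι]
    congr 1
    refine j.injective ?_
    rw [hκ, ← IsScalarTower.algebraMap_apply, ha]
  refine ⟨ι (algebraMap F M a * algebraMap L M π ^ k), ⟨_, rfl⟩, ?_⟩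
  rw [map_mul, map_zpow₀, ha', ← ht]
  have h3 : x - y' * t = (x / t - y') * t := by field_simp
  rw [h3, norm_mul, htn]
  gcongr
  rcases eq_or_ne (x / t - (y' : Completion E)) 0 with h0 | h0
  · rw [h0, norm_zero]; exact hπ0.le
  obtain ⟨l, hl⟩ := hvalC _ h0
  rw [hl] at h2 ⊢
  have h4 : 0 < l := by
    by_contra! h5
    exact absurd h2 (not_lt.2 (one_le_zpow_of_nonpos₀ hπ0 hπ1.le h5))
  exact (zpow_le_zpow_right_of_le_one₀ hπ0 hπ1.le h4).trans_eq (zpow_one _)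

end ResidueData

end Descent

section Transfer

open UniformSpace

variable {E G : Type*} [NormedField E] [CommGroup G] [MulSemiringAction G E]

lemma subNorm_top {E G : Type*} [Field E] [CommGroup G] [Fintype G] [MulSemiringAction G E]
    (x : E) : subNorm (⊤ : Subgroup G) x = ∏ g : G, g • x := by
  rw [subNorm]
  congr 1
  ext; simp

namespace FrobeniusData

variable [Fintype G] [IsUltrametricDist E] {φ : RingAut E} {p : E} {q n : ℕ}

/-- Solving the norm equation of the Frobenius in an incomplete field, given descent from the
completion. -/
lemma exists_prod_iterate_eq_of_descent (D : FrobeniusData E G φ p q) {c : E}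
    (hc : ∑ᶠ g : G, g • c = 1) (hn : n ≠ 0)
    (hdesc : ∀ x : Completion E, (completionAut φ D.isometry ^ n) x = x →
      ∃ y : E, (y : Completion E) = x)
    {u : E} (huG : ∀ g : G, g • u = u) (huφ : φ u = u) (hu : ‖u‖ = 1) :
    ∃ x : E, (∀ g : G, g • x = x) ∧ (φ ^ n) x = x ∧ ‖x‖ = 1 ∧
      ∏ i ∈ Finset.range n, (φ ^ i) x = u := by
  let _ := completionAction D.isometry_smul
  have hinj := (Completion.coeRingHom (α := E)).injective
  obtain ⟨x, hxG, hxφ, hx1, hx⟩ := (D.completion hc).exists_prod_iterate_eq hn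
    (u := (u : Completion E)) (fun g => by rw [coe_action D.isometry_smul, huG])
    (by rw [completionAut_coe, huφ]) (by rwa [Completion.norm_coe])
  obtain ⟨y, rfl⟩ := hdesc x hxφ
  refine ⟨y, fun g => hinj ?_, hinj ?_, by rwa [Completion.norm_coe] at hx1, hinj ?_⟩
  · exact (coe_action D.isometry_smul g y).symm.trans (hxG g)
  · exact (completionAut_pow_coe _ _ _ _).symm.trans hxφ
  · rw [map_prod]
    simp only [completionAut_pow_coe] at hx
    exact hx

/-- Solving the norm equation of `G` in an incomplete field, given descent from the completion. -/
lemma exists_prod_smul_eq_of_descent (D : FrobeniusData E G φ p q) {c : E}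
    (hc : ∑ᶠ g : G, g • c = 1) (hn : n ≠ 0)
    (hdesc : ∀ x : Completion E, (completionAut φ D.isometry ^ n) x = x →
      ∃ y : E, (y : Completion E) = x)
    {x y : E} (hxG : ∀ g : G, g • x = x) (hx : ‖x‖ = 1) (hyφ : φ y = y) (hy : ‖y‖ = 1)
    (hxy : ∏ i ∈ Finset.range n, (φ ^ i) x = ∏ g : G, g • y) :
    ∃ z : E, (φ ^ n) z = z ∧ ‖z‖ = 1 ∧ ∏ g : G, g • z = x := by
  let _ := completionAction D.isometry_smul
  have hinj := (Completion.coeRingHom (α := E)).injective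
  have hprod : ∀ y : E,
      ((∏ g : G, g • y : E) : Completion E) = ∏ g : G, g • (y : Completion E) := by
    intro y
    refine (map_prod (Completion.coeRingHom (α := E)) _ _).trans ?_
    exact Finset.prod_congr rfl fun g _ => (coe_action D.isometry_smul g y).symm
  obtain ⟨z, hzφ, hz1, hz⟩ := (D.completion hc).exists_subNorm_eq hn
    (x := (x : Completion E)) (y := (y : Completion E))
    (fun g => by rw [coe_action D.isometry_smul, hxG]) (by rwa [Completion.norm_coe])
    (by rw [completionAut_coe, hyφ]) (by rwa [Completion.norm_coe]) (by
      rw [subNorm_top, ← hprod, ← hxy]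
      simp only [completionAut_pow_coe]
      exact (map_prod (Completion.coeRingHom (α := E)) _ _).symm)
  obtain ⟨w, rfl⟩ := hdesc z hzφ
  refine ⟨w, hinj ?_, by rwa [Completion.norm_coe] at hz1, hinj ?_⟩
  · exact (completionAut_pow_coe _ _ _ _).symm.trans hzφ
  · rw [subNorm_top, ← hprod] at hz
    exact hz

end FrobeniusData

end Transfer

section NormUnits

open UniformSpace

namespace ResidueData

variable {K F L M Ω : Type*} [NontriviallyNormedField K] [CompleteSpace K] [NormedField Ω]
  [NormedAlgebra K Ω] [IsUltrametricDist Ω] {p q : ℕ}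
  [Field F] [Field L] [Field M] [Algebra F M] [Algebra L M]
  [Algebra K F] [Algebra K L] [Algebra K M] [IsScalarTower K F M] [IsScalarTower K L M]
  [Algebra F Ω] [Algebra L Ω] [Algebra M Ω] [IsScalarTower K F Ω] [IsScalarTower K L Ω]
  [IsScalarTower F M Ω] [IsScalarTower L M Ω] [IsScalarTower K M Ω]
  [Algebra.IsAlgebraic K Ω] [IsAlgClosed Ω] [FiniteDimensional K F] [FiniteDimensional K L]
  [FiniteDimensional F M] [IsGalois K L]

/-- The comparison of norms on units, in terms of a model `E` of `L(T)`. -/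
lemma norm_units_of_model {E : Type*} [NormedField E] [IsUltrametricDist E]
    (D : ResidueData K Ω p q) {φ : Ω ≃ₐ[K] Ω}
    (hφ : ∀ x : Ω, IsTeich q x → φ x = x ^ q)
    (hφL : ∀ a : L, φ (algebraMap L Ω a) = algebraMap L Ω a)
    (hcomp : Algebra.adjoin K (Set.range (algebraMap F M) ∪ Set.range (algebraMap L M)) = ⊤)
    (hF : ∀ x : F, algebraMap F Ω x ∈ teichField K Ω q)
    {j : E →+* Ω} (hj : ∀ x, ‖j x‖ = ‖x‖) {Φ : RingAut E}
    (hjΦ : ∀ x, j (Φ x) = φ (j x)) {κ : M →+* E} (hκ : ∀ z, j (κ z) = algebraMap M Ω z)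
    (hjT : ∀ ζ, IsTeich q ζ → ∃ y, j y = ζ)
    {G : Type*} [CommGroup G] [Fintype G] [MulSemiringAction G E] {e : G ≃* (L ≃ₐ[K] L)}
    {θ : G → Ω ≃ₐ[K] Ω} (H : GaloisLift q e θ) (hjθ : ∀ (g : G) x, j (g • x) = θ g (j x))
    {ϖ : E} {π : L} (hϖ : j ϖ = algebraMap L Ω π) (DE : FrobeniusData E G Φ ϖ q) :
    (∀ (x : F) (y : L), ‖algebraMap F Ω x‖ = 1 → ‖algebraMap L Ω y‖ = 1 →
      Algebra.norm K x = Algebra.norm K y →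
      ∃ z : M, ‖algebraMap M Ω z‖ = 1 ∧ x = Algebra.norm F z) ∧
    ∀ u : K, ‖u‖ = 1 → ∃ x : F, ‖algebraMap F Ω x‖ = 1 ∧ Algebra.norm K x = u := by
  have hn : Module.finrank K F ≠ 0 := Module.finrank_pos.ne'
  have hjpow : ∀ (n : ℕ) (y : E), j ((Φ ^ n) y) = (φ ^ n) (j y) := fun n y => by
    induction n with
    | zero => rfl
    | succ n ih => rw [pow_succ', pow_succ', RingAut.mul_apply, hjΦ, ih, AlgEquiv.mul_apply]
  have hκF : ∀ x : F, j (κ (algebraMap F M x)) = algebraMap F Ω x := fun x => by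
    rw [hκ, ← IsScalarTower.algebraMap_apply]
  have hκL : ∀ x : L, j (κ (algebraMap L M x)) = algebraMap L Ω x := fun x => by
    rw [hκ, ← IsScalarTower.algebraMap_apply]
  have hκK : ∀ x : K, j (κ (algebraMap K M x)) = algebraMap K Ω x := fun x => by
    rw [hκ, ← IsScalarTower.algebraMap_apply]
  have hϖn : ‖ϖ‖ = ‖algebraMap L Ω π‖ := by rw [← hj, hϖ]
  have hdesc0 : ∀ x : Completion E, (completionAut Φ DE.isometry ^ Module.finrank K F) x = x →
      ∃ z : M, (κ z : Completion E) = x := fun x hx =>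
    D.exists_of_completion_fixed hφ hφL hcomp hF hj DE.isometry hjΦ hκ hjT (π := π)
      (hϖn ▸ DE.unif_pos) (hϖn ▸ DE.unif_lt) (fun x hx0 => hϖn ▸ DE.value x trivial hx0) hx
  have hdesc : ∀ x : Completion E, (completionAut Φ DE.isometry ^ Module.finrank K F) x = x →
      ∃ y : E, (y : Completion E) = x := fun x hx => (hdesc0 x hx).imp' κ fun _ h => h
  have hdescE : ∀ x : E, (Φ ^ Module.finrank K F) x = x → ∃ z : M, κ z = x := fun x hx => by
    obtain ⟨z, hz⟩ := hdesc0 x (by rw [completionAut_pow_coe, hx])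
    exact ⟨z, (Completion.coeRingHom (α := E)).injective hz⟩
  obtain ⟨c, hc⟩ : ∃ c : E, ∑ᶠ g : G, g • c = 1 := by
    obtain ⟨c, hc⟩ := Algebra.trace_surjective K L 1
    refine ⟨κ (algebraMap L M c), j.injective ?_⟩
    rw [finsum_eq_sum_of_fintype, map_sum, map_one]
    simp_rw [hjθ, hκL, H.base]
    rw [← map_sum, ← map_one (algebraMap L Ω)]
    congr 1
    rw [← map_one (algebraMap K L), ← hc, trace_eq_sum_automorphisms]
    exact Fintype.sum_equiv e.toEquiv _ _ fun g => rfl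
  constructor
  · intro x y hx hy hxy
    obtain ⟨w, hwφ, hw1, hw⟩ := DE.exists_prod_smul_eq_of_descent hc hn hdesc
      (x := κ (algebraMap F M x)) (y := κ (algebraMap L M y))
      (fun g => j.injective (by rw [hjθ, hκF, H.apply_unramified hF]))
      (by rw [← hj, hκF, hx]) (j.injective (by rw [hjΦ, hκL, hφL])) (by rw [← hj, hκL, hy])
      (j.injective (by
        simp only [map_prod, hjpow, hκF, hjθ, hκL]
        rw [← D.norm_eq_prod_frob hφ hF, ← H.norm_base, hxy]))
    obtain ⟨z, rfl⟩ := hdescE w hwφ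
    refine ⟨z, by rw [← hκ, hj, hw1], (algebraMap F Ω).injective ?_⟩
    rw [GaloisLift.norm_compositum D H hcomp hF, ← hκF, ← hw, map_prod]
    simp only [hjθ, hκ]
  · intro u hu
    obtain ⟨w, hwG, hwφ, hw1, hw⟩ := DE.exists_prod_iterate_eq_of_descent hc hn hdesc
      (u := κ (algebraMap K M u)) (fun g => j.injective (by rw [hjθ, hκK, AlgEquiv.commutes]))
      (j.injective (by rw [hjΦ, hκK, AlgEquiv.commutes]))
      (by rw [← hj, hκK, norm_algebraMap', hu])
    obtain ⟨z, rfl⟩ := hdescE w hwφ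
    obtain ⟨x, hx⟩ := GaloisLift.mem_range_of_fixed' D H hcomp hF (z := z) fun g => by
      rw [← hκ, ← hjθ, hwG]
    refine ⟨x, by rw [hx, ← hκ, hj, hw1], (algebraMap K Ω).injective ?_⟩
    rw [D.norm_eq_prod_frob hφ hF, ← hκK, ← hw, map_prod]
    simp only [hjpow, hκ, hx]

/-- The comparison of norms on units for a totally ramified abelian extension `L` and an unramified
extension `F` of `K`. -/
theorem norm_units (D : ResidueData K Ω p q)
    (hcomp : Algebra.adjoin K (Set.range (algebraMap F M) ∪ Set.range (algebraMap L M)) = ⊤)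
    {G : Type*} [CommGroup G] [Fintype G] (e : G ≃* (L ≃ₐ[K] L)) {π : L}
    (hπ0 : 0 < ‖algebraMap L Ω π‖) (hπ1 : ‖algebraMap L Ω π‖ < 1)
    (hL : ∀ a : L, a ≠ 0 → ∃ k : ℤ, ‖algebraMap L Ω a‖ = ‖algebraMap L Ω π‖ ^ k)
    (hK : ∀ a : K, a ≠ 0 → ∃ k : ℤ, ‖a‖ = (‖algebraMap L Ω π‖ ^ Module.finrank K L) ^ k)
    (hF : ∀ a : F, a ≠ 0 → ∃ c : K, ‖algebraMap F Ω a‖ = ‖c‖) :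
    (∀ (x : F) (y : L), ‖algebraMap F Ω x‖ = 1 → ‖algebraMap L Ω y‖ = 1 →
      Algebra.norm K x = Algebra.norm K y →
      ∃ z : M, ‖algebraMap M Ω z‖ = 1 ∧ x = Algebra.norm F z) ∧
    ∀ u : K, ‖u‖ = 1 → ∃ x : F, ‖algebraMap F Ω x‖ = 1 ∧ Algebra.norm K x = u := by
  have hn : Module.finrank K L ≠ 0 := Module.finrank_pos.ne'
  have hcard : Nat.card G = Module.finrank K L := by
    rw [Nat.card_congr e.toEquiv, IsGalois.card_aut_eq_finrank]
  have hFT : ∀ x : F, algebraMap F Ω x ∈ teichField K Ω q :=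
    D.mem_teichField_of_unramified (pow_pos hπ0 _) (pow_lt_one₀ hπ0.le hπ1 hn) hK hF
  obtain ⟨φ, hφ⟩ := D.exists_frobenius (D.frob_of_totallyRamified hπ0 hπ1 hK)
  have hφL : ∀ a : L, φ.restrictScalars K (algebraMap L Ω a) = algebraMap L Ω a := φ.commutes
  obtain ⟨θ, H⟩ := D.exists_galoisLift (φ := φ.restrictScalars K) hφ hφL e
  have DE := D.frobeniusData (φ := φ.restrictScalars K) hφ hφL H hπ0 hπ1 hL (hcard ▸ hK)
  let _ := H.action
  refine D.norm_units_of_model (E := teichField L Ω q) hφ hφL hcomp hFT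
    (j := algebraMap (teichField L Ω q) Ω) (fun x => rfl) (Φ := frobAut q _ hφL) (fun x => rfl)
    (κ := (algebraMap M Ω).codRestrict (teichField L Ω q) (compositum_mem_teichField hcomp hFT))
    (fun z => rfl) (fun ζ hζ => ⟨⟨ζ, IntermediateField.subset_adjoin _ _ hζ⟩, rfl⟩) H
    (fun g x => rfl) (ϖ := algebraMap L (teichField L Ω q) π) (π := π) rfl DE

end ResidueData

end NormUnits

section ResidueFinite

/-- An ultrametric field with finite residue field carries residue data. -/
lemma exists_residueData {K Ω : Type*} [NormedField K] [IsUltrametricDist K] [NormedField Ω]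
    [NormedAlgebra K Ω]
    (hres : ∃ S : Finset K, ∀ x : K, ‖x‖ ≤ 1 → ∃ s ∈ S, ‖x - s‖ < 1)
    (inv : ∀ (σ : Ω ≃ₐ[K] Ω) (x : Ω), ‖σ x‖ = ‖x‖) : ∃ p q, ResidueData K Ω p q := by
  classical
  obtain ⟨S, hS⟩ := hres
  let f : S → ResField K := fun s =>
    if h : ‖(s : K)‖ ≤ 1 then IsLocalRing.residue (unitBall K) ⟨s, mem_unitBall.2 h⟩ else 0
  have hf : Function.Surjective f := fun r => by
    obtain ⟨x, rfl⟩ := IsLocalRing.residue_surjective r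
    obtain ⟨s, hs, hxs⟩ := hS x (mem_unitBall.1 x.2)
    have hs1 : ‖s‖ ≤ 1 := by
      have := IsUltrametricDist.norm_add_le_max (x : K) (s - x)
      rw [add_sub_cancel, norm_sub_rev] at this
      exact this.trans (max_le (mem_unitBall.1 x.2) hxs.le)
    refine ⟨⟨s, hs⟩, ?_⟩
    simp only [f, hs1, dite_true]
    refine ((residue_eq_iff _ _).2 ?_).symm
    exact hxs
  have : Finite (ResField K) := Finite.of_surjective f hf
  let _ := Fintype.ofFinite (ResField K)
  obtain ⟨p, hp⟩ := CharP.exists (ResField K)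
  obtain ⟨n, hprime, hcard⟩ := FiniteField.card (ResField K) p
  let g : ResField K → unitBall K :=
    Function.surjInv (IsLocalRing.residue_surjective (R := unitBall K))
  have hg : ∀ r, IsLocalRing.residue (unitBall K) (g r) = r := Function.surjInv_eq _
  have hgi : Function.Injective fun r => (g r : K) := fun a b h => by
    rw [← hg a, ← hg b, Subtype.ext h]
  refine ⟨p, p ^ (n : ℕ), hprime, ⟨n, n.ne_zero, rfl⟩, ?_, fun a ha => ?_,
    ⟨Finset.univ.map ⟨_, hgi⟩, ?_, ?_, ?_⟩, inv⟩
  · rw [← map_natCast (algebraMap K Ω), norm_algebraMap']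
    have := (residue_eq_zero_iff ((p : ℕ) : unitBall K)).1 (by simp)
    simpa using this
  · have := (residue_eq_iff (⟨a, mem_unitBall.2 ha⟩ ^ p ^ (n : ℕ)) ⟨a, mem_unitBall.2 ha⟩).1 (by
      rw [map_pow, ← hcard, FiniteField.pow_card])
    simpa using this
  · rw [Finset.card_map, Finset.card_univ, hcard]
  · intro s hs
    obtain ⟨r, -, rfl⟩ := Finset.mem_map.1 hs
    exact mem_unitBall.1 (g r).2
  · intro s hs t ht hst
    obtain ⟨r, -, rfl⟩ := Finset.mem_map.1 hs
    obtain ⟨r', -, rfl⟩ := Finset.mem_map.1 ht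
    have := (residue_eq_iff (g r) (g r')).2 hst
    rw [hg, hg] at this
    rw [this]

end ResidueFinite

section DiscreteValuation

open WithZeroMulInt

/-- The real absolute value `2 ^ (log v x)` attached to a discrete valuation. -/
noncomputable def Valuation.realAbs {X : Type*} [Field X] (v : Valuation X Γ₀) (x : X) : ℝ :=
  toNNReal (e := 2) two_ne_zero (v x)

namespace Valuation

variable {X : Type*} [Field X] (v : Valuation X Γ₀)

lemma realAbs_nonneg (x : X) : 0 ≤ v.realAbs x := NNReal.coe_nonneg _

lemma realAbs_le_iff {x y : X} : v.realAbs x ≤ v.realAbs y ↔ v x ≤ v y := by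
  rw [realAbs, realAbs, NNReal.coe_le_coe]
  exact (toNNReal_strictMono (e := 2) one_lt_two).le_iff_le

lemma realAbs_mul (x y : X) : v.realAbs (x * y) = v.realAbs x * v.realAbs y := by
  simp [realAbs]

lemma realAbs_one : v.realAbs 1 = 1 := by simp [realAbs]

lemma realAbs_eq_zero {x : X} : v.realAbs x = 0 ↔ x = 0 := by
  simp [realAbs]

lemma realAbs_add_le (x y : X) : v.realAbs (x + y) ≤ max (v.realAbs x) (v.realAbs y) := by
  rw [le_max_iff, realAbs_le_iff, realAbs_le_iff, ← le_max_iff]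
  exact v.map_add x y

lemma realAbs_eq_one_iff {x : X} : v.realAbs x = 1 ↔ v x = 1 := by
  rw [realAbs, NNReal.coe_eq_one]
  exact toNNReal_eq_one_iff _ _ (by norm_num)

lemma realAbs_lt_one_iff {x : X} : v.realAbs x < 1 ↔ v x < 1 := by
  rw [← not_le, ← not_le, ← v.map_one, ← realAbs_one v, realAbs_le_iff]

lemma realAbs_le_one_iff {x : X} : v.realAbs x ≤ 1 ↔ v x ≤ 1 := by
  rw [← v.map_one, ← realAbs_one v, realAbs_le_iff]

lemma exists_eq_zpow_uniformizer {π : X}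
    (hπ : v π = ((Multiplicative.ofAdd (-1 : ℤ) : Multiplicative ℤ) : Γ₀)) {x : X} (hx : x ≠ 0) :
    ∃ k : ℤ, v x = v (π ^ k) := by
  obtain ⟨a, ha⟩ := WithZero.ne_zero_iff_exists.1 (v.ne_zero_iff.2 hx)
  refine ⟨-a.toAdd, ?_⟩
  rw [map_zpow₀, hπ, ← ha, ← WithZero.coe_zpow, ← ofAdd_zsmul]
  simp

variable {K : Type*} [NontriviallyNormedField K] [CompleteSpace K] [IsUltrametricDist K]
  {Ω : Type*} [NormedField Ω] [NormedAlgebra K Ω] [Algebra K X] [Algebra X Ω]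
  [IsScalarTower K X Ω] [Algebra.IsAlgebraic K X]

/-- Uniqueness of the extension of the absolute value of a complete field, up to rescaling. -/
lemma norm_pow_eq_realAbs {m : ℕ} (hm : m ≠ 0)
    (h : ∀ x : K, v.realAbs (algebraMap K X x) = ‖x‖ ^ m) (x : X) :
    ‖algebraMap X Ω x‖ ^ m = v.realAbs x := by
  let f : AbsoluteValue X ℝ :=
    { toFun := fun x => v.realAbs x ^ (m⁻¹ : ℝ)
      map_mul' := fun x y => by
        rw [realAbs_mul, Real.mul_rpow (v.realAbs_nonneg _) (v.realAbs_nonneg _)]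
      nonneg' := fun x => Real.rpow_nonneg (v.realAbs_nonneg _) _
      eq_zero' := fun x => by
        rw [Real.rpow_eq_zero (v.realAbs_nonneg _) (by positivity), realAbs_eq_zero]
      add_le' := fun x y => by
        have h0 := Real.rpow_nonneg (v.realAbs_nonneg x) (m⁻¹ : ℝ)
        have h1 := Real.rpow_nonneg (v.realAbs_nonneg y) (m⁻¹ : ℝ)
        rcases le_max_iff.1 (v.realAbs_add_le x y) with h | h
        · have := Real.rpow_le_rpow (v.realAbs_nonneg _) h (z := (m⁻¹ : ℝ)) (by positivity)
          linarith
        · have := Real.rpow_le_rpow (v.realAbs_nonneg _) h (z := (m⁻¹ : ℝ)) (by positivity)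
          linarith }
  have hf : ∀ x : X, f x = v.realAbs x ^ (m⁻¹ : ℝ) := fun x => rfl
  let g : AbsoluteValue X ℝ :=
    { toFun := fun x => ‖algebraMap X Ω x‖
      map_mul' := fun x y => by simp
      nonneg' := fun x => _root_.norm_nonneg _
      eq_zero' := fun x => by simp
      add_le' := fun x y => by rw [map_add]; exact _root_.norm_add_le _ _ }
  have hfx := spectralNorm_unique_field_norm_ext (K := K) (f := f) (fun x => by
    rw [hf, h, Real.pow_rpow_inv_natCast (_root_.norm_nonneg _) hm]) x
  have hgx := spectralNorm_unique_field_norm_ext (K := K) (f := g) (fun x => by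
    change ‖algebraMap X Ω (algebraMap K X x)‖ = _
    rw [← IsScalarTower.algebraMap_apply, norm_algebraMap']) x
  change ‖algebraMap X Ω x‖ = _ at hgx
  rw [hgx, ← hfx, hf, Real.rpow_inv_natCast_pow (v.realAbs_nonneg _) hm]

lemma norm_eq_one_iff_of_realAbs {m : ℕ} (hm : m ≠ 0)
    (h : ∀ x : K, v.realAbs (algebraMap K X x) = ‖x‖ ^ m) (x : X) :
    ‖algebraMap X Ω x‖ = 1 ↔ v x = 1 := by
  rw [← realAbs_eq_one_iff, ← v.norm_pow_eq_realAbs (Ω := Ω) hm h,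
    pow_eq_one_iff_of_nonneg (_root_.norm_nonneg _) hm]

end Valuation

/-- The rank one structure on a discrete valuation given by `toNNReal`. -/
@[reducible] noncomputable def rankOneOfUniformizer {K : Type*} [Field K] (v : Valuation K Γ₀)
    (h : ∃ π : K, v π = ((Multiplicative.ofAdd (-1 : ℤ) : Multiplicative ℤ) : Γ₀)) :
    Valuation.RankOne v where
  hom' := (toNNReal (e := 2) two_ne_zero).comp MonoidWithZeroHom.ValueGroup₀.embedding
  strictMono' := (toNNReal_strictMono (e := 2) one_lt_two).comp
    MonoidWithZeroHom.ValueGroup₀.embedding_strictMono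
  exists_val_nontrivial := by
    obtain ⟨π, hπ⟩ := h
    refine ⟨π, ?_, ?_⟩
    · rw [hπ]; exact WithZero.coe_ne_zero
    · rw [hπ]; intro h; rw [← WithZero.coe_one, WithZero.coe_inj] at h; exact absurd h (by decide)

lemma Valuation.realAbs_uniformizer {X : Type*} [Field X] {v : Valuation X Γ₀} {π : X}
    (hπ : v π = ((Multiplicative.ofAdd (-1 : ℤ) : Multiplicative ℤ) : Γ₀)) :
    0 < v.realAbs π ∧ v.realAbs π < 1 := by
  refine ⟨(v.realAbs_nonneg _).lt_of_ne' fun h => ?_, v.realAbs_lt_one_iff.2 ?_⟩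
  · rw [v.realAbs_eq_zero] at h
    rw [h, map_zero] at hπ
    exact WithZero.coe_ne_zero hπ.symm
  · rw [hπ, ← WithZero.coe_one, WithZero.coe_lt_coe]
    decide

open Valuation in
/-- The comparison of unit norms in terms of normalized discrete valuations. -/
theorem ResidueData.norm_units_of_valuation {K F L M Ω : Type*} [NontriviallyNormedField K]
    [CompleteSpace K] [IsUltrametricDist K] [NormedField Ω] [NormedAlgebra K Ω]
    [IsUltrametricDist Ω] {p q : ℕ} [Field F] [Field L] [Field M] [Algebra F M] [Algebra L M]
    [Algebra K F] [Algebra K L] [Algebra K M] [IsScalarTower K F M] [IsScalarTower K L M]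
    [Algebra F Ω] [Algebra L Ω] [Algebra M Ω] [IsScalarTower K F Ω] [IsScalarTower K L Ω]
    [IsScalarTower F M Ω] [IsScalarTower L M Ω] [IsScalarTower K M Ω]
    [Algebra.IsAlgebraic K Ω] [IsAlgClosed Ω] [FiniteDimensional K F] [FiniteDimensional K L]
    [FiniteDimensional F M] [IsGalois K L] (hab : ∀ σ τ : L ≃ₐ[K] L, σ * τ = τ * σ)
    (D : ResidueData K Ω p q)
    (vK : Valuation K Γ₀) (vF : Valuation F Γ₀) (vL : Valuation L Γ₀) (vM : Valuation M Γ₀)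
    (hv : ∀ x : K, vK.realAbs x = ‖x‖)
    (hdK : ∃ π : K, vK π = ((Multiplicative.ofAdd (-1 : ℤ) : Multiplicative ℤ) : Γ₀))
    (hdL : ∃ π : L, vL π = ((Multiplicative.ofAdd (-1 : ℤ) : Multiplicative ℤ) : Γ₀))
    (htr : ∀ x : K, vL (algebraMap K L x) = vK x ^ Module.finrank K L)
    (hur : ∀ x : K, vF (algebraMap K F x) = vK x)
    (hurL : ∀ x : L, vM (algebraMap L M x) = vL x)
    (hcomp : Algebra.adjoin K (Set.range (algebraMap F M) ∪ Set.range (algebraMap L M)) = ⊤) :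
    (∀ (x : F) (y : L), vF x = 1 → vL y = 1 → Algebra.norm K x = Algebra.norm K y →
      ∃ z : M, vM z = 1 ∧ x = Algebra.norm F z) ∧
    ∀ u : K, vK u = 1 → ∃ x : F, vF x = 1 ∧ Algebra.norm K x = u := by
  let _ : CommGroup (L ≃ₐ[K] L) := { (inferInstance : Group (L ≃ₐ[K] L)) with mul_comm := hab }
  have : FiniteDimensional K M := FiniteDimensional.trans K F M
  have hn : Module.finrank K L ≠ 0 := Module.finrank_pos.ne'
  have hrF : ∀ x : K, vF.realAbs (algebraMap K F x) = ‖x‖ ^ 1 := fun x => by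
    rw [pow_one, ← hv, realAbs, realAbs, hur]
  have hrL : ∀ x : K, vL.realAbs (algebraMap K L x) = ‖x‖ ^ Module.finrank K L := fun x => by
    rw [← hv, realAbs, realAbs, htr, map_pow, NNReal.coe_pow]
  have hrM : ∀ x : K, vM.realAbs (algebraMap K M x) = ‖x‖ ^ Module.finrank K L := fun x => by
    rw [← hrL, IsScalarTower.algebraMap_apply K L M, realAbs, realAbs, hurL]
  have hF := vF.norm_pow_eq_realAbs (Ω := Ω) one_ne_zero hrF
  have hL := vL.norm_pow_eq_realAbs (Ω := Ω) hn hrL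
  obtain ⟨ϖ, hϖ⟩ := hdK
  obtain ⟨π, hπ⟩ := hdL
  obtain ⟨hπ0, hπ1⟩ := realAbs_uniformizer hπ
  rw [← hL] at hπ0 hπ1
  have hϖπ : ‖ϖ‖ = ‖algebraMap L Ω π‖ ^ Module.finrank K L := by
    rw [hL, ← hv, realAbs, realAbs, hϖ, hπ]
  have key := D.norm_units (F := F) hcomp (MulEquiv.refl (L ≃ₐ[K] L)) (π := π)
    ((_root_.norm_nonneg _).lt_of_ne' fun h => by rw [h, zero_pow hn] at hπ0; exact hπ0.false)
    ((pow_lt_one_iff_of_nonneg (_root_.norm_nonneg _) hn).1 hπ1)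
    (fun a ha => by
      obtain ⟨k, hk⟩ := vL.exists_eq_zpow_uniformizer hπ ha
      refine ⟨k, (pow_left_inj₀ (_root_.norm_nonneg _)
        (zpow_nonneg (_root_.norm_nonneg _) _) hn).1 ?_⟩
      rw [← norm_zpow, ← map_zpow₀, hL, hL, realAbs, realAbs, hk])
    (fun a ha => by
      obtain ⟨k, hk⟩ := vK.exists_eq_zpow_uniformizer hϖ ha
      refine ⟨k, ?_⟩
      rw [← hϖπ, ← norm_zpow, ← hv, ← hv, realAbs, realAbs, hk])
    (fun a ha => by
      obtain ⟨k, hk⟩ := vF.exists_eq_zpow_uniformizer ((hur ϖ).trans hϖ) ha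
      refine ⟨ϖ ^ k, ?_⟩
      rw [← pow_one ‖algebraMap F Ω a‖, hF, ← hv, realAbs, realAbs, hk, ← map_zpow₀, hur])
  refine ⟨fun x y hx hy hxy => ?_, fun u hu => ?_⟩
  · obtain ⟨z, hz, h⟩ := key.1 x y
      ((vF.norm_eq_one_iff_of_realAbs one_ne_zero hrF x).2 hx)
      ((vL.norm_eq_one_iff_of_realAbs hn hrL y).2 hy) hxy
    exact ⟨z, (vM.norm_eq_one_iff_of_realAbs hn hrM z).1 hz, h⟩
  · obtain ⟨x, hx, h⟩ := key.2 u (by rw [← hv, realAbs_eq_one_iff, hu])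
    exact ⟨x, (vF.norm_eq_one_iff_of_realAbs one_ne_zero hrF x).1 hx, h⟩

end DiscreteValuation

end

/-- Let `K` be a local field (complete discretely valued with finite residue field),
`L/K` a finite totally ramified abelian extension of degree `n`, `K'/K` the unramified
extension of degree `n`, and `L' = K'L`.  Then the norm `N_{K'/K}` induces an
isomorphism `O_{K'}^×/N_{L'/K'}(O_{L'}^×) ≅ O_K^×/N_{L/K}(O_L^×)`.  Units of the
valuation rings are the elements of valuation `1`; injectivity and surjectivity of the
induced map are stated elementwise. -/
theorem stmt4 (K K' L L' : Type*) [Field K] [Field K'] [Field L] [Field L']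
    [Valued K Γ₀] [Valued K' Γ₀] [Valued L Γ₀] [Valued L' Γ₀] [CompleteSpace K]
    [Algebra K L] [Algebra K K'] [Algebra K' L'] [Algebra L L'] [Algebra K L']
    [IsScalarTower K K' L'] [IsScalarTower K L L']
    [FiniteDimensional K L] [FiniteDimensional K K'] [FiniteDimensional K' L']
    [IsGalois K L] (hab : ∀ σ τ : L ≃ₐ[K] L, σ * τ = τ * σ)
    -- normalized discrete valuations
    (hdK : ∃ π : K, Valued.v π =
      ((Multiplicative.ofAdd (-1 : ℤ) : Multiplicative ℤ) : Γ₀))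
    (hdK' : ∃ π : K', Valued.v π =
      ((Multiplicative.ofAdd (-1 : ℤ) : Multiplicative ℤ) : Γ₀))
    (hdL : ∃ π : L, Valued.v π =
      ((Multiplicative.ofAdd (-1 : ℤ) : Multiplicative ℤ) : Γ₀))
    (hdL' : ∃ π : L', Valued.v π =
      ((Multiplicative.ofAdd (-1 : ℤ) : Multiplicative ℤ) : Γ₀))
    -- the residue field of `K` is finite
    (hres : ∃ S : Finset K, ∀ x : K, Valued.v x ≤ 1 → ∃ s ∈ S, Valued.v (x - s) < 1)
    -- `L/K` is totally ramified of degree `n = [L : K]`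
    (htr : ∀ x : K, Valued.v (algebraMap K L x) = (Valued.v x) ^ (Module.finrank K L))
    -- `K'/K` is unramified of degree `n`
    (hur : ∀ x : K, Valued.v (algebraMap K K' x) = Valued.v x)
    (hdeg : Module.finrank K K' = Module.finrank K L)
    -- `L'/L` is unramified and `L' = K'L` is the compositum
    (hurL : ∀ x : L, Valued.v (algebraMap L L' x) = Valued.v x)
    (hcomp : Algebra.adjoin K
      (Set.range (algebraMap K' L') ∪ Set.range (algebraMap L L')) =
        (⊤ : Subalgebra K L')) :
    (∀ x : K', Valued.v x = 1 →
        (∃ y : L, Valued.v y = 1 ∧ Algebra.norm K x = Algebra.norm K y) →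
        ∃ z : L', Valued.v z = 1 ∧ x = Algebra.norm K' z) ∧
      (∀ u : K, Valued.v u = 1 →
        ∃ x : K', Valued.v x = 1 ∧
          ∃ y : L, Valued.v y = 1 ∧ Algebra.norm K x = u * Algebra.norm K y) := by
  let _ := rankOneOfUniformizer (Valued.v : Valuation K Γ₀) hdK
  let _ : NontriviallyNormedField K := Valued.toNontriviallyNormedField K Γ₀
  have : IsUltrametricDist K := ⟨fun x y z => by
    simpa [dist_eq_norm] using Valued.isNonarchimedean_norm K Γ₀ (x - y) (y - z)⟩
  have hv : ∀ x : K, (Valued.v : Valuation K Γ₀).realAbs x = ‖x‖ := fun x => by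
    change _ = ((WithZeroMulInt.toNNReal (e := 2) two_ne_zero
      (MonoidWithZeroHom.ValueGroup₀.embedding (Valued.v.restrict x)) : NNReal) : ℝ)
    rw [Valuation.embedding_restrict, Valuation.realAbs]
  have : FiniteDimensional K L' := FiniteDimensional.trans K K' L'
  have : Algebra.IsAlgebraic K (AlgebraicClosure L') := Algebra.IsAlgebraic.trans K L' _
  let _ : NormedField (AlgebraicClosure L') := spectralNorm.normedField K (AlgebraicClosure L')
  let _ : NormedAlgebra K (AlgebraicClosure L') :=
    spectralNorm.normedAlgebra K (AlgebraicClosure L')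
  have : IsUltrametricDist (AlgebraicClosure L') :=
    IsUltrametricDist.isUltrametricDist_of_isNonarchimedean_norm isNonarchimedean_spectralNorm
  obtain ⟨p, q, D⟩ := exists_residueData (K := K) (Ω := AlgebraicClosure L')
    (by simpa [← hv, Valuation.realAbs_le_one_iff, Valuation.realAbs_lt_one_iff] using hres)
    (fun σ x => (spectralNorm_eq_of_equiv σ x).symm)
  have key := D.norm_units_of_valuation (F := K') (L := L) (M := L') hab Valued.v Valued.v
    Valued.v Valued.v hv hdK hdL htr hur hurL hcomp
  refine ⟨fun x hx ⟨y, hy, hxy⟩ => key.1 x y hx hy hxy, fun u hu => ?_⟩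
  obtain ⟨x, hx, h⟩ := key.2 u hu
  exact ⟨x, hx, 1, map_one _, by rw [h, map_one, mul_one]⟩
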